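/- Let U_B ⊂ U(4) be a partially invertible universal set with a = |U_M|/|U_B|, let t ≥ 1 be an integer, n ≥ ⌊2.5·log₂(4t)⌋, ε' < 1 − P(t), some constant 0 < C < 1, and k ≥ (10t + n²t − nt + n + log₂(1/ε')) / log₂(1/(1+(C−1)a)). Then the n-qubit random unitary ensemble block(B₁), where B₁ is the uniform ensemble on the relaxed seed U^k, is an (η, t)-tensor product expander with η = (P(t) + ε')/(1 − a^k)^{n−1} + (1 − (1 − a^k)^{n−1})/(1 − a^k)^{n−1}. -/

import Mathlib

open MeasureTheory Matrix
open scoped Classical ComplexOrder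

noncomputable section

/-- We equip the unitary group with its Borel σ-algebra. -/
instance unitaryGroupMeasurableSpace {ξ : Type*} [Fintype ξ] [DecidableEq ξ] :
    MeasurableSpace (Matrix.unitaryGroup ξ ℂ) := borel _

instance unitaryGroupBorelSpace {ξ : Type*} [Fintype ξ] [DecidableEq ξ] :
    BorelSpace (Matrix.unitaryGroup ξ ℂ) := ⟨rfl⟩

/-- The spectral-gap bound
`P(t) = (1 + (1/2)·(425·⌊log₂(4t)⌋²·t⁵·t^{3.1/ln 2})⁻¹)^{-1/3}`. -/
def Pgap (t : ℕ) : ℝ :=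
  (1 + (1 / 2) * (425 * ((⌊Real.logb 2 (4 * t)⌋ : ℤ) : ℝ) ^ 2 * (t : ℝ) ^ 5 *
      (t : ℝ) ^ ((3.1 : ℝ) / Real.log 2))⁻¹) ^ (-(1 / 3 : ℝ))

/-- The moment matrix `U^{⊗t} ⊗ U^{*⊗t}` (entrywise description). -/
def momentMat {ξ : Type*} [Fintype ξ] (t : ℕ) (U : Matrix ξ ξ ℂ) :
    Matrix ((Fin t → ξ) × (Fin t → ξ)) ((Fin t → ξ) × (Fin t → ξ)) ℂ :=
  fun x y => (∏ s, U (x.1 s) (y.1 s)) * ∏ s, (starRingEnd ℂ) (U (x.2 s) (y.2 s))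

/-- The Haar moment superoperator `∫ U^{⊗t} ⊗ U^{*⊗t} dμ(U)`, defined entrywise. -/
def haarMomentMat {ξ : Type*} [Fintype ξ] [DecidableEq ξ] (t : ℕ)
    (μ : Measure (Matrix.unitaryGroup ξ ℂ)) :
    Matrix ((Fin t → ξ) × (Fin t → ξ)) ((Fin t → ξ) × (Fin t → ξ)) ℂ :=
  fun x y => ∫ U, momentMat t ((U : Matrix ξ ξ ℂ)) x y ∂μ

/-- The ℓ²→ℓ² operator norm `‖·‖_∞` of a matrix. -/
def opNorm {ι : Type*} [Fintype ι] [DecidableEq ι] (A : Matrix ι ι ℂ) : ℝ :=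
  ‖Matrix.toEuclideanCLM (𝕜 := ℂ) A‖

/-- An ensemble `{p i, V i}` is an `(η, t)`-tensor product expander:
`‖M_t[μ] − M_t[μ_H]‖_∞ ≤ η`. -/
def IsTPE {ξ : Type*} [Fintype ξ] [DecidableEq ξ] {ι : Type*} [Fintype ι]
    (t : ℕ) (η : ℝ) (μH : Measure (Matrix.unitaryGroup ξ ℂ))
    (p : ι → ℝ) (V : ι → Matrix ξ ξ ℂ) : Prop :=
  opNorm (∑ i, (p i : ℂ) • momentMat t (V i) - haarMomentMat t μH) ≤ η

/-- Index of a pair of qubit basis states as a basis state of `ℂ⁴`. -/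
def pairIdx (x y : Fin 2) : Fin 4 := ⟨2 * x.val + y.val, by omega⟩

/-- The `n`-qubit matrix which applies the two-qubit gate `U` to the (distinct) qubits
`q, q'` and acts as the identity on all other qubits. -/
def applyGate (n : ℕ) (q q' : Fin n) (U : Matrix (Fin 4) (Fin 4) ℂ) :
    Matrix (Fin n → Fin 2) (Fin n → Fin 2) ℂ :=
  fun x y =>
    if (∀ r, r ≠ q → r ≠ q' → x r = y r) then
      U (pairIdx (x q) (x q')) (pairIdx (y q) (y q')) else 0

/-- One block: a first layer of nearest-neighbour two-qubit gates `f i` on qubit pairs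
`(0,1), (2,3), …`, followed by a second layer of gates `g i` on qubit pairs
`(1,2), (3,4), …` (`n` even; odd `n` analogous, the last qubit pair being dropped). -/
def blockUnitary (n : ℕ)
    (f : Fin (n / 2) → Matrix (Fin 4) (Fin 4) ℂ)
    (g : Fin ((n - 1) / 2) → Matrix (Fin 4) (Fin 4) ℂ) :
    Matrix (Fin n → Fin 2) (Fin n → Fin 2) ℂ :=
  (List.ofFn fun i : Fin ((n - 1) / 2) =>
      applyGate n ⟨2 * i.val + 1, by omega⟩ ⟨2 * i.val + 2, by omega⟩ (g i)).prod *
  (List.ofFn fun i : Fin (n / 2) =>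
      applyGate n ⟨2 * i.val, by omega⟩ ⟨2 * i.val + 1, by omega⟩ (f i)).prod

/-- The product `U_{f 0} ⋯ U_{f (k-1)}` of a word of unitaries, as a `4 × 4` matrix. -/
def wordMat {k : ℕ} (f : Fin k → Matrix.unitaryGroup (Fin 4) ℂ) :
    Matrix (Fin 4) (Fin 4) ℂ :=
  (List.ofFn fun i => ((f i : Matrix (Fin 4) (Fin 4) ℂ))).prod

/-- A word of length `k` over the seed `UB` with at least one letter outside `UM`:
the index set of the uniform ensemble `B₁` on the relaxed seed `𝒰^k = 𝒰_{B^k} ∖ 𝒰_{M^k}`. -/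
abbrev RelaxedWord (UB UM : Finset (Matrix.unitaryGroup (Fin 4) ℂ)) (k : ℕ) :=
  {f : Fin k → {x // x ∈ UB} // ∃ i, (f i : Matrix.unitaryGroup (Fin 4) ℂ) ∉ UM}

instance relaxedWordFintype (UB UM : Finset (Matrix.unitaryGroup (Fin 4) ℂ)) (k : ℕ) :
    Fintype (RelaxedWord UB UM k) :=
  inferInstance

set_option linter.unusedSectionVars false

namespace TPE

section Abstract
variable {E : Type*} [NormedAddCommGroup E] [InnerProductSpace ℂ E] [FiniteDimensional ℂ E]

lemma gap_of_eigen (T : E →ₗ[ℂ] E) (hT : T.IsSymmetric) (V : Submodule ℂ E) (s : ℝ)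
    (h : ∀ (v : E) (l : ℝ), T v = (l : ℂ) • v → l < s → v ∈ V) :
    ∀ v ∈ Vᗮ, s * ‖v‖ ^ 2 ≤ (inner ℂ v (T v)).re := by
  intro v hv
  set b := hT.eigenvectorBasis rfl with hb
  have h1 : ∀ i, inner ℂ (b i) (T v) = (hT.eigenvalues rfl i : ℂ) * inner ℂ (b i) v := by
    intro i
    rw [← hT, hb, hT.apply_eigenvectorBasis, inner_smul_left]
    simp
  rw [← b.sum_inner_mul_inner v (T v), Complex.re_sum, ← b.sum_sq_norm_inner_right v,
    Finset.mul_sum]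
  apply Finset.sum_le_sum
  intro i _
  rw [h1, mul_left_comm, ← inner_conj_symm v (b i), mul_comm ((starRingEnd ℂ) _), Complex.mul_conj]
  rw [Complex.normSq_eq_norm_sq]
  norm_cast
  by_cases hi : hT.eigenvalues rfl i < s
  · have : b i ∈ V := h _ _ (hT.apply_eigenvectorBasis rfl i) hi
    have h0 : inner ℂ (b i) v = 0 := hv _ this
    rw [h0]; simp
  · push Not at hi
    gcongr

lemma norm_of_eigen (T : E →ₗ[ℂ] E) (hT : T.IsSymmetric) (c : ℝ) (hc : 0 ≤ c)
    (h : ∀ (v : E) (l : ℝ), v ≠ 0 → T v = (l : ℂ) • v → |l| ≤ c) (v : E) :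
    ‖T v‖ ≤ c * ‖v‖ := by
  set b := hT.eigenvectorBasis rfl with hb
  have h1 : ∀ i, inner ℂ (b i) (T v) = (hT.eigenvalues rfl i : ℂ) * inner ℂ (b i) v := by
    intro i
    rw [← hT, hb, hT.apply_eigenvectorBasis, inner_smul_left]
    simp
  have : ‖T v‖ ^ 2 ≤ (c * ‖v‖) ^ 2 := by
    rw [mul_pow, ← b.sum_sq_norm_inner_right v, ← b.sum_sq_norm_inner_right (T v), Finset.mul_sum]
    apply Finset.sum_le_sum
    intro i _
    rw [h1, norm_mul, mul_pow]
    have h2 := h (b i) _ (b.orthonormal.ne_zero i) (hT.apply_eigenvectorBasis rfl i)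
    gcongr
    simpa using h2
  exact le_of_sq_le_sq this (by positivity)

/-- the complementary projection -/
def cproj (V : Submodule ℂ E) (v : E) : E := v - V.starProjection v

lemma cproj_eq (V : Submodule ℂ E) (v : E) : cproj V v = Vᗮ.starProjection v := by
  rw [Submodule.starProjection_orthogonal']
  simp [cproj]

lemma inner_proj_symm (V : Submodule ℂ E) (v w : E) :
    inner ℂ (V.starProjection v) w = inner ℂ v (V.starProjection w) :=
  Submodule.inner_starProjection_left_eq_right V v w

lemma proj_idem (V : Submodule ℂ E) (v : E) :
    V.starProjection (V.starProjection v) = V.starProjection v :=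
  Submodule.starProjection_eq_self_iff.2 (Submodule.starProjection_apply_mem V v)

lemma proj_norm_le (V : Submodule ℂ E) (v : E) : ‖V.starProjection v‖ ≤ ‖v‖ :=
  Submodule.norm_starProjection_apply_le V v

lemma proj_pyth (V : Submodule ℂ E) (v : E) :
    ‖v‖ ^ 2 = ‖V.starProjection v‖ ^ 2 + ‖cproj V v‖ ^ 2 := by
  rw [cproj_eq]
  exact Submodule.norm_sq_eq_add_norm_sq_starProjection v V

lemma inner_cproj (V : Submodule ℂ E) (v : E) :
    (inner ℂ v (cproj V v)).re = ‖cproj V v‖ ^ 2 := by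
  rw [cproj_eq]
  have := inner_proj_symm Vᗮ v (Vᗮ.starProjection v)
  rw [proj_idem] at this
  rw [← this, ← inner_self_eq_norm_sq (𝕜 := ℂ)]
  rfl

lemma inner_proj (V : Submodule ℂ E) (v : E) :
    (inner ℂ v (V.starProjection v)).re = ‖V.starProjection v‖ ^ 2 := by
  have := inner_proj_symm V v (V.starProjection v)
  rw [proj_idem] at this
  rw [← this, ← inner_self_eq_norm_sq (𝕜 := ℂ)]
  rfl

lemma proj_of_le_left {V W : Submodule ℂ E} (h : V ≤ W) (v : E) :
    W.starProjection (V.starProjection v) = V.starProjection v :=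
  Submodule.starProjection_eq_self_iff.2 (h (Submodule.starProjection_apply_mem V v))

lemma proj_of_le_right {V W : Submodule ℂ E} (h : V ≤ W) (v : E) :
    V.starProjection (W.starProjection v) = V.starProjection v := by
  apply ext_inner_left ℂ
  intro w
  rw [← inner_proj_symm, ← inner_proj_symm, proj_of_le_left h, ← inner_proj_symm]

/-- an operator preserving `V` together with its adjoint commutes with the projection -/
lemma proj_comm_of_maps (V : Submodule ℂ E) (T T' : E →L[ℂ] E)
    (hadj : ∀ v w, inner ℂ (T v) w = inner ℂ v (T' w))
    (h : ∀ v ∈ V, T v ∈ V) (h' : ∀ v ∈ V, T' v ∈ V) (v : E) :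
    T (V.starProjection v) = V.starProjection (T v) := by
  have hort : ∀ w ∈ Vᗮ, T w ∈ Vᗮ := by
    intro w hw u hu
    have := hw (T' u) (h' u hu)
    rw [← inner_conj_symm, hadj, inner_conj_symm]
    exact this
  have hdec : T v = T (V.starProjection v) + T (cproj V v) := by
    rw [← map_add]; simp [cproj]
  have hc : cproj V v ∈ Vᗮ := by
    rw [cproj_eq]; exact Submodule.starProjection_apply_mem _ _
  rw [hdec, map_add, Submodule.starProjection_eq_self_iff.2
      (h _ (Submodule.starProjection_apply_mem V v)),
    (Submodule.starProjection_apply_eq_zero_iff V).2 (hort _ hc), add_zero]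

lemma proj_comm_of_ker (V : Submodule ℂ E) (F T : E →L[ℂ] E)
    (hT : ∀ v w, inner ℂ (T v) w = inner ℂ v (T w))
    (hker : ∀ v, v ∈ Vᗮ ↔ F v = 0) (hcomm : ∀ v, T (F v) = F (T v)) (v : E) :
    T (V.starProjection v) = V.starProjection (T v) := by
  have h1 : ∀ w ∈ Vᗮ, T w ∈ Vᗮ := by
    intro w hw
    rw [hker, ← hcomm, (hker w).1 hw, map_zero]
  have h2 := proj_comm_of_maps Vᗮ T T hT h1 h1 v
  rw [← cproj_eq, ← cproj_eq, cproj, cproj, map_sub] at h2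
  simpa using h2

end Abstract
end TPE

namespace TPE

section Abstract2
variable {E : Type*} [NormedAddCommGroup E] [InnerProductSpace ℂ E] [FiniteDimensional ℂ E]

lemma re_inner_le (x y : E) : (inner ℂ x y).re ≤ ‖x‖ * ‖y‖ :=
  re_inner_le_norm (𝕜 := ℂ) x y

lemma norm_add_sq_re (x y : E) :
    ‖x + y‖ ^ 2 = ‖x‖ ^ 2 + 2 * (inner ℂ x y).re + ‖y‖ ^ 2 :=
  norm_add_sq (𝕜 := ℂ) x y

lemma two_proj (V V1 V2 : Submodule ℂ E) (h1 : V ≤ V1) (h2 : V ≤ V2) (δ : ℝ) (hδ1 : δ < 1)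
    (hδ0 : 0 ≤ δ)
    (hδ : ∀ v, ‖V1.starProjection (V2.starProjection v) - V.starProjection v‖ ≤ δ * ‖v‖) (v : E) :
    -δ * (‖cproj V1 v‖ ^ 2 + ‖cproj V2 v‖ ^ 2) ≤ 2 * (inner ℂ (cproj V1 v) (cproj V2 v)).re := by
  have key : ∀ u ∈ Vᗮ, (1 - δ) * ‖u‖ ^ 2 ≤ ‖cproj V1 u‖ ^ 2 + ‖cproj V2 u‖ ^ 2 := by
    intro u hu
    set p1 := V1.starProjection u with hp1
    set p2 := V2.starProjection u with hp2
    have hVu : V.starProjection u = 0 := (Submodule.starProjection_apply_eq_zero_iff V).2 hu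
    have a1 : (inner ℂ p1 p2).re ≤ δ * (‖p1‖ * ‖p2‖) := by
      have e1 : inner ℂ p1 p2 = inner ℂ p1 (V1.starProjection (V2.starProjection p2)
          - V.starProjection p2) := by
        rw [hp2, proj_idem, proj_of_le_right h2, hVu, sub_zero, hp1,
          ← inner_proj_symm V1 (V1.starProjection u), proj_idem]
      rw [e1]
      calc _ ≤ _ := re_inner_le _ _
        _ ≤ ‖p1‖ * (δ * ‖p2‖) := by gcongr; exact hδ p2
        _ = _ := by ring
    have a2 : ‖p1 + p2‖ ^ 2 ≤ (1 + δ) * (‖p1‖ ^ 2 + ‖p2‖ ^ 2) := by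
      rw [norm_add_sq_re]
      nlinarith [sq_nonneg (‖p1‖ - ‖p2‖)]
    have a3 : ‖p1‖ ^ 2 + ‖p2‖ ^ 2 ≤ ‖u‖ * ‖p1 + p2‖ := by
      rw [hp1, hp2, ← inner_proj, ← inner_proj, ← Complex.add_re, ← inner_add_right]
      exact re_inner_le _ _
    have a4 : ‖p1‖ ^ 2 + ‖p2‖ ^ 2 ≤ (1 + δ) * ‖u‖ ^ 2 := by
      set S := ‖p1‖ ^ 2 + ‖p2‖ ^ 2
      have hS : 0 ≤ S := by positivity
      have : S ^ 2 ≤ (‖u‖ * ‖p1 + p2‖) ^ 2 := by gcongr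
      rw [mul_pow] at this
      have h3 : S ^ 2 ≤ ‖u‖ ^ 2 * ((1 + δ) * S) := this.trans (by gcongr)
      rcases hS.eq_or_lt with h0 | h0
      · rw [← h0]; positivity
      · have : S * S ≤ ((1 + δ) * ‖u‖ ^ 2) * S := by nlinarith
        exact le_of_mul_le_mul_right this h0
    have b1 := proj_pyth V1 u
    have b2 := proj_pyth V2 u
    nlinarith
  set u := cproj V v with hu
  have huV : u ∈ Vᗮ := by rw [hu, cproj_eq]; exact Submodule.starProjection_apply_mem _ _
  have c1 : cproj V1 v = cproj V1 u := by
    simp only [cproj, hu, map_sub, proj_of_le_left h1]; abel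
  have c2 : cproj V2 v = cproj V2 u := by
    simp only [cproj, hu, map_sub, proj_of_le_left h2]; abel
  rw [c1, c2]
  set s := ‖cproj V1 u‖ ^ 2 + ‖cproj V2 u‖ ^ 2 with hs
  have hs0 : 0 ≤ s := by positivity
  have d1 : s ≤ ‖u‖ * ‖cproj V1 u + cproj V2 u‖ := by
    rw [hs, ← inner_cproj, ← inner_cproj, ← Complex.add_re, ← inner_add_right]
    exact re_inner_le _ _
  have d2 := key u huV
  have d3 := norm_add_sq_re (cproj V1 u) (cproj V2 u)
  have d4 : (1 - δ) * s ≤ ‖cproj V1 u + cproj V2 u‖ ^ 2 := by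
    set N := ‖cproj V1 u + cproj V2 u‖
    have : s ^ 2 ≤ (‖u‖ * N) ^ 2 := by gcongr
    rw [mul_pow] at this
    rcases hs0.eq_or_lt with h0 | h0
    · rw [← h0]; simp; positivity
    · have : s * ((1 - δ) * s) ≤ s * N ^ 2 := by
        have : ((1 - δ) * ‖u‖ ^ 2) * N ^ 2 ≤ s * N ^ 2 := by gcongr
        nlinarith
      exact le_of_mul_le_mul_left this h0
  nlinarith

lemma chain_sum (x : ℕ → E) (δ : ℝ) (hδ0 : 0 ≤ δ)
    (hadj : ∀ j, -δ * (‖x j‖ ^ 2 + ‖x (j + 1)‖ ^ 2) ≤ 2 * (inner ℂ (x j) (x (j + 1))).re)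
    (hfar : ∀ j k, j + 2 ≤ k → 0 ≤ (inner ℂ (x j) (x k)).re) (J : ℕ) :
    (1 - 2 * δ) * ∑ j ∈ Finset.range J, ‖x j‖ ^ 2 ≤ ‖∑ j ∈ Finset.range J, x j‖ ^ 2 := by
  have main : ∀ J : ℕ, (1 - 2 * δ) * ∑ j ∈ Finset.range (J + 1), ‖x j‖ ^ 2 + δ * ‖x J‖ ^ 2
      ≤ ‖∑ j ∈ Finset.range (J + 1), x j‖ ^ 2 := by
    intro J
    induction J with
    | zero => simp; nlinarith [sq_nonneg ‖x 0‖]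
    | succ J ih =>
      rw [Finset.sum_range_succ, Finset.sum_range_succ x (J + 1), norm_add_sq_re]
      have h1 : (inner ℂ (x J) (x (J + 1))).re
          ≤ (inner ℂ (∑ j ∈ Finset.range (J + 1), x j) (x (J + 1))).re := by
        rw [Finset.sum_range_succ, inner_add_left, sum_inner, Complex.add_re, Complex.re_sum]
        have : 0 ≤ ∑ j ∈ Finset.range J, (inner ℂ (x j) (x (J + 1))).re :=
          Finset.sum_nonneg fun j hj => hfar _ _ (by
            have := Finset.mem_range.1 hj; omega)
        linarith
      have h2 := hadj J
      nlinarith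
  cases J with
  | zero => simp
  | succ J =>
    have := main J
    nlinarith [sq_nonneg ‖x J‖]

lemma comm_cproj_inner (V W : Submodule ℂ E)
    (h : ∀ v, V.starProjection (W.starProjection v) = W.starProjection (V.starProjection v))
    (v : E) : 0 ≤ (inner ℂ (cproj V v) (cproj W v)).re := by
  have h1 : cproj V (cproj W v) = cproj W (cproj V v) := by
    simp only [cproj, map_sub, h]; abel
  have h2 : inner ℂ (cproj V v) (cproj W v)
      = inner ℂ (cproj V (cproj W v)) (cproj V (cproj W v)) := by
    have sym : ∀ (V : Submodule ℂ E) (x y : E), inner ℂ (cproj V x) y = inner ℂ x (cproj V y) := by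
      intro V x y; rw [cproj_eq, cproj_eq, inner_proj_symm]
    have idem : ∀ (V : Submodule ℂ E) (x : E), cproj V (cproj V x) = cproj V x := by
      intro V x; simp only [cproj_eq, proj_idem]
    calc inner ℂ (cproj V v) (cproj W v)
        = inner ℂ (cproj V (cproj V v)) (cproj W (cproj W v)) := by rw [idem, idem]
      _ = inner ℂ (cproj V v) (cproj V (cproj W (cproj W v))) := sym _ _ _
      _ = inner ℂ (cproj V v) (cproj W (cproj V (cproj W v))) := by rw [idem, h1, idem]
      _ = inner ℂ (cproj W (cproj V v)) (cproj V (cproj W v)) := (sym _ _ _).symm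
      _ = _ := by rw [h1]
  rw [h2]
  exact inner_self_nonneg (𝕜 := ℂ)

lemma chain_gap (V : ℕ → Submodule ℂ E) (V0 : Submodule ℂ E) (J : ℕ) (δ : ℝ) (hδ0 : 0 ≤ δ)
    (hadj : ∀ j v, -δ * (‖cproj (V j) v‖ ^ 2 + ‖cproj (V (j + 1)) v‖ ^ 2)
      ≤ 2 * (inner ℂ (cproj (V j) v) (cproj (V (j + 1)) v)).re)
    (hcomm : ∀ j k, j + 2 ≤ k → ∀ v,
      (V j).starProjection ((V k).starProjection v) = (V k).starProjection ((V j).starProjection v))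
    (hV0 : ∀ v, (∀ j < J, v ∈ V j) → v ∈ V0) (v : E) (hv : v ∈ V0ᗮ) :
    (1 - 2 * δ) * ‖v‖ ^ 2 ≤ ∑ j ∈ Finset.range J, ‖cproj (V j) v‖ ^ 2 := by
  let T : E →ₗ[ℂ] E := ∑ j ∈ Finset.range J, ((V j)ᗮ.starProjection : E →ₗ[ℂ] E)
  have hTv : ∀ v, T v = ∑ j ∈ Finset.range J, cproj (V j) v := by
    intro v; simp [T, cproj_eq]
  have hin : ∀ v, (inner ℂ v (T v)).re = ∑ j ∈ Finset.range J, ‖cproj (V j) v‖ ^ 2 := by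
    intro v
    rw [hTv, inner_sum, Complex.re_sum]
    exact Finset.sum_congr rfl fun j _ => inner_cproj _ _
  rw [← hin]
  refine gap_of_eigen T ?_ V0 _ ?_ v hv
  · intro x y
    rw [hTv, hTv, inner_sum, sum_inner]
    refine Finset.sum_congr rfl fun j _ => ?_
    rw [cproj_eq, cproj_eq, inner_proj_symm]
  · intro w l hw hl
    have h1 := chain_sum (fun j => cproj (V j) w) δ hδ0 (fun j => hadj j w)
      (fun j k hjk => comm_cproj_inner _ _ (hcomm j k hjk) w) J
    rw [← hTv, ← hin, hw, norm_smul, inner_smul_right] at h1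
    have h2 : ((l : ℂ) * inner ℂ w w).re = l * ‖w‖ ^ 2 := by
      rw [inner_self_eq_norm_sq_to_K, Complex.re_ofReal_mul]; norm_cast
    have h3 := hin w
    rw [hw, inner_smul_right, h2] at h3
    rw [h2] at h1
    have h4 : 0 ≤ ∑ j ∈ Finset.range J, ‖cproj (V j) w‖ ^ 2 := by positivity
    by_cases hw0 : w = 0
    · rw [hw0]; exact V0.zero_mem
    have hn : 0 < ‖w‖ ^ 2 := by positivity
    have hl0 : 0 ≤ l := by
      rw [← h3] at h4
      exact nonneg_of_mul_nonneg_left h4 hn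
    have hl1 : l = 0 := by
      by_contra hne
      have hlp : 0 < l := lt_of_le_of_ne hl0 (Ne.symm hne)
      rw [mul_pow] at h1
      simp only [Complex.norm_real, Real.norm_eq_abs, sq_abs] at h1
      have : (1 - 2 * δ - l) * (l * ‖w‖ ^ 2) ≤ 0 := by nlinarith
      have : 0 < (1 - 2 * δ - l) * (l * ‖w‖ ^ 2) := by
        apply mul_pos (by linarith) (by positivity)
      linarith
    rw [hl1, zero_mul] at h3
    apply hV0
    intro j hj
    have h5 := (Finset.sum_eq_zero_iff_of_nonneg (fun j _ => by positivity)).1 h3.symm j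
      (Finset.mem_range.2 hj)
    have h6 : cproj (V j) w = 0 := by simpa using h5
    rw [cproj, sub_eq_zero] at h6
    exact Submodule.starProjection_eq_self_iff.1 h6.symm

end Abstract2
end TPE

namespace TPE

/-- ordered product of the first `N` operators -/
def layer {A : Type*} [Monoid A] (g : ℕ → A) (N : ℕ) : A := ((List.range N).map g).prod

lemma layer_zero {A : Type*} [Monoid A] (g : ℕ → A) : layer g 0 = 1 := rfl

lemma layer_succ {A : Type*} [Monoid A] (g : ℕ → A) (N : ℕ) :
    layer g (N + 1) = layer g N * g N := by
  simp [layer, List.range_succ]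

lemma layer_commute {A : Type*} [Monoid A] (g : ℕ → A) (N : ℕ) (T : A)
    (h : ∀ i < N, Commute T (g i)) : Commute T (layer g N) := by
  induction N with
  | zero => exact Commute.one_right T
  | succ N ih =>
    rw [layer_succ]
    exact (ih fun i hi => h i (by omega)).mul_right (h N (by omega))

lemma layer_succ' {A : Type*} [Monoid A] (g : ℕ → A) (N : ℕ)
    (h : ∀ i j, Commute (g i) (g j)) : layer g (N + 1) = g N * layer g N := by
  rw [layer_succ]
  exact (layer_commute g N (g N) fun i _ => h _ _).eq.symm

section Abstract3
variable {E : Type*} [NormedAddCommGroup E] [InnerProductSpace ℂ E] [FiniteDimensional ℂ E]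

lemma detect (V : ℕ → Submodule ℂ E) (V0 : Submodule ℂ E) (hV0 : ∀ e, V0 ≤ V e)
    (hcomm : ∀ e e', e + 2 ≤ e' → Commute (V e).starProjection (V e').starProjection)
    (N : ℕ) (Δ : ℝ)
    (hgap : ∀ φ ∈ V0ᗮ, Δ * ‖φ‖ ^ 2 ≤ ∑ e ∈ Finset.range (2 * N), ‖cproj (V e) φ‖ ^ 2) (ψ : E)
    (hψ : ψ ∈ V0ᗮ) :
    (1 + Δ / 2) * ‖layer (fun i => (V (2 * i + 1)).starProjection) N
      (layer (fun i => (V (2 * i)).starProjection) N ψ)‖ ^ 2 ≤ ‖ψ‖ ^ 2 := by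
  have hcomm' : ∀ e e', (e + 2 ≤ e' ∨ e' + 2 ≤ e ∨ e = e') →
      Commute (V e).starProjection (V e').starProjection := by
    rintro e e' (h | h | h)
    · exact hcomm _ _ h
    · exact (hcomm _ _ h).symm
    · rw [h]
  set o : ℕ → E →L[ℂ] E := fun i => (V (2 * i + 1)).starProjection with ho
  set ev : ℕ → E →L[ℂ] E := fun i => (V (2 * i)).starProjection with hev
  have hoo : ∀ i j, Commute (o i) (o j) := fun i j => hcomm' _ _ (by omega)
  have hee : ∀ i j, Commute (ev i) (ev j) := fun i j => hcomm' _ _ (by omega)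
  set χ0 := layer ev N ψ with hχ0
  set χ : ℕ → E := fun j => layer o j χ0 with hχ
  have χs : ∀ j, χ (j + 1) = o j (χ j) := by
    intro j
    simp only [hχ, layer_succ' o j hoo]; rfl
  -- even: ev i χ0 = χ0
  have fixlayer : ∀ (g : ℕ → E →L[ℂ] E), (∀ i j, Commute (g i) (g j)) →
      (∀ i x, g i (g i x) = g i x) → ∀ M i x, i < M → g i (layer g M x) = layer g M x := by
    intro g hg hid M i x
    induction M with
    | zero => intro h; omega
    | succ M ih =>
      intro h
      rw [layer_succ' g M hg]
      change g i (g M (layer g M x)) = g M (layer g M x)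
      rcases Nat.lt_succ_iff_lt_or_eq.1 h with h' | h'
      · have := congrArg (fun T : E →L[ℂ] E => T (layer g M x)) (hg i M).eq
        simp only [mul_apply_eq_comp] at this
        rw [this, ih h']
      · rw [h', hid]
  have hoid : ∀ i x, o i (o i x) = o i x := fun i x => proj_idem _ _
  have heid : ∀ i x, ev i (ev i x) = ev i x := fun i x => proj_idem _ _
  have normlayer : ∀ (g : ℕ → E →L[ℂ] E), (∀ i x, ‖g i x‖ ≤ ‖x‖) → ∀ M x, ‖layer g M x‖ ≤ ‖x‖ := by
    intro g hg M
    induction M with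
    | zero => intro x; simp [layer_zero]
    | succ M ih =>
      intro x
      rw [layer_succ]
      exact (ih _).trans (hg _ _)
  have c1 : ‖χ0‖ ≤ ‖ψ‖ := normlayer ev (fun i x => proj_norm_le _ _) N ψ
  -- φ ⊥ V0
  have ortl : ∀ (g : ℕ → E →L[ℂ] E), (∀ i, ∀ x ∈ V0ᗮ, g i x ∈ V0ᗮ) → ∀ M, ∀ x ∈ V0ᗮ,
      layer g M x ∈ V0ᗮ := by
    intro g hg M
    induction M with
    | zero => intro x hx; simpa [layer_zero] using hx
    | succ M ih =>
      intro x hx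
      rw [layer_succ]
      exact ih _ (hg _ _ hx)
  have ortp : ∀ e, ∀ x ∈ V0ᗮ, (V e).starProjection x ∈ V0ᗮ := by
    intro e x hx w hw
    rw [← inner_proj_symm, Submodule.starProjection_eq_self_iff.2 (hV0 e hw)]
    exact hx w hw
  have hφ : χ N ∈ V0ᗮ :=
    ortl o (fun i => ortp _) N _ (ortl ev (fun i => ortp _) N _ hψ)
  have hg := hgap _ hφ
  -- odd terms vanish
  have hsum : ∑ e ∈ Finset.range (2 * N), ‖cproj (V e) (χ N)‖ ^ 2
      = ∑ i ∈ Finset.range N, ‖cproj (V (2 * i)) (χ N)‖ ^ 2 := by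
    have gen : ∀ (f : ℕ → ℝ) (M : ℕ), (∀ i < M, f (2 * i + 1) = 0) →
        ∑ e ∈ Finset.range (2 * M), f e = ∑ i ∈ Finset.range M, f (2 * i) := by
      intro f M
      induction M with
      | zero => simp
      | succ M ih =>
        intro h
        rw [show 2 * (M + 1) = 2 * M + 1 + 1 by ring, Finset.sum_range_succ, Finset.sum_range_succ,
          Finset.sum_range_succ, ih fun i hi => h i (by omega), h M (by omega), add_zero]
    apply gen
    intro i hi
    have := fixlayer o hoo hoid N i χ0 hi
    simp only [cproj, hχ]
    rw [show (V (2 * i + 1)).starProjection (layer o N χ0) = layer o N χ0 from this]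
    simp
  have happ : ∀ {S T : E →L[ℂ] E}, Commute S T → ∀ x, S (T x) = T (S x) := by
    intro S T h x
    exact congrArg (fun T : E →L[ℂ] E => T x) h.eq
  -- Q_{2i} χ_j
  have q1 : ∀ i j, i + 1 ≤ j → ‖cproj (V (2 * i)) (χ j)‖ ≤ ‖cproj (V (2 * i)) (χ (i + 1))‖ := by
    intro i j hij
    induction j, hij using Nat.le_induction with
    | base => exact le_rfl
    | succ j hj ih =>
      refine le_trans ?_ ih
      have : cproj (V (2 * i)) (χ (j + 1)) = o j (cproj (V (2 * i)) (χ j)) := by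
        rw [χs, cproj, cproj, map_sub]
        rw [happ (hcomm' (2 * i) (2 * j + 1) (by omega))]
      rw [this]
      exact proj_norm_le _ _
  have q2 : ∀ i j, i < N → j < i → cproj (V (2 * i)) (χ j) = 0 := by
    intro i j hi hj
    have h1 : Commute (ev i) (layer o j) :=
      layer_commute o j (ev i) fun k hk => hcomm' _ _ (by omega)
    have h2 : ev i (χ j) = χ j := by
      simp only [hχ]
      rw [happ h1, fixlayer ev hee heid N i ψ hi]
    rw [cproj, show (V (2 * i)).starProjection (χ j) = χ j from h2, sub_self]
  have q20 : 0 < N → cproj (V 0) (χ 0) = 0 := by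
    intro h
    have h2 : ev 0 (χ 0) = χ 0 := by
      simp only [hχ, layer_zero]
      exact fixlayer ev hee heid N 0 ψ h
    rw [cproj, show (V 0).starProjection (χ 0) = χ 0 from h2, sub_self]
  have cle : ∀ (W : Submodule ℂ E) x, ‖cproj W x‖ ≤ ‖x‖ := by
    intro W x; rw [cproj_eq]; exact proj_norm_le _ _
  have q3 : ∀ (W : Submodule ℂ E) x y, cproj W x = 0 → ‖cproj W y‖ ^ 2 ≤ ‖x - y‖ ^ 2 := by
    intro W x y h
    have : cproj W y = - cproj W (x - y) := by
      have : cproj W (x - y) = cproj W x - cproj W y := by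
        simp only [cproj, map_sub]; abel
      rw [this, h]; simp
    rw [this, norm_neg]
    gcongr
    exact cle _ _
  have mono : ∀ j, ‖χ (j + 1)‖ ^ 2 ≤ ‖χ j‖ ^ 2 := by
    intro j; rw [χs]; gcongr; exact proj_norm_le _ _
  have S : ∀ M, M + 1 ≤ N → ∑ i ∈ Finset.range (M + 1), ‖cproj (V (2 * i)) (χ N)‖ ^ 2
      ≤ 2 * ‖χ 0‖ ^ 2 - ‖χ M‖ ^ 2 - ‖χ (M + 1)‖ ^ 2 := by
    intro M
    induction M with
    | zero =>
      intro hM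
      rw [Finset.sum_range_one]
      have h1 : ‖cproj (V (2 * 0)) (χ N)‖ ^ 2 ≤ ‖cproj (V (2 * 0)) (χ 1)‖ ^ 2 := by
        gcongr; exact q1 0 N hM
      have h2 := q3 (V 0) (χ 0) (χ 1) (q20 (by omega))
      have h3 := proj_pyth (V 1) (χ 0)
      have h4 : χ 1 = (V 1).starProjection (χ 0) := χs 0
      rw [cproj, ← h4] at h3
      simp only [mul_zero, zero_add] at h1 h2 ⊢
      linarith
    | succ M ih =>
      intro hM
      rw [Finset.sum_range_succ]
      have h0 := ih (by omega)
      have h1 : ‖cproj (V (2 * (M + 1))) (χ N)‖ ^ 2 ≤ ‖cproj (V (2 * (M + 1))) (χ (M + 2))‖ ^ 2 := by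
        gcongr; exact q1 (M + 1) N hM
      have h2 := q3 (V (2 * (M + 1))) (χ M) (χ (M + 2)) (q2 _ _ (by omega) (by omega))
      have h3 : ‖χ M - χ (M + 2)‖ ^ 2 = ‖χ M‖ ^ 2 - ‖χ (M + 2)‖ ^ 2 := by
        have e1 : χ (M + 2) = o (M + 1) (o M (χ M)) := by rw [χs, χs]
        have e2 : (inner ℂ (χ M) (χ (M + 2))).re = ‖χ (M + 2)‖ ^ 2 := by
          rw [e1, show o (M + 1) (o M (χ M))
            = (V (2 * (M + 1) + 1)).starProjection (o M (χ M)) from rfl, ← inner_proj,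
            show (V (2 * (M + 1) + 1)).starProjection (o M (χ M)) = o (M + 1) (o M (χ M)) from rfl,
            show inner ℂ (o M (χ M)) (o (M + 1) (o M (χ M)))
              = inner ℂ (χ M) (o M (o (M + 1) (o M (χ M)))) from inner_proj_symm _ _ _,
            happ (hoo M (M + 1)) (o M (χ M)), hoid]
        have e3 := norm_sub_sq (𝕜 := ℂ) (χ M) (χ (M + 2))
        have e4 : RCLike.re (inner ℂ (χ M) (χ (M + 2))) = ‖χ (M + 2)‖ ^ 2 := e2
        rw [e4] at e3
        linarith
      linarith [mono M]
  have fin : ∑ i ∈ Finset.range N, ‖cproj (V (2 * i)) (χ N)‖ ^ 2 ≤ 2 * (‖χ 0‖ ^ 2 - ‖χ N‖ ^ 2) := by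
    cases hN : N with
    | zero => simp
    | succ M =>
      have := S M (by omega)
      rw [hN] at this
      linarith [mono M]
  have hχ00 : ‖χ 0‖ ^ 2 ≤ ‖ψ‖ ^ 2 := by
    simp only [hχ, layer_zero]
    gcongr
    exact c1
  rw [hsum] at hg
  change (1 + Δ / 2) * ‖χ N‖ ^ 2 ≤ ‖ψ‖ ^ 2
  linarith

end Abstract3
end TPE

namespace TPE

lemma schur_test {Λ : Type*} [Fintype Λ] (k : Λ → Λ → ℝ) (hk : ∀ i j, 0 ≤ k i j) (ε : ℝ)
    (hrow : ∀ i, ∑ j, k i j ≤ ε) (hcol : ∀ j, ∑ i, k i j ≤ ε) (hε : 0 ≤ ε)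
    (a b : Λ → ℝ) :
    ∑ i, ∑ j, k i j * (a i * b j) ≤ ε * (√(∑ i, a i ^ 2) * √(∑ i, b i ^ 2)) := by
  have h1 : (∑ p : Λ × Λ, (√(k p.1 p.2) * a p.1) * (√(k p.1 p.2) * b p.2)) ^ 2
      ≤ (∑ p : Λ × Λ, (√(k p.1 p.2) * a p.1) ^ 2) * ∑ p : Λ × Λ, (√(k p.1 p.2) * b p.2) ^ 2 :=
    Finset.sum_mul_sq_le_sq_mul_sq _ _ _
  have h2 : ∑ p : Λ × Λ, (√(k p.1 p.2) * a p.1) ^ 2 ≤ ε * ∑ i, a i ^ 2 := by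
    rw [Fintype.sum_prod_type, Finset.mul_sum]
    apply Finset.sum_le_sum
    intro i _
    simp only [mul_pow, Real.sq_sqrt (hk _ _)]
    rw [← Finset.sum_mul]
    gcongr
    exact hrow i
  have h3 : ∑ p : Λ × Λ, (√(k p.1 p.2) * b p.2) ^ 2 ≤ ε * ∑ i, b i ^ 2 := by
    rw [Fintype.sum_prod_type_right, Finset.mul_sum]
    apply Finset.sum_le_sum
    intro i _
    simp only [mul_pow, Real.sq_sqrt (hk _ _)]
    rw [← Finset.sum_mul]
    gcongr
    exact hcol i
  have h4 : ∑ p : Λ × Λ, (√(k p.1 p.2) * a p.1) * (√(k p.1 p.2) * b p.2)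
      = ∑ i, ∑ j, k i j * (a i * b j) := by
    rw [Fintype.sum_prod_type]
    refine Finset.sum_congr rfl fun i _ => Finset.sum_congr rfl fun j _ => ?_
    have := Real.mul_self_sqrt (hk i j)
    calc _ = (√(k i j) * √(k i j)) * (a i * b j) := by ring
      _ = _ := by rw [this]
  rw [h4] at h1
  apply le_of_sq_le_sq _ (by positivity)
  rw [mul_pow, mul_pow, Real.sq_sqrt (by positivity), Real.sq_sqrt (by positivity)]
  calc _ ≤ _ := h1
    _ ≤ (ε * ∑ i, a i ^ 2) * (ε * ∑ i, b i ^ 2) := by gcongr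
    _ = _ := by ring

section Abstract4
variable {E : Type*} [NormedAddCommGroup E] [InnerProductSpace ℂ E] [FiniteDimensional ℂ E]
variable {Λ : Type*} [Fintype Λ]

/-- A family of almost orthogonal projections `P σ` whose ranges span `V`. -/
structure AlmostOrth (P : Λ → E →L[ℂ] E) (V : Submodule ℂ E) (ε : ℝ) : Prop where
  eps : 0 ≤ ε
  sym : ∀ i x y, inner ℂ (P i x) y = inner ℂ x (P i y)
  idem : ∀ i x, P i (P i x) = P i x
  ran : ∀ i x, P i x ∈ V
  inj : ∀ v ∈ V, (∀ i, P i v = 0) → v = 0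
  ov : ∃ k : Λ → Λ → ℝ, (∀ i j, 0 ≤ k i j) ∧ (∀ i, ∑ j, k i j ≤ ε) ∧ (∀ j, ∑ i, k i j ≤ ε) ∧
    ∀ i j, i ≠ j → ∀ x y, ‖inner ℂ (P i x) (P j y)‖ ≤ k i j * (‖P i x‖ * ‖P j y‖)

namespace AlmostOrth
variable {P : Λ → E →L[ℂ] E} {V : Submodule ℂ E} {ε : ℝ}

lemma inner_sum (h : AlmostOrth P V ε) (x : E) : (inner ℂ x ((∑ i, P i) x)).re = ∑ i, ‖P i x‖ ^ 2 := by
  rw [_root_.sum_apply, _root_.inner_sum, Complex.re_sum]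
  refine Finset.sum_congr rfl fun i _ => ?_
  rw [← h.idem, ← h.sym, ← inner_self_eq_norm_sq (𝕜 := ℂ), h.idem]
  rfl

lemma symF (h : AlmostOrth P V ε) (x y : E) : inner ℂ ((∑ i, P i) x) y = inner ℂ x ((∑ i, P i) y) := by
  rw [_root_.sum_apply, _root_.sum_apply, _root_.inner_sum, sum_inner]
  exact Finset.sum_congr rfl fun i _ => h.sym _ _ _

lemma sq_bound (h : AlmostOrth P V ε) (x : E) :
    |‖(∑ i, P i) x‖ ^ 2 - ∑ i, ‖P i x‖ ^ 2| ≤ ε * ∑ i, ‖P i x‖ ^ 2 := by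
  obtain ⟨k, hk, hr, hc, ho⟩ := h.ov
  have e1 : ‖(∑ i, P i) x‖ ^ 2 = ∑ i, ∑ j, (inner ℂ (P i x) (P j x)).re := by
    rw [← inner_self_eq_norm_sq (𝕜 := ℂ), _root_.sum_apply, sum_inner]
    simp only [_root_.inner_sum, map_sum]
    rfl
  have e2 : ∑ i, ‖P i x‖ ^ 2 = ∑ i, ∑ j, if i = j then (inner ℂ (P i x) (P j x)).re else 0 := by
    refine Finset.sum_congr rfl fun i _ => ?_
    rw [Finset.sum_ite_eq]
    simp only [Finset.mem_univ, if_true]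
    rw [← inner_self_eq_norm_sq (𝕜 := ℂ)]; rfl
  have h3 : |‖(∑ i, P i) x‖ ^ 2 - ∑ i, ‖P i x‖ ^ 2|
      ≤ ∑ i, ∑ j, k i j * (‖P i x‖ * ‖P j x‖) := by
    rw [e1, e2, ← Finset.sum_sub_distrib]
    refine (Finset.abs_sum_le_sum_abs _ _).trans (Finset.sum_le_sum fun i _ => ?_)
    rw [← Finset.sum_sub_distrib]
    refine (Finset.abs_sum_le_sum_abs _ _).trans (Finset.sum_le_sum fun j _ => ?_)
    by_cases hij : i = j
    · simp only [hij, if_true, sub_self, abs_zero]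
      have := hk j j
      positivity
    · simp only [hij, if_false, sub_zero]
      exact (Complex.abs_re_le_norm _).trans (ho i j hij x x)
  refine h3.trans ((schur_test k hk ε hr hc h.eps _ _).trans ?_)
  rw [Real.mul_self_sqrt (by positivity)]

lemma le_sum (h : AlmostOrth P V ε) (x : E) : ∑ i, ‖P i x‖ ^ 2 ≤ (1 + ε) * ‖x‖ ^ 2 := by
  have h1 := (abs_le.1 (h.sq_bound x)).2
  set S := ∑ i, ‖P i x‖ ^ 2 with hS
  have hS0 : 0 ≤ S := by positivity
  have h2 : S ≤ ‖x‖ * ‖(∑ i, P i) x‖ := by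
    rw [hS, ← h.inner_sum]; exact re_inner_le _ _
  have h3 : S ^ 2 ≤ (‖x‖ * ‖(∑ i, P i) x‖) ^ 2 := by gcongr
  have h4 : S ^ 2 ≤ ‖x‖ ^ 2 * ((1 + ε) * S) := by
    rw [mul_pow] at h3
    exact h3.trans (by gcongr; linarith)
  have := h.eps
  rcases hS0.eq_or_lt with h0 | h0
  · rw [← h0]; positivity
  · have : S * S ≤ ((1 + ε) * ‖x‖ ^ 2) * S := by nlinarith
    exact le_of_mul_le_mul_right this h0

lemma ker_iff (h : AlmostOrth P V ε) (x : E) : x ∈ Vᗮ ↔ (∑ i, P i) x = 0 := by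
  constructor
  · intro hx
    rw [_root_.sum_apply]
    refine Finset.sum_eq_zero fun i _ => ?_
    rw [← inner_self_eq_zero (𝕜 := ℂ), h.sym, ← inner_conj_symm]
    rw [h.idem, hx _ (h.ran i x)]; simp
  · intro hx
    have hz : ∀ i, P i x = 0 := by
      have := h.inner_sum x
      rw [hx] at this
      simp only [inner_zero_right, Complex.zero_re] at this
      intro i
      have := (Finset.sum_eq_zero_iff_of_nonneg (fun j _ => by positivity)).1 this.symm i
        (Finset.mem_univ i)
      simpa using this
    have : V.starProjection x = 0 := by
      -- the projection of x onto V is killed by all P i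
      apply h.inj _ (Submodule.starProjection_apply_mem V x)
      intro i
      apply ext_inner_left ℂ
      intro w
      rw [← h.sym, ← inner_proj_symm, Submodule.starProjection_eq_self_iff.2 (h.ran i w), h.sym,
        hz i]
    exact (Submodule.starProjection_apply_eq_zero_iff V).1 this

lemma norm_sub (h : AlmostOrth P V ε) (x : E) : ‖(∑ i, P i) x - V.starProjection x‖ ≤ ε * ‖x‖ := by
  set F := ∑ i, P i with hF
  have hsF : ((F - V.starProjection : E →L[ℂ] E) : E →ₗ[ℂ] E).IsSymmetric := by
    intro x y
    simp only [ContinuousLinearMap.coe_coe, _root_.sub_apply, inner_sub_left,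
      inner_sub_right]
    rw [h.symF, inner_proj_symm]
  refine norm_of_eigen _ hsF ε h.eps ?_ x
  intro v l hv0 hv
  simp only [ContinuousLinearMap.coe_coe, _root_.sub_apply] at hv
  by_cases hl : l = 0
  · rw [hl, abs_zero]; exact h.eps
  have hFV : ∀ y, F y ∈ V := by
    intro y
    rw [hF, _root_.sum_apply]
    exact V.sum_mem fun i _ => h.ran i y
  have hvV : v ∈ V := by
    have : v = (l : ℂ)⁻¹ • (F v - V.starProjection v) := by
      rw [hv, smul_smul, inv_mul_cancel₀ (by exact_mod_cast hl), one_smul]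
    rw [this]
    exact V.smul_mem _ (V.sub_mem (hFV v) (Submodule.starProjection_apply_mem V v))
  rw [Submodule.starProjection_eq_self_iff.2 hvV, sub_eq_iff_eq_add] at hv
  have hFv : F v = ((1 + l : ℝ) : ℂ) • v := by
    rw [hv]; push_cast; rw [add_smul, one_smul, add_comm]
  have h1 := h.inner_sum v
  have h2 := h.sq_bound v
  rw [← hF] at h1 h2
  rw [hFv, inner_smul_right, inner_self_eq_norm_sq_to_K, Complex.re_ofReal_mul] at h1
  have h1' : (1 + l) * ‖v‖ ^ 2 = ∑ i, ‖P i v‖ ^ 2 := by rw [← h1]; norm_cast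
  rw [← h1', hFv, norm_smul, mul_pow] at h2
  simp only [Complex.norm_real, Real.norm_eq_abs, sq_abs] at h2
  have hn : 0 < ‖v‖ ^ 2 := by positivity
  have hpos : 0 ≤ 1 + l := by
    have : 0 ≤ (1 + l) * ‖v‖ ^ 2 := by rw [h1']; positivity
    exact nonneg_of_mul_nonneg_left this hn
  have hne : 1 + l ≠ 0 := by
    intro h0
    rw [h0] at hFv
    have : v ∈ Vᗮ := by rw [h.ker_iff, ← hF, hFv]; simp
    have h3 := this v hvV
    exact hv0 (inner_self_eq_zero.1 h3)
  have hpos' : 0 < 1 + l := lt_of_le_of_ne hpos (Ne.symm hne)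
  have e : (1 + l) ^ 2 * ‖v‖ ^ 2 - (1 + l) * ‖v‖ ^ 2 = l * ((1 + l) * ‖v‖ ^ 2) := by ring
  rw [e, abs_mul, abs_of_pos (by positivity : 0 < (1 + l) * ‖v‖ ^ 2)] at h2
  exact le_of_mul_le_mul_right h2 (by positivity)

lemma norm_F (h : AlmostOrth P V ε) (x : E) : ‖(∑ i, P i) x‖ ≤ (1 + ε) * ‖x‖ := by
  have h1 := h.norm_sub x
  have h2 := proj_norm_le V x
  calc ‖(∑ i, P i) x‖ = ‖((∑ i, P i) x - V.starProjection x) + V.starProjection x‖ := by simp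
    _ ≤ _ := norm_add_le _ _
    _ ≤ ε * ‖x‖ + ‖x‖ := by gcongr
    _ = _ := by ring

end AlmostOrth

lemma AlmostOrth.comm {P P' : Λ → E →L[ℂ] E} {V V' : Submodule ℂ E} {ε ε' : ℝ}
    (h : AlmostOrth P V ε) (h' : AlmostOrth P' V' ε')
    (hc : ∀ i j x, P i (P' j x) = P' j (P i x)) (x : E) :
    V.starProjection (V'.starProjection x) = V'.starProjection (V.starProjection x) := by
  have h1 : ∀ x, (∑ i, P i) ((∑ i, P' i) x) = (∑ i, P' i) ((∑ i, P i) x) := by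
    intro x
    simp only [_root_.sum_apply, map_sum, hc]
    rw [Finset.sum_comm]
  have h2 := proj_comm_of_ker V' (∑ i, P' i) (∑ i, P i) h.symF h'.ker_iff h1
  exact (proj_comm_of_ker V (∑ i, P i) V'.starProjection (fun v w => inner_proj_symm V' v w)
    h.ker_iff (fun v => (h2 v).symm) x).symm

lemma AlmostOrth.overlap {P1 P2 P3 : Λ → E →L[ℂ] E} {V1 V2 V3 : Submodule ℂ E} {e εB : ℝ}
    (h1 : AlmostOrth P1 V1 e) (h2 : AlmostOrth P2 V2 e) (h3 : AlmostOrth P3 V3 e)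
    (hB0 : 0 ≤ εB)
    (hdiag : ∀ i x, P1 i (P2 i x) = P3 i x)
    (hoff : ∃ k : Λ → Λ → ℝ, (∀ i j, 0 ≤ k i j) ∧ (∀ i, ∑ j, k i j ≤ εB) ∧
      (∀ j, ∑ i, k i j ≤ εB) ∧
      ∀ i j, i ≠ j → ∀ x y, ‖inner ℂ (P1 i x) (P2 j y)‖ ≤ k i j * (‖P1 i x‖ * ‖P2 j y‖))
    (x : E) :
    ‖V1.starProjection (V2.starProjection x) - V3.starProjection x‖
      ≤ (εB * (1 + e) + (3 * e + e ^ 2)) * ‖x‖ := by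
  obtain ⟨k, hk, hr, hc, ho⟩ := hoff
  set F1 := ∑ i, P1 i with hF1
  set F2 := ∑ i, P2 i with hF2
  set F3 := ∑ i, P3 i with hF3
  have he := h1.eps
  have key : ‖F1 (F2 x) - F3 x‖ ≤ εB * (1 + e) * ‖x‖ := by
    set w := F1 (F2 x) - F3 x with hw
    have : ‖w‖ ^ 2 ≤ εB * (1 + e) * (‖w‖ * ‖x‖) := by
      have a1 : inner ℂ w w = ∑ i, ∑ j, (if i = j then 0 else inner ℂ (P1 i w) (P2 j x)) := by
        have : w = ∑ i, ∑ j, (if i = j then 0 else P1 i (P2 j x)) := by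
          have b1 : F1 (F2 x) = ∑ i, ∑ j, P1 i (P2 j x) := by
            simp only [hF1, hF2, _root_.sum_apply, map_sum]
            rw [Finset.sum_comm]
          have b2 : F3 x = ∑ i, ∑ j, if i = j then P1 i (P2 j x) else 0 := by
            simp only [hF3, _root_.sum_apply]
            refine Finset.sum_congr rfl fun i _ => ?_
            rw [Finset.sum_ite_eq]; simp [hdiag]
          rw [hw, b1, b2, ← Finset.sum_sub_distrib]
          refine Finset.sum_congr rfl fun i _ => ?_
          rw [← Finset.sum_sub_distrib]
          refine Finset.sum_congr rfl fun j _ => ?_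
          split_ifs <;> simp
        have c1 : inner ℂ w w
            = inner ℂ w (∑ i, ∑ j, (if i = j then 0 else P1 i (P2 j x))) := by rw [← this]
        rw [c1, _root_.inner_sum]
        refine Finset.sum_congr rfl fun i _ => ?_
        rw [_root_.inner_sum]
        refine Finset.sum_congr rfl fun j _ => ?_
        split_ifs
        · simp
        · rw [h1.sym]
      have a2 : ‖w‖ ^ 2 ≤ ∑ i, ∑ j, k i j * (‖P1 i w‖ * ‖P2 j x‖) := by
        have : ‖w‖ ^ 2 = ‖inner ℂ w w‖ := by
          rw [inner_self_eq_norm_sq_to_K]; simp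
        rw [this, a1]
        refine (norm_sum_le _ _).trans (Finset.sum_le_sum fun i _ => ?_)
        refine (norm_sum_le _ _).trans (Finset.sum_le_sum fun j _ => ?_)
        split_ifs with hij
        · simp only [norm_zero]
          have := hk i j
          positivity
        · exact ho i j hij _ _
      have a3 : √(∑ i, ‖P1 i w‖ ^ 2) * √(∑ i, ‖P2 i x‖ ^ 2) ≤ (1 + e) * (‖w‖ * ‖x‖) := by
        calc _ ≤ √((1 + e) * ‖w‖ ^ 2) * √((1 + e) * ‖x‖ ^ 2) := by
              gcongr
              · exact h1.le_sum w
              · exact h2.le_sum x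
          _ = (√(1 + e) * √(1 + e)) * (‖w‖ * ‖x‖) := by
              rw [Real.sqrt_mul (by linarith), Real.sqrt_mul (by linarith),
                Real.sqrt_sq (norm_nonneg _), Real.sqrt_sq (norm_nonneg _)]
              ring
          _ = _ := by rw [Real.mul_self_sqrt (by linarith)]
      refine a2.trans ((schur_test k hk εB hr hc hB0 _ _).trans ?_)
      rw [mul_assoc]
      gcongr
    rcases (norm_nonneg w).eq_or_lt with h0 | h0
    · rw [← h0]; positivity
    · have : ‖w‖ * ‖w‖ ≤ ‖w‖ * (εB * (1 + e) * ‖x‖) := by nlinarith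
      exact le_of_mul_le_mul_left this h0
  have t1 := h1.norm_sub (V2.starProjection x)
  have t2 : ‖F1 (F2 x - V2.starProjection x)‖ ≤ (1 + e) * (e * ‖x‖) :=
    (h1.norm_F _).trans (by gcongr; exact h2.norm_sub x)
  have t3 := h3.norm_sub x
  rw [← hF1] at t1
  rw [← hF3] at t3
  have t4 := proj_norm_le V2 x
  have : V1.starProjection (V2.starProjection x) - V3.starProjection x
      = -(F1 (V2.starProjection x) - V1.starProjection (V2.starProjection x))
        - F1 (F2 x - V2.starProjection x) + (F1 (F2 x) - F3 x)
        + (F3 x - V3.starProjection x) := by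
    rw [map_sub]; abel
  rw [this]
  calc _ ≤ ‖F1 (V2.starProjection x) - V1.starProjection (V2.starProjection x)‖
        + ‖F1 (F2 x - V2.starProjection x)‖ + ‖F1 (F2 x) - F3 x‖
        + ‖F3 x - V3.starProjection x‖ := by
        refine (norm_add_le _ _).trans ?_
        gcongr
        refine (norm_add_le _ _).trans ?_
        gcongr
        refine (norm_sub_le _ _).trans ?_
        rw [norm_neg]
    _ ≤ e * ‖x‖ + (1 + e) * (e * ‖x‖) + εB * (1 + e) * ‖x‖ + e * ‖x‖ := by
        gcongr
        exact t1.trans (by gcongr)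
    _ = _ := by ring

end Abstract4
end TPE

namespace TPE

/-- index set of the moment space -/
abbrev Idx (t : ℕ) (ξ : Type*) := (Fin t → ξ) × (Fin t → ξ)

/-- the moment Hilbert space -/
abbrev HS (t : ℕ) (ξ : Type*) [Fintype ξ] := EuclideanSpace ℂ (Idx t ξ)

/-- operator of a matrix -/
def op {ι : Type*} [Fintype ι] [DecidableEq ι] (A : Matrix ι ι ℂ) :
    EuclideanSpace ℂ ι →L[ℂ] EuclideanSpace ℂ ι := Matrix.toEuclideanCLM (𝕜 := ℂ) A

section op
variable {ι : Type*} [Fintype ι] [DecidableEq ι]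

lemma op_mul (A B : Matrix ι ι ℂ) : op (A * B) = op A * op B := by simp [op]
lemma op_one : op (1 : Matrix ι ι ℂ) = 1 := by simp [op]
lemma op_add (A B : Matrix ι ι ℂ) : op (A + B) = op A + op B := by simp [op]
lemma op_sub (A B : Matrix ι ι ℂ) : op (A - B) = op A - op B := by simp [op]
lemma op_smul (c : ℂ) (A : Matrix ι ι ℂ) : op (c • A) = c • op A := by simp [op]
lemma op_sum {κ : Type*} (s : Finset κ) (A : κ → Matrix ι ι ℂ) :
    op (∑ i ∈ s, A i) = ∑ i ∈ s, op (A i) := by simp [op]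
lemma op_apply (A : Matrix ι ι ℂ) (v : EuclideanSpace ℂ ι) (i : ι) :
    op A v i = ∑ j, A i j * v j := by
  rw [op, Matrix.ofLp_toEuclideanCLM]
  rfl
lemma op_mul_apply (A B : Matrix ι ι ℂ) (v : EuclideanSpace ℂ ι) :
    op (A * B) v = op A (op B v) := by rw [op_mul]; rfl
lemma op_adj (A : Matrix ι ι ℂ) (v w : EuclideanSpace ℂ ι) :
    inner ℂ (op A v) w = inner ℂ v (op Aᴴ w) := by
  have : op Aᴴ = ContinuousLinearMap.adjoint (op A) := by
    simp only [op, ← Matrix.star_eq_conjTranspose, map_star]; rfl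
  rw [this, ContinuousLinearMap.adjoint_inner_right]
lemma op_continuous (v : EuclideanSpace ℂ ι) :
    Continuous (fun A : Matrix ι ι ℂ => op A v) := by
  let L : Matrix ι ι ℂ →ₗ[ℂ] EuclideanSpace ℂ ι :=
    { toFun := fun A => op A v
      map_add' := fun A B => by rw [op_add]; rfl
      map_smul' := fun c A => by rw [op_smul]; rfl }
  exact L.continuous_of_finiteDimensional
lemma op_inj {A B : Matrix ι ι ℂ} (h : op A = op B) : A = B :=
  (Matrix.toEuclideanCLM (𝕜 := ℂ) (n := ι)).injective h
end op

section rep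
variable {ξ : Type*} [Fintype ξ] [DecidableEq ξ] {t : ℕ}

/-- `A^{⊗t} ⊗ B^{⊗t}` -/
def RR (t : ℕ) (A B : Matrix ξ ξ ℂ) : Matrix (Idx t ξ) (Idx t ξ) ℂ :=
  fun x y => (∏ s, A (x.1 s) (y.1 s)) * ∏ s, B (x.2 s) (y.2 s)

/-- entrywise conjugation -/
def cj (A : Matrix ξ ξ ℂ) : Matrix ξ ξ ℂ := A.map (starRingEnd ℂ)

lemma momentMat_eq (U : Matrix ξ ξ ℂ) : momentMat t U = RR t U (cj U) := rfl

lemma cj_mul (A B : Matrix ξ ξ ℂ) : cj (A * B) = cj A * cj B := by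
  simp [cj, Matrix.map_mul]
lemma cj_one : cj (1 : Matrix ξ ξ ℂ) = 1 := by simp [cj]
lemma cj_transpose (A : Matrix ξ ξ ℂ) : (cj A)ᵀ = Aᴴ := rfl

lemma RR_mul (A B A' B' : Matrix ξ ξ ℂ) :
    RR t A B * RR t A' B' = RR t (A * A') (B * B') := by
  ext x y
  simp only [RR, Matrix.mul_apply, Fintype.sum_prod_type]
  rw [Finset.prod_univ_sum, Finset.prod_univ_sum, Finset.sum_mul_sum]
  simp only [Fintype.piFinset_univ, Finset.prod_mul_distrib]
  refine Finset.sum_congr rfl fun i _ => Finset.sum_congr rfl fun j _ => ?_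
  ring

lemma RR_one : RR t (1 : Matrix ξ ξ ℂ) 1 = 1 := by
  ext x y
  simp only [RR, Matrix.one_apply, Finset.prod_ite_zero, Finset.mem_univ, true_imp_iff,
    Finset.prod_const_one, ← ite_and, mul_ite, mul_one, mul_zero]
  congr 1
  simp only [Prod.ext_iff, funext_iff, eq_iff_iff]
  tauto

lemma RR_conjTranspose (A B : Matrix ξ ξ ℂ) : (RR t A B)ᴴ = RR t Aᴴ Bᴴ := by
  ext x y
  simp [RR, Matrix.conjTranspose_apply]

lemma momentMat_mul (U W : Matrix ξ ξ ℂ) :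
    momentMat t (U * W) = momentMat t U * momentMat t W := by
  rw [momentMat_eq, momentMat_eq, momentMat_eq, RR_mul, cj_mul]

lemma momentMat_one : momentMat t (1 : Matrix ξ ξ ℂ) = 1 := by
  rw [momentMat_eq, cj_one, RR_one]

lemma momentMat_conjTranspose (U : Matrix ξ ξ ℂ) : (momentMat t U)ᴴ = momentMat t Uᴴ := by
  rw [momentMat_eq, momentMat_eq, RR_conjTranspose]; rfl

/-- the infinitesimal action (entrywise) -/
def dmomF (t : ℕ) (X : Matrix ξ ξ ℂ) : Matrix (Idx t ξ) (Idx t ξ) ℂ := fun x y =>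
    (∑ s, (∏ s' ∈ Finset.univ.erase s, (1 : Matrix ξ ξ ℂ) (x.1 s') (y.1 s')) * X (x.1 s) (y.1 s)) *
      (∏ s, (1 : Matrix ξ ξ ℂ) (x.2 s) (y.2 s)) +
    (∏ s, (1 : Matrix ξ ξ ℂ) (x.1 s) (y.1 s)) *
      (∑ s, (∏ s' ∈ Finset.univ.erase s, (1 : Matrix ξ ξ ℂ) (x.2 s') (y.2 s')) *
        (- X (y.2 s) (x.2 s)))

/-- the infinitesimal action -/
def dmom (t : ℕ) : Matrix ξ ξ ℂ →ₗ[ℂ] Matrix (Idx t ξ) (Idx t ξ) ℂ where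
  toFun X := dmomF t X
  map_add' X Y := by
    ext x y
    rw [Matrix.add_apply]
    simp only [dmomF, Matrix.add_apply, mul_add, neg_add, Finset.sum_add_distrib]
    ring
  map_smul' c X := by
    ext x y
    rw [Matrix.smul_apply]
    simp only [dmomF, Matrix.smul_apply, smul_eq_mul, RingHom.id_apply, mul_add, Finset.mul_sum,
      Finset.sum_mul]
    congr 1
    · refine Finset.sum_congr rfl fun i _ => ?_
      ring
    · refine Finset.sum_congr rfl fun i _ => ?_
      ring

lemma dmom_apply (X : Matrix ξ ξ ℂ) (x y : Idx t ξ) : dmom t X x y =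
    (∑ s, (∏ s' ∈ Finset.univ.erase s, (1 : Matrix ξ ξ ℂ) (x.1 s') (y.1 s')) * X (x.1 s) (y.1 s)) *
      (∏ s, (1 : Matrix ξ ξ ℂ) (x.2 s) (y.2 s)) +
    (∏ s, (1 : Matrix ξ ξ ℂ) (x.1 s) (y.1 s)) *
      (∑ s, (∏ s' ∈ Finset.univ.erase s, (1 : Matrix ξ ξ ℂ) (x.2 s') (y.2 s')) *
        (- X (y.2 s) (x.2 s))) := rfl

/-- derivative of `RR` along a curve through `(1,1)` -/
lemma RR_hasDerivAt (A B : ℝ → Matrix ξ ξ ℂ) (X : Matrix ξ ξ ℂ) (hA1 : A 0 = 1) (hB1 : B 0 = 1)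
    (hA : ∀ i j, HasDerivAt (fun z => A z i j) (X i j) 0)
    (hB : ∀ i j, HasDerivAt (fun z => B z i j) (-X j i) 0) (x y : Idx t ξ) :
    HasDerivAt (fun z => RR t (A z) (B z) x y) (dmom t X x y) 0 := by
  have h1 := HasDerivAt.fun_finsetProd (u := Finset.univ) (x := (0:ℝ))
    (f := fun s z => A z (x.1 s) (y.1 s)) (f' := fun s => X (x.1 s) (y.1 s))
    (fun s _ => hA (x.1 s) (y.1 s))
  have h2 := HasDerivAt.fun_finsetProd (u := Finset.univ) (x := (0:ℝ))
    (f := fun s z => B z (x.2 s) (y.2 s)) (f' := fun s => -X (y.2 s) (x.2 s))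
    (fun s _ => hB (x.2 s) (y.2 s))
  have h3 := h1.mul h2
  simp only [hA1, hB1, smul_eq_mul] at h3
  exact h3

lemma dmom_scalar (c : ℂ) : dmom t (c • (1 : Matrix ξ ξ ℂ)) = 0 := by
  rw [map_smul]
  have : dmom t (1 : Matrix ξ ξ ℂ) = 0 := by
    ext x y
    rw [dmom_apply]
    have h : ∀ a b : Fin t → ξ, ∑ s, (∏ s' ∈ Finset.univ.erase s, (1 : Matrix ξ ξ ℂ) (a s') (b s'))
        * (1 : Matrix ξ ξ ℂ) (a s) (b s) = t * ∏ s, (1 : Matrix ξ ξ ℂ) (a s) (b s) := by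
      intro a b
      rw [Finset.sum_congr rfl (g := fun _ => ∏ s, (1 : Matrix ξ ξ ℂ) (a s) (b s))]
      · simp
      · intro s _
        exact Finset.prod_erase_mul _ _ (Finset.mem_univ s)
    have h' : ∀ a b : Fin t → ξ, ∑ s, (∏ s' ∈ Finset.univ.erase s, (1 : Matrix ξ ξ ℂ) (a s') (b s'))
        * -(1 : Matrix ξ ξ ℂ) (b s) (a s) = -(t * ∏ s, (1 : Matrix ξ ξ ℂ) (a s) (b s)) := by
      intro a b
      rw [← h, ← Finset.sum_neg_distrib]
      refine Finset.sum_congr rfl fun s _ => ?_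
      have : (1 : Matrix ξ ξ ℂ) (b s) (a s) = (1 : Matrix ξ ξ ℂ) (a s) (b s) := by
        simp only [Matrix.one_apply, eq_comm]
      rw [this]; ring
    rw [h, h']
    simp; ring
  rw [this, smul_zero]

lemma dmom_one_comp (X W X' : Matrix ξ ξ ℂ) (B : Matrix ξ ξ ℂ) (h1 : X * W = W * X')
    (h2 : Xᵀ * B = B * X'ᵀ) :
    dmom t X * RR t W B = RR t W B * dmom t X' := by
  have hd : ∀ (X : Matrix ξ ξ ℂ) (x y : Idx t ξ),
      HasDerivAt (fun z : ℝ => RR t (1 + (z : ℂ) • X) (1 - (z : ℂ) • Xᵀ) x y) (dmom t X x y) 0 := by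
    intro X x y
    have hz : HasDerivAt (fun z : ℝ => (z : ℂ)) 1 0 := by
      simpa using (hasDerivAt_id (0:ℝ)).ofReal_comp
    apply RR_hasDerivAt (fun z : ℝ => 1 + (z : ℂ) • X) (fun z : ℝ => 1 - (z : ℂ) • Xᵀ) X
    · simp
    · simp
    · intro i j
      simp only [Matrix.add_apply, Matrix.smul_apply, smul_eq_mul]
      simpa using (hz.mul_const (X i j)).const_add ((1 : Matrix ξ ξ ℂ) i j)
    · intro i j
      simp only [Matrix.sub_apply, Matrix.smul_apply, smul_eq_mul, Matrix.transpose_apply]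
      simpa using (hz.mul_const (X j i)).const_sub ((1 : Matrix ξ ξ ℂ) i j)
  ext x y
  have e : ∀ z : ℝ, RR t (1 + (z : ℂ) • X) (1 - (z : ℂ) • Xᵀ) * RR t W B
      = RR t W B * RR t (1 + (z : ℂ) • X') (1 - (z : ℂ) • X'ᵀ) := by
    intro z
    rw [RR_mul, RR_mul]
    congr 1
    · rw [add_mul, mul_add, smul_mul_assoc, mul_smul_comm, h1]; simp
    · rw [sub_mul, mul_sub, smul_mul_assoc, mul_smul_comm, h2]; simp
  have d1 : HasDerivAt (fun z : ℝ => (RR t (1 + (z : ℂ) • X) (1 - (z : ℂ) • Xᵀ) * RR t W B :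
      Matrix (Idx t ξ) (Idx t ξ) ℂ) x y)
      ((dmom t X * RR t W B : Matrix (Idx t ξ) (Idx t ξ) ℂ) x y) 0 := by
    simp only [Matrix.mul_apply]
    exact HasDerivAt.fun_sum fun j _ => (hd X x j).mul_const _
  have d2 : HasDerivAt (fun z : ℝ => (RR t W B * RR t (1 + (z : ℂ) • X') (1 - (z : ℂ) • X'ᵀ) :
      Matrix (Idx t ξ) (Idx t ξ) ℂ) x y)
      ((RR t W B * dmom t X' : Matrix (Idx t ξ) (Idx t ξ) ℂ) x y) 0 := by
    simp only [Matrix.mul_apply]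
    exact HasDerivAt.fun_sum fun j _ => (hd X' j y).const_mul _
  simp only [e] at d1
  exact d1.unique d2

lemma dmom_conj (X W : Matrix ξ ξ ℂ) (hW : W ∈ Matrix.unitaryGroup ξ ℂ) :
    dmom t X * momentMat t W = momentMat t W * dmom t (Wᴴ * X * W) := by
  rw [momentMat_eq]
  have hW1 : W * Wᴴ = 1 := (Matrix.mem_unitaryGroup_iff).1 hW
  apply dmom_one_comp
  · rw [← mul_assoc, ← mul_assoc, hW1, one_mul]
  · have h : cj W * Wᵀ = 1 := by
      have h := congrArg Matrix.transpose hW1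
      rw [Matrix.transpose_mul, Matrix.transpose_one] at h
      exact h
    rw [Matrix.transpose_mul, Matrix.transpose_mul, ← mul_assoc, ← mul_assoc, h, one_mul]
    rfl

end rep
end TPE

set_option linter.style.haveILetI false
namespace TPE

section avg
variable {E : Type*} [NormedAddCommGroup E] [InnerProductSpace ℂ E] [FiniteDimensional ℂ E]
variable {G : Type*} [Group G] [TopologicalSpace G] [IsTopologicalGroup G] [CompactSpace G]
  [MeasurableSpace G] [BorelSpace G]

lemma integrable_cont {F : Type*} [NormedAddCommGroup F]
    (ν : Measure G) [IsProbabilityMeasure ν] (f : G → F) (hf : Continuous f) :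
    Integrable f ν :=
  hf.integrable_of_hasCompactSupport (HasCompactSupport.of_compactSpace f)

lemma avg_proj (ν : Measure G) [IsProbabilityMeasure ν] [ν.IsMulLeftInvariant]
    (π : G → E →L[ℂ] E) (hmul : ∀ g h v, π (g * h) v = π g (π h v))
    (hcont : ∀ v, Continuous fun g => π g v)
    (hadj : ∀ g v w, inner ℂ (π g v) w = inner ℂ v (π g⁻¹ w))
    (V : Submodule ℂ E) (hV : ∀ v, v ∈ V ↔ ∀ g, π g v = v) (v : E) :
    ∫ g, π g v ∂ν = V.starProjection v := by
  have : CompleteSpace E := FiniteDimensional.complete ℂ E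
  symm
  apply Submodule.eq_starProjection_of_mem_of_inner_eq_zero
  · rw [hV]
    intro h
    rw [← ContinuousLinearMap.integral_comp_comm _ (integrable_cont ν _ (hcont v))]
    simp_rw [← hmul]
    exact integral_mul_left_eq_self (μ := ν) (fun g => π g v) h
  · intro w hw
    rw [hV] at hw
    rw [inner_sub_left, sub_eq_zero]
    have h1 : inner ℂ w (∫ g, π g v ∂ν) = ∫ g, inner ℂ w (π g v) ∂ν :=
      (integral_inner (integrable_cont ν _ (hcont v)) w).symm
    have h2 : ∀ g, inner ℂ w (π g v) = inner ℂ w v := by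
      intro g
      rw [← inner_conj_symm, hadj, hw, inner_conj_symm]
    simp only [h2] at h1
    rw [← inner_conj_symm, ← inner_conj_symm (∫ g, π g v ∂ν), h1]
    simp
end avg

section uni
variable {ξ : Type*} [Fintype ξ] [DecidableEq ξ] {t : ℕ}

instance compactU : CompactSpace (Matrix.unitaryGroup ξ ℂ) := by
  refine (isCompact_iff_compactSpace (s := ((Matrix.unitaryGroup ξ ℂ :
    Submonoid (Matrix ξ ξ ℂ)) : Set (Matrix ξ ξ ℂ)))).1 ?_
  have h1 : IsClosed ((Matrix.unitaryGroup ξ ℂ : Submonoid (Matrix ξ ξ ℂ)) : Set (Matrix ξ ξ ℂ)) := by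
    have : ((Matrix.unitaryGroup ξ ℂ : Submonoid (Matrix ξ ξ ℂ)) : Set (Matrix ξ ξ ℂ))
        = {A | A * star A = 1} := by
      ext A; exact Matrix.mem_unitaryGroup_iff
    rw [this]
    exact isClosed_eq (by fun_prop) continuous_const
  have h2 : IsCompact (Set.pi Set.univ fun _ : ξ => Set.pi Set.univ fun _ : ξ =>
      Metric.closedBall (0:ℂ) 1) :=
    isCompact_univ_pi fun _ => isCompact_univ_pi fun _ => isCompact_closedBall _ _
  refine IsCompact.of_isClosed_subset (X := ξ → ξ → ℂ) h2 h1 ?_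
  intro A hA i _ j _
  simpa using entry_norm_bound_of_unitary hA i j

/-- Haar probability measure on `U(ξ)` -/
def nu (ξ : Type*) [Fintype ξ] [DecidableEq ξ] : Measure (Matrix.unitaryGroup ξ ℂ) :=
  Measure.haarMeasure ⊤

instance : (nu ξ).IsHaarMeasure := by unfold nu; infer_instance
instance : IsProbabilityMeasure (nu ξ) := ⟨by
  have := Measure.haarMeasure_self (G := Matrix.unitaryGroup ξ ℂ) (K₀ := ⊤)
  simpa [nu] using this⟩

lemma momentMat_continuous : Continuous (fun U : Matrix ξ ξ ℂ => momentMat t U) := by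
  apply continuous_pi; intro x; apply continuous_pi; intro y
  unfold momentMat
  refine Continuous.mul ?_ ?_
  · exact continuous_finsetProd _ fun s _ => (continuous_apply_apply _ _)
  · exact continuous_finsetProd _ fun s _ =>
      Complex.continuous_conj.comp (continuous_apply_apply _ _)

/-- entrywise matrix integrals commute with `op` -/
lemma op_integral {G : Type*} [TopologicalSpace G] [CompactSpace G]
    [MeasurableSpace G] [BorelSpace G] {ι : Type*} [Fintype ι] [DecidableEq ι]
    (ν : Measure G) [IsProbabilityMeasure ν] (A : G → Matrix ι ι ℂ) (hA : Continuous A)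
    (v : EuclideanSpace ℂ ι) :
    op (Matrix.of fun x y => ∫ g, A g x y ∂ν) v = ∫ g, op (A g) v ∂ν := by
  ext i
  rw [op_apply]
  have hc : Continuous fun g => op (A g) v := (op_continuous v).comp hA
  have hi : Integrable (fun g => op (A g) v) ν :=
    hc.integrable_of_hasCompactSupport (HasCompactSupport.of_compactSpace _)
  have := (EuclideanSpace.proj (𝕜 := ℂ) i).integral_comp_comm hi
  have e : (∫ g, op (A g) v ∂ν) i = ∫ g, op (A g) v i ∂ν := this.symm
  rw [e]
  simp only [op_apply, Matrix.of_apply]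
  rw [integral_finsetSum]
  · refine Finset.sum_congr rfl fun j _ => ?_
    rw [integral_mul_const]
  · intro j _
    have hc : Continuous fun g => A g i j * v j := by
      have : Continuous fun g => A g i j := (continuous_apply_apply i j).comp hA
      fun_prop
    exact hc.integrable_of_hasCompactSupport (HasCompactSupport.of_compactSpace _)

/-- full unitary-fixed space -/
def VU (t : ℕ) (ξ : Type*) [Fintype ξ] [DecidableEq ξ] : Submodule ℂ (HS t ξ) where
  carrier := {v | ∀ U : Matrix.unitaryGroup ξ ℂ, op (momentMat t (U : Matrix ξ ξ ℂ)) v = v}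
  add_mem' := by
    intro a b ha hb U
    rw [map_add, ha, hb]
  zero_mem' := by intro U; simp
  smul_mem' := by
    intro c a ha U
    rw [map_smul, ha]

lemma haar_eq_proj (μ : Measure (Matrix.unitaryGroup ξ ℂ)) [IsProbabilityMeasure μ]
    [μ.IsMulLeftInvariant] :
    op (haarMomentMat t μ) = (VU t ξ).starProjection := by
  ext1 v
  have h1 := op_integral μ (fun U : Matrix.unitaryGroup ξ ℂ => momentMat t (U : Matrix ξ ξ ℂ))
    (momentMat_continuous.comp continuous_subtype_val) v
  have : op (haarMomentMat t μ) v = _ := h1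
  rw [this]
  refine avg_proj μ (fun U : Matrix.unitaryGroup ξ ℂ => op (momentMat t (U : Matrix ξ ξ ℂ)))
    ?_ ?_ ?_ _ ?_ v
  · intro g h v
    rw [← op_mul_apply, ← momentMat_mul]; rfl
  · intro v
    exact (op_continuous v).comp (momentMat_continuous.comp continuous_subtype_val)
  · intro g v w
    rw [op_adj, momentMat_conjTranspose]; rfl
  · intro v; rfl

/-- moment matrices of unitaries are isometries -/
lemma momentMat_norm (U : Matrix ξ ξ ℂ) (hU : U ∈ Matrix.unitaryGroup ξ ℂ) (v : HS t ξ) :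
    ‖op (momentMat t U) v‖ = ‖v‖ := by
  have h : inner ℂ (op (momentMat t U) v) (op (momentMat t U) v) = inner ℂ v v := by
    rw [op_adj, ← op_mul_apply, momentMat_conjTranspose, ← momentMat_mul,
      ← Matrix.star_eq_conjTranspose, (Matrix.mem_unitaryGroup_iff').1 hU, momentMat_one, op_one]
    rfl
  rw [inner_self_eq_norm_sq_to_K, inner_self_eq_norm_sq_to_K] at h
  have h2 : ‖op (momentMat t U) v‖ ^ 2 = ‖v‖ ^ 2 := by exact_mod_cast h
  exact (sq_eq_sq₀ (norm_nonneg _) (norm_nonneg _)).1 h2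

open NormedSpace in
lemma exp_entry_hasDerivAt (X : Matrix ξ ξ ℂ) (i j : ξ) :
    HasDerivAt (fun z : ℝ => (exp ((z : ℂ) • X) : Matrix ξ ξ ℂ) i j) (X i j) 0 := by
  let _i : NormedRing (Matrix ξ ξ ℂ) := Matrix.linftyOpNormedRing
  let _i : NormedAlgebra ℂ (Matrix ξ ξ ℂ) := Matrix.linftyOpNormedAlgebra
  let _i : NormedAlgebra ℝ (Matrix ξ ξ ℂ) := Matrix.linftyOpNormedAlgebra
  have h : HasDerivAt (fun u : ℝ => exp (u • X)) (exp ((0:ℝ) • X) * X) 0 :=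
    hasDerivAt_exp_smul_const (𝕂 := ℝ) X (0:ℝ)
  have e : ∀ z : ℝ, z • X = (z : ℂ) • X := by
    intro z; ext i j; simp
  rw [zero_smul, exp_zero, one_mul] at h
  simp only [e] at h
  let L : Matrix ξ ξ ℂ →ₗ[ℝ] ℂ :=
    { toFun := fun A => A i j
      map_add' := fun A B => rfl
      map_smul' := fun c A => rfl }
  exact (L.toContinuousLinearMap.hasFDerivAt.comp_hasDerivAt (0:ℝ) h)

open NormedSpace in
/-- vectors fixed under a one-parameter group are annihilated by the generator -/
lemma dmom_of_fixed (X : Matrix ξ ξ ℂ) (v : HS t ξ)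
    (h : ∀ z : ℝ, op (RR t (exp ((z : ℂ) • X)) ((exp (-((z : ℂ) • X)))ᵀ)) v = v) :
    op (dmom t X) v = 0 := by
  ext x
  rw [op_apply]
  have hd : ∀ y, HasDerivAt (fun z : ℝ => RR t (exp ((z : ℂ) • X)) ((exp (-((z : ℂ) • X)))ᵀ) x y)
      (dmom t X x y) 0 := by
    intro y
    apply RR_hasDerivAt (fun z : ℝ => exp ((z : ℂ) • X)) (fun z : ℝ => (exp (-((z : ℂ) • X)))ᵀ) X
    · simp
    · simp
    · exact exp_entry_hasDerivAt X
    · intro i j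
      have := exp_entry_hasDerivAt (-X) j i
      simpa [smul_neg] using this
  have d1 : HasDerivAt (fun z : ℝ => ∑ y, RR t (exp ((z : ℂ) • X)) ((exp (-((z : ℂ) • X)))ᵀ) x y * v y)
      (∑ y, dmom t X x y * v y) 0 := HasDerivAt.fun_sum fun y _ => (hd y).mul_const _
  have e : (fun z : ℝ => ∑ y, RR t (exp ((z : ℂ) • X)) ((exp (-((z : ℂ) • X)))ᵀ) x y * v y)
      = fun _ => v x := by
    funext z
    rw [← op_apply, h z]
  rw [e] at d1
  exact d1.unique (hasDerivAt_const _ _)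

open NormedSpace in
lemma exp_skew_unitary (X : Matrix ξ ξ ℂ) (hX : Xᴴ = -X) :
    exp X ∈ Matrix.unitaryGroup ξ ℂ := by
  rw [Matrix.mem_unitaryGroup_iff, Matrix.star_eq_conjTranspose, ← Matrix.exp_conjTranspose, hX,
    ← Matrix.exp_add_of_commute _ _ (Commute.neg_right (Commute.refl X))]
  simp

open NormedSpace in
lemma RR_exp_skew (X : Matrix ξ ξ ℂ) (hX : Xᴴ = -X) (z : ℝ) :
    RR t (exp ((z : ℂ) • X)) ((exp (-((z : ℂ) • X)))ᵀ) = momentMat t (exp ((z : ℂ) • X)) := by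
  rw [momentMat_eq]
  congr 1
  have : (cj (exp ((z : ℂ) • X)))ᵀ = exp (-((z : ℂ) • X)) := by
    rw [cj_transpose, ← Matrix.exp_conjTranspose, Matrix.conjTranspose_smul, hX]
    simp
  rw [← this, Matrix.transpose_transpose]

/-- a star-closed complex subspace of matrices; vectors fixed by the exponentials of its skew
elements are annihilated by the infinitesimal action of the whole subspace. -/
lemma dmom_of_unitary_fixed (𝒜 : Submodule ℂ (Matrix ξ ξ ℂ)) (hs : ∀ X ∈ 𝒜, Xᴴ ∈ 𝒜) (v : HS t ξ)
    (h : ∀ X ∈ 𝒜, Xᴴ = -X → op (momentMat t (NormedSpace.exp X)) v = v)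
    (X : Matrix ξ ξ ℂ) (hX : X ∈ 𝒜) : op (dmom t X) v = 0 := by
  have key : ∀ Y ∈ 𝒜, Yᴴ = -Y → op (dmom t Y) v = 0 := by
    intro Y hY hYs
    apply dmom_of_fixed
    intro z
    rw [RR_exp_skew Y hYs]
    apply h _ (𝒜.smul_mem _ hY)
    rw [Matrix.conjTranspose_smul, hYs]; simp
  have e : X = (1/2 : ℂ) • (X - Xᴴ) + (-Complex.I/2) • (Complex.I • (X + Xᴴ)) := by
    rw [smul_smul]
    have : -Complex.I / 2 * Complex.I = 1/2 := by
      rw [div_mul_eq_mul_div, neg_mul, Complex.I_mul_I, neg_neg]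
    rw [this, ← smul_add]
    ext i j
    simp; ring
  rw [e, map_add, map_smul, map_smul, op_add, op_smul, op_smul]
  have h1 := key (X - Xᴴ) (𝒜.sub_mem hX (hs X hX)) (by simp)
  have h2 := key (Complex.I • (X + Xᴴ)) (𝒜.smul_mem _ (𝒜.add_mem hX (hs X hX))) (by
    rw [Matrix.conjTranspose_smul]
    simp [add_comm])
  rw [_root_.add_apply, _root_.smul_apply,
    _root_.smul_apply, h1, h2, smul_zero, smul_zero, add_zero]
end uni
end TPE

namespace TPE

section schur
variable {ξ : Type*} [Fintype ξ] [DecidableEq ξ] {t : ℕ}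

lemma prod_one_erase (a y : Fin t → ξ) (s : Fin t) (g : ξ → ℂ) :
    (∏ s' ∈ Finset.univ.erase s, (1 : Matrix ξ ξ ℂ) (a s') (y s')) * g (y s)
      = ∑ c, if y = Function.update a s c then g c else 0 := by
  rw [Finset.sum_eq_single (y s)]
  · have h : (∏ s' ∈ Finset.univ.erase s, (1 : Matrix ξ ξ ℂ) (a s') (y s'))
        = if y = Function.update a s (y s) then 1 else 0 := by
      simp only [Matrix.one_apply]
      rw [Finset.prod_ite_zero]
      simp only [Finset.prod_const_one]
      congr 1
      rw [eq_iff_iff]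
      constructor
      · intro h
        funext r
        by_cases hr : r = s
        · subst hr; simp
        · rw [Function.update_of_ne hr]
          exact (h r (by simp [hr])).symm
      · intro h r hr
        have hr' : r ≠ s := by simpa using hr
        have := congrFun h r
        rw [Function.update_of_ne hr'] at this
        exact this.symm
    rw [h]; split_ifs <;> simp
  · intro b _ hb
    rw [if_neg]
    intro h
    apply hb
    rw [h]; simp
  · simp

/-- explicit formula of the infinitesimal action -/
lemma dmom_op_apply (X : Matrix ξ ξ ℂ) (v : HS t ξ) (x : Idx t ξ) :
    op (dmom t X) v x = (∑ s, ∑ c, X (x.1 s) c * v (Function.update x.1 s c, x.2))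
      - ∑ s, ∑ c, X c (x.2 s) * v (x.1, Function.update x.2 s c) := by
  rw [op_apply]
  simp only [dmom_apply, add_mul, Finset.sum_add_distrib]
  rw [sub_eq_add_neg]
  have hone : ∀ a b : Fin t → ξ, (∏ s, (1 : Matrix ξ ξ ℂ) (a s) (b s)) = if b = a then 1 else 0 := by
    intro a b
    simp only [Matrix.one_apply]
    rw [Finset.prod_ite_zero]
    simp [funext_iff, eq_comm]
  congr 1
  · rw [Fintype.sum_prod_type]
    have : ∀ y1 : Fin t → ξ, (∑ y2 : Fin t → ξ,
        ((∑ s, (∏ s' ∈ Finset.univ.erase s, (1 : Matrix ξ ξ ℂ) (x.1 s') (y1 s')) * X (x.1 s) (y1 s)) *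
        ∏ s, (1 : Matrix ξ ξ ℂ) (x.2 s) (y2 s)) * v (y1, y2))
        = ∑ s, ∑ c, if y1 = Function.update x.1 s c then X (x.1 s) c * v (y1, x.2) else 0 := by
      intro y1
      rw [Finset.sum_eq_single x.2]
      · rw [hone, if_pos rfl, mul_one, Finset.sum_mul]
        refine Finset.sum_congr rfl fun s _ => ?_
        rw [prod_one_erase x.1 y1 s (fun c => X (x.1 s) c), Finset.sum_mul]
        refine Finset.sum_congr rfl fun c _ => ?_
        split_ifs <;> simp
      · intro b _ hb
        rw [hone, if_neg hb]; simp
      · simp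
    simp only [this]
    rw [Finset.sum_comm]
    refine Finset.sum_congr rfl fun s _ => ?_
    rw [Finset.sum_comm]
    refine Finset.sum_congr rfl fun c _ => ?_
    simp
  · rw [Fintype.sum_prod_type, Finset.sum_comm, ← Finset.sum_neg_distrib]
    have : ∀ y2 : Fin t → ξ, (∑ y1 : Fin t → ξ,
        ((∏ s, (1 : Matrix ξ ξ ℂ) (x.1 s) (y1 s)) *
        (∑ s, (∏ s' ∈ Finset.univ.erase s, (1 : Matrix ξ ξ ℂ) (x.2 s') (y2 s')) * -X (y2 s) (x.2 s))) * v (y1, y2))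
        = ∑ s, ∑ c, if y2 = Function.update x.2 s c then -X c (x.2 s) * v (x.1, y2) else 0 := by
      intro y2
      rw [Finset.sum_eq_single x.1]
      · rw [hone, if_pos rfl, one_mul, Finset.sum_mul]
        refine Finset.sum_congr rfl fun s _ => ?_
        rw [prod_one_erase x.2 y2 s (fun c => -X c (x.2 s)), Finset.sum_mul]
        refine Finset.sum_congr rfl fun c _ => ?_
        split_ifs <;> simp
      · intro b _ hb
        rw [hone, if_neg hb]; simp
      · simp
    simp only [this]
    rw [Finset.sum_comm]
    refine Finset.sum_congr rfl fun s _ => ?_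
    rw [Finset.sum_comm, ← Finset.sum_neg_distrib]
    refine Finset.sum_congr rfl fun c _ => ?_
    simp

/-- the infinitesimal invariance relation -/
def Rel (v : (Fin t → ξ) → (Fin t → ξ) → ℂ) : Prop := ∀ (a b : ξ) (x y : Fin t → ξ),
  (∑ s, if x s = a then v (Function.update x s b) y else 0)
    = ∑ s, if y s = b then v x (Function.update y s a) else 0

lemma rel_of_dmom (v : HS t ξ) (h : ∀ a b, op (dmom t (Matrix.single a b (1:ℂ))) v = 0) :
    Rel (fun x y => v (x, y)) := by
  intro a b x y
  have := congrArg (fun w : HS t ξ => w (x, y)) (h a b)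
  simp only [dmom_op_apply] at this
  have h0 : (0 : HS t ξ) (x, y) = 0 := rfl
  rw [h0, sub_eq_zero] at this
  simp only [Matrix.single_apply] at this
  convert this using 1
  · refine Finset.sum_congr rfl fun s _ => ?_
    rw [Finset.sum_eq_single b]
    · by_cases hh : x s = a
      · rw [if_pos hh, if_pos ⟨hh.symm, rfl⟩, one_mul]
      · rw [if_neg hh, if_neg (fun h => hh h.1.symm), zero_mul]
    · intro c _ hc
      rw [if_neg (fun h => hc h.2.symm), zero_mul]
    · simp
  · refine Finset.sum_congr rfl fun s _ => ?_
    rw [Finset.sum_eq_single a]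
    · by_cases hh : y s = b
      · rw [if_pos hh, if_pos ⟨rfl, hh.symm⟩, one_mul]
      · rw [if_neg hh, if_neg (fun h => hh h.2.symm), zero_mul]
    · intro c _ hc
      rw [if_neg (fun h => hc h.1.symm), zero_mul]
    · simp

/-- permutation indicator -/
def psi (σ : Equiv.Perm (Fin t)) (x y : Fin t → ξ) : ℂ := if x = y ∘ σ then 1 else 0

lemma rel_psi (σ : Equiv.Perm (Fin t)) : Rel (psi (ξ := ξ) σ) := by
  intro a b x y
  rw [← Equiv.sum_comp σ (fun s => if y s = b then psi σ x (Function.update y s a) else 0)]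
  refine Finset.sum_congr rfl fun s _ => ?_
  have e : Function.update y (σ s) a ∘ σ = Function.update (y ∘ σ) s a := by
    funext r
    by_cases hr : r = s
    · subst hr; simp
    · simp [Function.update_of_ne hr, Function.update_of_ne (fun h => hr (σ.injective h))]
  unfold psi
  rw [e, ← ite_and, ← ite_and]
  congr 1
  rw [eq_iff_iff]
  constructor
  · rintro ⟨h1, h2⟩
    constructor
    · have := congrFun h2 s; simpa using this.symm
    · rw [← h2, ← h1]; simp
  · rintro ⟨h1, h2⟩
    constructor
    · rw [h2]; simp
    · rw [h2, ← h1]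
      funext r
      by_cases hr : r = s
      · subst hr; simp
      · simp [Function.update_of_ne hr]

lemma Rel.sub_sum {v : (Fin t → ξ) → (Fin t → ξ) → ℂ} (h : Rel v) (c : Equiv.Perm (Fin t) → ℂ) :
    Rel (fun x y => v x y - ∑ σ, c σ * psi σ x y) := by
  intro a b x y
  have h1 := h a b x y
  have h2 : ∀ σ : Equiv.Perm (Fin t), _ := fun σ => rel_psi (ξ := ξ) σ a b x y
  have l : ∀ s : Fin t, (if x s = a then v (Function.update x s b) y - ∑ σ, c σ * psi σ (Function.update x s b) y else 0)
      = (if x s = a then v (Function.update x s b) y else 0)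
        - ∑ σ, c σ * (if x s = a then psi σ (Function.update x s b) y else 0) := by
    intro s; split_ifs <;> simp
  have r : ∀ s : Fin t, (if y s = b then v x (Function.update y s a) - ∑ σ, c σ * psi σ x (Function.update y s a) else 0)
      = (if y s = b then v x (Function.update y s a) else 0)
        - ∑ σ, c σ * (if y s = b then psi σ x (Function.update y s a) else 0) := by
    intro s; split_ifs <;> simp
  simp only [l, r, Finset.sum_sub_distrib]
  rw [h1]
  congr 1
  rw [Finset.sum_comm]
  conv_rhs => rw [Finset.sum_comm]
  refine Finset.sum_congr rfl fun σ _ => ?_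
  rw [← Finset.mul_sum, ← Finset.mul_sum, h2]

lemma Rel.step {v : (Fin t → ξ) → (Fin t → ξ) → ℂ} (h : Rel v) (x : Fin t → ξ) (hx : ∀ y, v x y = 0)
    (s : Fin t) (hs : ∀ r, r ≠ s → x r ≠ x s) (b : ξ) : ∀ y, v (Function.update x s b) y = 0 := by
  intro y
  have := h (x s) b x y
  rw [Finset.sum_eq_single s] at this
  · simpa [hx] using this
  · intro r _ hr
    rw [if_neg (hs r hr)]
  · simp

lemma Rel.disj {v : (Fin t → ξ) → (Fin t → ξ) → ℂ} (h : Rel v) (x : Fin t → ξ) (hx : ∀ y, v x y = 0)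
    (hinj : Function.Injective x) (z : Fin t → ξ) (hz : ∀ s r, x s ≠ z r) : ∀ y, v z y = 0 := by
  have : ∀ T : Finset (Fin t), ∀ y, v (T.piecewise z x) y = 0 := by
    intro T
    induction T using Finset.induction_on with
    | empty => simpa using hx
    | insert a T ha ih =>
      rw [Finset.piecewise_insert]
      apply h.step _ ih
      intro r hr
      have e : T.piecewise z x a = x a := by simp [ha]
      rw [e]
      by_cases hT : r ∈ T
      · simp only [hT, Finset.piecewise_eq_of_mem]
        exact fun h => hz a r h.symm
      · simp only [hT, not_false_eq_true, Finset.piecewise_eq_of_notMem]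
        exact fun h => hr (hinj h)
  have h2 := this Finset.univ
  simpa using h2

lemma Rel.all (hc : 2 * t ≤ Fintype.card ξ) {v : (Fin t → ξ) → (Fin t → ξ) → ℂ} (h : Rel v)
    (z : Fin t → ξ) : ∀ (k : ℕ) (x : Fin t → ξ) (_ : ∀ y, v x y = 0)
    (_ : Function.Injective x) (_ : (Finset.univ.filter fun s => ∃ r, x s = z r).card = k),
      ∀ y, v z y = 0 := by
  intro k
  induction k using Nat.strong_induction_on with
  | _ k ih =>
  intro x hx hinj hk
  by_cases hd : ∀ s r, x s ≠ z r
  · exact h.disj x hx hinj z hd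
  push Not at hd
  obtain ⟨s, r, hsr⟩ := hd
  -- fresh element
  have hcard : (Finset.univ.image x ∪ (Finset.univ.image z).erase (z r)).card < Fintype.card ξ := by
    have h1 : (Finset.univ.image x).card ≤ t := by
      simpa using Finset.card_image_le (s := (Finset.univ : Finset (Fin t))) (f := x)
    have h2 : ((Finset.univ.image z).erase (z r)).card + 1 ≤ t := by
      rw [Finset.card_erase_add_one (Finset.mem_image_of_mem _ (Finset.mem_univ r))]
      simpa using Finset.card_image_le (s := (Finset.univ : Finset (Fin t))) (f := z)
    have := Finset.card_union_le (Finset.univ.image x) ((Finset.univ.image z).erase (z r))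
    omega
  obtain ⟨f, hf⟩ : ∃ f, f ∉ (Finset.univ.image x ∪ (Finset.univ.image z).erase (z r)) := by
    by_contra hcon
    push Not at hcon
    rw [Finset.eq_univ_iff_forall.2 hcon, Finset.card_univ] at hcard
    exact lt_irrefl _ hcard
  have hfx : ∀ s, x s ≠ f := by
    intro s hs
    exact hf (Finset.mem_union_left _ (hs ▸ Finset.mem_image_of_mem _ (Finset.mem_univ s)))
  have hfz : ∀ r', z r' ≠ f := by
    intro r' hr'
    by_cases he : f = z r
    · exact hfx s (hsr.trans he.symm)
    · exact hf (Finset.mem_union_right _ (Finset.mem_erase.2 ⟨he,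
        hr' ▸ Finset.mem_image_of_mem _ (Finset.mem_univ r')⟩))
  refine ih _ ?_ (Function.update x s f) (h.step x hx s (fun r hr h => hr (hinj h)) f) ?_ rfl
  · rw [← hk]
    apply Finset.card_lt_card
    rw [Finset.ssubset_iff]
    refine ⟨s, ?_, ?_⟩
    · simp only [Finset.mem_filter, Finset.mem_univ, Function.update_self, true_and, not_exists]
      intro r' h; exact hfz r' h.symm
    · intro s' hs'
      rw [Finset.mem_insert] at hs'
      rcases hs' with rfl | hs'
      · simp only [Finset.mem_filter, Finset.mem_univ, true_and]; exact ⟨r, hsr⟩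
      · simp only [Finset.mem_filter, Finset.mem_univ, true_and] at hs' ⊢
        obtain ⟨r', hr'⟩ := hs'
        by_cases hss : s' = s
        · subst hss; exact ⟨r, hsr⟩
        · rw [Function.update_of_ne hss] at hr'; exact ⟨r', hr'⟩
  · intro a b hab
    by_cases ha : a = s <;> by_cases hb : b = s
    · rw [ha, hb]
    · subst ha
      rw [Function.update_self, Function.update_of_ne hb] at hab
      exact absurd hab.symm (hfx b)
    · subst hb
      rw [Function.update_self, Function.update_of_ne ha] at hab
      exact absurd hab (hfx a)
    · rw [Function.update_of_ne ha, Function.update_of_ne hb] at hab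
      exact hinj hab

/-- pure Schur–Weyl duality in the stable range -/
theorem schur_weyl (hc : 2 * t ≤ Fintype.card ξ) {v : (Fin t → ξ) → (Fin t → ξ) → ℂ} (h : Rel v) :
    ∃ c : Equiv.Perm (Fin t) → ℂ, ∀ x y, v x y = ∑ σ, c σ * psi σ x y := by
  have hemb : Nonempty (Fin t ↪ ξ) := by
    apply Function.Embedding.nonempty_of_card_le
    simp; omega
  obtain ⟨x0⟩ := hemb
  refine ⟨fun σ => v x0 (x0 ∘ σ.symm), ?_⟩
  set c : Equiv.Perm (Fin t) → ℂ := fun σ => v x0 (x0 ∘ σ.symm) with hcdef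
  have h' := h.sub_sum c
  have h0 : ∀ y, v x0 y - ∑ σ, c σ * psi σ x0 y = 0 := by
    intro y
    by_cases hp : ∃ σ : Equiv.Perm (Fin t), (x0 : Fin t → ξ) = y ∘ σ
    · obtain ⟨σ, hσ⟩ := hp
      have hy : y = x0 ∘ σ.symm := by rw [hσ]; funext r; simp
      rw [Finset.sum_eq_single σ]
      · unfold psi; rw [if_pos hσ, hcdef, mul_one]; simp only [← hy, sub_self]
      · intro τ _ hτ
        unfold psi
        rw [if_neg, mul_zero]
        intro hh
        apply hτ
        ext s
        have := congrFun hh s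
        rw [hy] at this
        simp only [Function.comp] at this
        have := congrArg σ (x0.injective this)
        rw [this]; simp
      · simp
    · have hs : ∑ σ, c σ * psi σ x0 y = 0 := by
        apply Finset.sum_eq_zero
        intro σ _
        unfold psi
        rw [if_neg (fun hh => hp ⟨σ, hh⟩), mul_zero]
      rw [hs, sub_zero]
      by_contra hne
      apply hp
      have hex : ∀ s, ∃ s', y s' = x0 s := by
        intro s
        by_contra hno
        push Not at hno
        have := h (x0 s) (x0 s) x0 y
        rw [Finset.sum_eq_single s] at this
        · simp [hno] at this
          exact hne this
        · intro r _ hr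
          rw [if_neg (fun hh => hr (x0.injective hh))]
        · simp
      choose f hf using hex
      have finj : Function.Injective f := by
        intro a b hab
        apply x0.injective
        rw [← hf, ← hf, hab]
      refine ⟨Equiv.ofBijective f (Finite.injective_iff_bijective.1 finj), ?_⟩
      funext s
      simp [hf]
  intro x y
  have := h'.all hc x _ x0 h0 x0.injective rfl y
  exact sub_eq_zero.1 this

end schur
end TPE

namespace TPE

/-- qubit configurations -/
abbrev Q (n : ℕ) := Fin n → Fin 2
/-- `n`-qubit matrices -/
abbrev MQ (n : ℕ) := Matrix (Q n) (Q n) ℂ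

section units
variable {n : ℕ}

/-- one-qubit matrix units -/
def mu (q : Fin n) (i j : Fin 2) : MQ n :=
  Matrix.of fun x y => if x q = i ∧ y = Function.update x q j then 1 else 0

lemma mu_mul_apply (q : Fin n) (i j : Fin 2) (A : MQ n) (x y : Q n) :
    (mu q i j * A) x y = if x q = i then A (Function.update x q j) y else 0 := by
  rw [Matrix.mul_apply]
  simp only [mu, Matrix.of_apply]
  by_cases h : x q = i
  · simp [h]
  · simp [h]

lemma mul_mu_apply (q : Fin n) (i j : Fin 2) (A : MQ n) (x y : Q n) :
    (A * mu q i j) x y = if y q = j then A x (Function.update y q i) else 0 := by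
  rw [Matrix.mul_apply]
  simp only [mu, Matrix.of_apply]
  have e : ∀ z : Q n, (z q = i ∧ y = Function.update z q j) ↔
      (y q = j ∧ z = Function.update y q i) := by
    intro z
    constructor
    · rintro ⟨h1, h2⟩
      subst h2
      refine ⟨by simp, ?_⟩
      rw [← h1]; simp
    · rintro ⟨h1, h2⟩
      subst h2
      refine ⟨by simp, ?_⟩
      rw [← h1]; simp
  simp only [e]
  by_cases h : y q = j
  · simp [h]
  · simp [h]

lemma mu_star (q : Fin n) (i j : Fin 2) : (mu q i j)ᴴ = mu q j i := by
  ext x y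
  rw [Matrix.conjTranspose_apply]
  simp only [mu, Matrix.of_apply]
  have e : (y q = i ∧ x = Function.update y q j) ↔
      (x q = j ∧ y = Function.update x q i) := by
    constructor
    · rintro ⟨h1, h2⟩
      subst h2
      refine ⟨by simp, ?_⟩
      rw [← h1]; simp
    · rintro ⟨h1, h2⟩
      subst h2
      refine ⟨by simp, ?_⟩
      rw [← h1]; simp
  simp only [e]
  split_ifs <;> simp

lemma mu_mul_mu (q : Fin n) (i j k l : Fin 2) :
    mu q i j * mu q k l = if j = k then mu q i l else 0 := by
  ext x y
  rw [mu_mul_apply]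
  by_cases h : j = k
  · subst h
    simp only [mu, Matrix.of_apply, Function.update_self, Function.update_idem, true_and, if_true]
    rw [← ite_and]
  · rw [if_neg h]
    simp [mu, h]

lemma mu_sum (q : Fin n) : ∑ i, mu q i i = 1 := by
  ext x y
  rw [Matrix.sum_apply]
  simp only [mu, Matrix.of_apply, Matrix.one_apply]
  rw [Finset.sum_eq_single (x q)]
  · simp [eq_comm]
  · intro b _ hb
    rw [if_neg (fun h => hb h.1.symm)]
  · simp

lemma mu_comm {q r : Fin n} (h : q ≠ r) (i j k l : Fin 2) :
    mu q i j * mu r k l = mu r k l * mu q i j := by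
  ext x y
  rw [mu_mul_apply, mu_mul_apply]
  simp only [mu, Matrix.of_apply, Function.update_of_ne h, Function.update_of_ne h.symm,
    Function.update_comm h]
  split_ifs <;> simp_all

/-- operators supported on `S` -/
def Loc (S : Finset (Fin n)) : Subalgebra ℂ (MQ n) :=
  Subalgebra.centralizer ℂ {A | ∃ q, q ∉ S ∧ ∃ i j, A = mu q i j}

lemma mem_Loc {S : Finset (Fin n)} {X : MQ n} :
    X ∈ Loc S ↔ ∀ q, q ∉ S → ∀ i j, mu q i j * X = X * mu q i j := by
  unfold Loc
  rw [Subalgebra.mem_centralizer_iff]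
  constructor
  · intro h q hq i j
    exact h _ ⟨q, hq, i, j, rfl⟩
  · rintro h _ ⟨q, hq, i, j, rfl⟩
    exact h q hq i j

lemma Loc_mono {S T : Finset (Fin n)} (h : S ⊆ T) : Loc S ≤ Loc T := by
  intro X hX
  rw [mem_Loc] at hX ⊢
  exact fun q hq => hX q (fun hh => hq (h hh))

lemma Loc_star {S : Finset (Fin n)} {X : MQ n} (h : X ∈ Loc S) : Xᴴ ∈ Loc S := by
  rw [mem_Loc] at h ⊢
  intro q hq i j
  have := congrArg Matrix.conjTranspose (h q hq j i)
  rw [Matrix.conjTranspose_mul, Matrix.conjTranspose_mul, mu_star] at this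
  exact this.symm

lemma mu_mem_Loc {S : Finset (Fin n)} {q : Fin n} (h : q ∈ S) (i j : Fin 2) : mu q i j ∈ Loc S := by
  rw [mem_Loc]
  intro r hr k l
  apply mu_comm
  rintro rfl; exact hr h

lemma Loc_exp {S : Finset (Fin n)} {X : MQ n} (h : X ∈ Loc S) : NormedSpace.exp X ∈ Loc S := by
  let _i : NormedRing (MQ n) := Matrix.linftyOpNormedRing
  let _i : NormedAlgebra ℂ (MQ n) := Matrix.linftyOpNormedAlgebra
  rw [mem_Loc] at h ⊢
  intro q hq i j
  have : Commute X (mu q i j) := (h q hq i j).symm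
  exact this.exp_left.symm

lemma Loc_zero {S : Finset (Fin n)} {X : MQ n} (h : X ∈ Loc S) {q : Fin n} (hq : q ∉ S) {x y : Q n}
    (hxy : x q ≠ y q) : X x y = 0 := by
  have := congrFun (congrFun (mem_Loc.1 h q hq (x q) (x q)) x) y
  rw [mu_mul_apply, mul_mu_apply, if_pos rfl, if_neg hxy.symm] at this
  simpa using this

lemma Loc_update {S : Finset (Fin n)} {X : MQ n} (h : X ∈ Loc S) {q : Fin n} (hq : q ∉ S) {x y : Q n}
    (hxy : x q = y q) (j : Fin 2) : X (Function.update x q j) (Function.update y q j) = X x y := by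
  have := congrFun (congrFun (mem_Loc.1 h q hq (x q) j) x) (Function.update y q j)
  rw [mu_mul_apply, mul_mu_apply, if_pos rfl, if_pos (by simp)] at this
  rw [this, Function.update_idem, hxy, Function.update_eq_self]

lemma Loc_glue {S : Finset (Fin n)} {X : MQ n} (h : X ∈ Loc S) {x y : Q n}
    (hxy : ∀ q, q ∉ S → x q = y q) (w : Q n) :
    X (S.piecewise x w) (S.piecewise y w) = X x y := by
  have : ∀ T : Finset (Fin n), (∀ q ∈ T, q ∉ S) → X (T.piecewise w x) (T.piecewise w y) = X x y := by
    intro T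
    induction T using Finset.induction_on with
    | empty => simp
    | insert a T ha ih =>
      intro hT
      rw [Finset.piecewise_insert, Finset.piecewise_insert, Loc_update h (hT a (by simp))]
      · exact ih fun q hq => hT q (by simp [hq])
      · simp [ha, hxy a (hT a (by simp))]
  have h2 := this Sᶜ (by simp)
  rw [Finset.piecewise_compl, Finset.piecewise_compl] at h2
  exact h2

lemma Loc_apply {S : Finset (Fin n)} {X : MQ n} (h : X ∈ Loc S) (x y w : Q n) :
    X x y = if ∀ q, q ∉ S → x q = y q then X (S.piecewise x w) (S.piecewise y w) else 0 := by
  split_ifs with hh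
  · exact (Loc_glue h hh w).symm
  · push Not at hh
    obtain ⟨q, hq, hne⟩ := hh
    exact Loc_zero h hq hne

/-- matrices commuting with all units outside `S`, entrywise criterion -/
lemma mem_Loc_of {S : Finset (Fin n)} {X : MQ n}
    (h0 : ∀ q, q ∉ S → ∀ x y : Q n, x q ≠ y q → X x y = 0)
    (h1 : ∀ q, q ∉ S → ∀ x y : Q n, x q = y q → ∀ j, X (Function.update x q j) (Function.update y q j) = X x y) :
    X ∈ Loc S := by
  rw [mem_Loc]
  intro q hq i j
  ext x y
  rw [mu_mul_apply, mul_mu_apply]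
  by_cases hx : x q = i <;> by_cases hy : y q = j
  · rw [if_pos hx, if_pos hy]
    have := h1 q hq x (Function.update y q i) (by simp [hx]) j
    rw [← this, Function.update_idem, ← hy, Function.update_eq_self]
  · rw [if_pos hx, if_neg hy]
    exact h0 q hq _ _ (by simpa using fun h => hy h.symm)
  · rw [if_neg hx, if_pos hy]
    exact (h0 q hq _ _ (by simpa using hx)).symm
  · rw [if_neg hx, if_neg hy]

/-- elements with disjoint supports commute -/
lemma Loc_comm_mu {S : Finset (Fin n)} {X : MQ n} (h : X ∈ Loc S) {q : Fin n} (hq : q ∉ S) (i j : Fin 2) :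
    mu q i j * X = X * mu q i j := mem_Loc.1 h q hq i j

end units

section gates
variable {n : ℕ}

lemma sum_pair {M : Type*} [AddCommMonoid M] (f : Fin 4 → M) :
    ∑ c : Fin 2, ∑ d : Fin 2, f (pairIdx c d) = ∑ a, f a := by
  simp only [Fin.sum_univ_succ, Fin.sum_univ_zero]
  simp only [pairIdx, add_zero]
  rw [add_assoc]
  rfl

lemma pairIdx_inj {a b c d : Fin 2} (h : pairIdx a b = pairIdx c d) : a = c ∧ b = d := by
  simp only [pairIdx, Fin.mk.injEq] at h
  constructor <;> ext <;> omega

/-- high bit -/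
def hiB (a : Fin 4) : Fin 2 := ⟨a.val / 2, by omega⟩
/-- low bit -/
def loB (a : Fin 4) : Fin 2 := ⟨a.val % 2, by omega⟩
lemma pairIdx_hilo (a : Fin 4) : pairIdx (hiB a) (loB a) = a := by
  ext; simp only [pairIdx, hiB, loB]; omega
lemma hiB_pair (c d : Fin 2) : hiB (pairIdx c d) = c := by
  ext; simp only [pairIdx, hiB]; omega
lemma loB_pair (c d : Fin 2) : loB (pairIdx c d) = d := by
  ext; simp only [pairIdx, loB]; omega

lemma gate_eq_sum {q q' : Fin n} (h : q ≠ q') (U : Matrix (Fin 4) (Fin 4) ℂ) :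
    applyGate n q q' U = ∑ a, ∑ b, U a b • (mu q (hiB a) (hiB b) * mu q' (loB a) (loB b)) := by
  ext x y
  simp only [Matrix.sum_apply, Matrix.smul_apply, mu_mul_apply, smul_eq_mul]
  simp only [mu, Matrix.of_apply, Function.update_of_ne h.symm]
  rw [Finset.sum_eq_single (pairIdx (x q) (x q'))]
  · simp only [hiB_pair, loB_pair, if_true, true_and]
    unfold applyGate
    split_ifs with hh
    · rw [Finset.sum_eq_single (pairIdx (y q) (y q'))]
      · rw [hiB_pair, loB_pair, if_pos, mul_one]
        funext r
        by_cases hr' : r = q'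
        · subst hr'; simp
        · rw [Function.update_of_ne hr']
          by_cases hr : r = q
          · subst hr; simp
          · rw [Function.update_of_ne hr]; exact (hh r hr hr').symm
      · intro b _ hb
        rw [if_neg, mul_zero]
        intro hy
        apply hb
        have e1 : y q = hiB b := by rw [hy]; simp [Function.update_of_ne h]
        have e2 : y q' = loB b := by rw [hy]; simp
        rw [e1, e2, pairIdx_hilo]
      · simp
    · symm
      apply Finset.sum_eq_zero
      intro b _
      rw [if_neg, mul_zero]
      intro hy
      apply hh
      intro r hr hr'
      rw [hy, Function.update_of_ne hr', Function.update_of_ne hr]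
  · intro a _ ha
    apply Finset.sum_eq_zero
    intro b _
    by_cases h1 : x q = hiB a
    · by_cases h2 : x q' = loB a
      · exfalso; apply ha; rw [h1, h2, pairIdx_hilo]
      · simp [h2]
    · simp [h1]
  · simp

lemma gate_single {q q' : Fin n} (h : q ≠ q') (a b : Fin 4) :
    applyGate n q q' (Matrix.single a b 1) = mu q (hiB a) (hiB b) * mu q' (loB a) (loB b) := by
  rw [gate_eq_sum h, Finset.sum_eq_single a, Finset.sum_eq_single b]
  · simp
  · intro c _ hc; simp [hc.symm]
  · simp
  · intro c _ hc; simp [hc.symm]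
  · simp

/-- the gate star homomorphism -/
def gate (n : ℕ) (q q' : Fin n) (h : q ≠ q') : Matrix (Fin 4) (Fin 4) ℂ →ₗ[ℂ] MQ n where
  toFun := applyGate n q q'
  map_add' U V := by
    rw [gate_eq_sum h, gate_eq_sum h, gate_eq_sum h]
    simp only [Matrix.add_apply, add_smul, Finset.sum_add_distrib]
  map_smul' c U := by
    rw [gate_eq_sum h, gate_eq_sum h]
    simp only [Matrix.smul_apply, smul_eq_mul, mul_smul, Finset.smul_sum, RingHom.id_apply]

variable {q q' : Fin n} (h : q ≠ q')

lemma gate_apply (U : Matrix (Fin 4) (Fin 4) ℂ) : gate n q q' h U = applyGate n q q' U := rfl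

lemma gate_unit (a b : Fin 4) :
    gate n q q' h (Matrix.single a b 1) = mu q (hiB a) (hiB b) * mu q' (loB a) (loB b) :=
  gate_single h a b

lemma gate_unit_mul (a b c d : Fin 4) :
    gate n q q' h (Matrix.single a b 1) * gate n q q' h (Matrix.single c d 1)
      = if b = c then gate n q q' h (Matrix.single a d 1) else 0 := by
  rw [gate_unit, gate_unit, mul_assoc, ← mul_assoc (mu q' _ _), mu_comm h.symm, mul_assoc,
    ← mul_assoc, mu_mul_mu, mu_mul_mu]
  by_cases hbc : b = c
  · subst hbc; simp [gate_unit]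
  · rw [if_neg hbc]
    by_cases h1 : hiB b = hiB c
    · by_cases h2 : loB b = loB c
      · exact absurd (by rw [← pairIdx_hilo b, ← pairIdx_hilo c, h1, h2]) hbc
      · simp [h2]
    · simp [h1]

lemma gate_expand (U : Matrix (Fin 4) (Fin 4) ℂ) :
    gate n q q' h U = ∑ a, ∑ b, U a b • gate n q q' h (Matrix.single a b 1) := by
  simp only [gate_unit]
  exact gate_eq_sum h U

lemma gate_mul (U V : Matrix (Fin 4) (Fin 4) ℂ) :
    gate n q q' h (U * V) = gate n q q' h U * gate n q q' h V := by
  rw [gate_expand h (U * V), gate_expand h U, gate_expand h V, Finset.sum_mul]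
  refine Finset.sum_congr rfl fun a _ => ?_
  rw [Finset.sum_mul]
  have : ∀ b, (U a b • gate n q q' h (Matrix.single a b 1)) *
      (∑ c, ∑ d, V c d • gate n q q' h (Matrix.single c d 1))
      = ∑ d, (U a b * V b d) • gate n q q' h (Matrix.single a d 1) := by
    intro b
    rw [Finset.mul_sum, Finset.sum_eq_single b]
    · rw [Finset.mul_sum]
      refine Finset.sum_congr rfl fun d _ => ?_
      rw [smul_mul_smul_comm, gate_unit_mul, if_pos rfl]
    · intro c _ hc
      rw [Finset.mul_sum]
      refine Finset.sum_eq_zero fun d _ => ?_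
      rw [smul_mul_smul_comm, gate_unit_mul, if_neg hc.symm, smul_zero]
    · simp
  simp only [this]
  rw [Finset.sum_comm]
  refine Finset.sum_congr rfl fun d _ => ?_
  rw [Matrix.mul_apply, Finset.sum_smul]

lemma applyGate_apply (q q' : Fin n) (U : Matrix (Fin 4) (Fin 4) ℂ) (x y : Q n) :
    applyGate n q q' U x y = if (∀ r, r ≠ q → r ≠ q' → x r = y r) then
      U (pairIdx (x q) (x q')) (pairIdx (y q) (y q')) else 0 := rfl

lemma gate_one : gate n q q' h 1 = 1 := by
  ext x y
  rw [gate_apply, applyGate_apply]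
  simp only [Matrix.one_apply]
  by_cases hxy : x = y
  · subst hxy; simp
  · rw [if_neg hxy]
    split_ifs with h1 h2
    · exfalso
      apply hxy
      obtain ⟨e1, e2⟩ := pairIdx_inj h2
      funext r
      by_cases hr : r = q
      · subst hr; exact e1
      · by_cases hr' : r = q'
        · subst hr'; exact e2
        · exact h1 r hr hr'
    · rfl
    · rfl

lemma gate_star (U : Matrix (Fin 4) (Fin 4) ℂ) : gate n q q' h Uᴴ = (gate n q q' h U)ᴴ := by
  ext x y
  rw [Matrix.conjTranspose_apply, gate_apply, gate_apply]
  unfold applyGate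
  have : (∀ r, r ≠ q → r ≠ q' → y r = x r) ↔ (∀ r, r ≠ q → r ≠ q' → x r = y r) := by
    simp only [eq_comm]
  simp only [this]
  split_ifs <;> simp

lemma gate_mem : ∀ U : Matrix (Fin 4) (Fin 4) ℂ, gate n q q' h U ∈ Loc ({q, q'} : Finset (Fin n)) := by
  intro U
  rw [gate_expand]
  refine Subalgebra.sum_mem _ fun a _ => Subalgebra.sum_mem _ fun b _ => Subalgebra.smul_mem _ ?_ _
  rw [gate_unit]
  exact Subalgebra.mul_mem _ (mu_mem_Loc (by simp) _ _) (mu_mem_Loc (by simp) _ _)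

lemma gate_surj (X : MQ n) (hX : X ∈ Loc ({q, q'} : Finset (Fin n))) : ∃ U, X = gate n q q' h U := by
  let bits : Fin 4 → Q n := fun a => Function.update (Function.update 0 q (hiB a)) q' (loB a)
  refine ⟨Matrix.of fun a b => X (bits a) (bits b), ?_⟩
  ext x y
  rw [gate_apply, Loc_apply hX x y 0]
  unfold applyGate
  have e : (∀ r, r ∉ ({q, q'} : Finset (Fin n)) → x r = y r) ↔ (∀ r, r ≠ q → r ≠ q' → x r = y r) := by
    simp
  simp only [e]
  have e2 : ∀ x : Q n, Finset.piecewise {q, q'} x 0 = bits (pairIdx (x q) (x q')) := by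
    intro x
    funext r
    simp only [bits, hiB_pair, loB_pair]
    by_cases hr' : r = q'
    · subst hr'; simp
    · rw [Function.update_of_ne hr']
      by_cases hr : r = q
      · subst hr; simp
      · rw [Function.update_of_ne hr, Finset.piecewise_eq_of_notMem _ _ _ (by simp [hr, hr'])]
  rw [e2, e2]; rfl

lemma gate_inj {U V : Matrix (Fin 4) (Fin 4) ℂ} (e : gate n q q' h U = gate n q q' h V) : U = V := by
  let bits : Fin 4 → Q n := fun a => Function.update (Function.update 0 q (hiB a)) q' (loB a)
  ext a b
  have := congrFun (congrFun e (bits a)) (bits b)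
  rw [gate_apply, gate_apply] at this
  unfold applyGate at this
  have hb : ∀ a, pairIdx (bits a q) (bits a q') = a := by
    intro a
    simp only [bits, Function.update_self, Function.update_of_ne h, pairIdx_hilo]
  rw [hb, hb, if_pos, if_pos] at this
  · exact this
  · intro r hr hr'; simp [bits, Function.update_of_ne hr, Function.update_of_ne hr']
  · intro r hr hr'; simp [bits, Function.update_of_ne hr, Function.update_of_ne hr']

lemma gate_unitary {U : Matrix (Fin 4) (Fin 4) ℂ} (hU : U ∈ Matrix.unitaryGroup (Fin 4) ℂ) :
    gate n q q' h U ∈ Matrix.unitaryGroup (Q n) ℂ := by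
  rw [Matrix.mem_unitaryGroup_iff, Matrix.star_eq_conjTranspose] at hU ⊢
  rw [← gate_star, ← gate_mul, hU, gate_one]

lemma unitary_of_gate {U : Matrix (Fin 4) (Fin 4) ℂ}
    (hU : gate n q q' h U ∈ Matrix.unitaryGroup (Q n) ℂ) : U ∈ Matrix.unitaryGroup (Fin 4) ℂ := by
  rw [Matrix.mem_unitaryGroup_iff, Matrix.star_eq_conjTranspose] at hU ⊢
  rw [← gate_star, ← gate_mul, ← gate_one h] at hU
  exact gate_inj h hU

lemma gate_continuous : Continuous (gate n q q' h) := (gate n q q' h).continuous_of_finiteDimensional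

end gates
end TPE

namespace TPE

section hs
variable {ξ : Type*} [Fintype ξ] [DecidableEq ξ]
/-- Hilbert–Schmidt form -/
def hs (X Y : Matrix ξ ξ ℂ) : ℂ := (Xᴴ * Y).trace

lemma hs_sum_right {κ : Type*} (s : Finset κ) (X : Matrix ξ ξ ℂ) (Y : κ → Matrix ξ ξ ℂ) :
    hs X (∑ i ∈ s, Y i) = ∑ i ∈ s, hs X (Y i) := by
  simp [hs, Finset.mul_sum, Matrix.trace_sum]
lemma hs_smul_right (c : ℂ) (X Y : Matrix ξ ξ ℂ) : hs X (c • Y) = c * hs X Y := by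
  simp [hs]
lemma hs_sub_right (X Y Z : Matrix ξ ξ ℂ) : hs X (Y - Z) = hs X Y - hs X Z := by
  simp [hs, mul_sub, Matrix.trace_sub]
lemma hs_sub_left (X Y Z : Matrix ξ ξ ℂ) : hs (X - Y) Z = hs X Z - hs Y Z := by
  simp [hs, sub_mul, Matrix.trace_sub]
lemma hs_conj (X Y : Matrix ξ ξ ℂ) : (starRingEnd ℂ) (hs X Y) = hs Y X := by
  unfold hs
  rw [starRingEnd_apply, ← Matrix.trace_conjTranspose, Matrix.conjTranspose_mul,
    Matrix.conjTranspose_conjTranspose]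
lemma hs_self (X : Matrix ξ ξ ℂ) : hs X X = ((∑ x, ∑ y, ‖X x y‖ ^ 2 : ℝ) : ℂ) := by
  unfold hs
  simp only [Matrix.trace, Matrix.diag, Matrix.mul_apply, Matrix.conjTranspose_apply]
  rw [Finset.sum_comm]
  push_cast
  refine Finset.sum_congr rfl fun x _ => Finset.sum_congr rfl fun y _ => ?_
  rw [← Complex.conj_mul']; rfl
/-- squared Hilbert–Schmidt norm -/
def nrm (X : Matrix ξ ξ ℂ) : ℝ := ∑ x, ∑ y, ‖X x y‖ ^ 2
lemma nrm_eq (X : Matrix ξ ξ ℂ) : hs X X = (nrm X : ℂ) := hs_self X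
lemma nrm_nonneg (X : Matrix ξ ξ ℂ) : 0 ≤ nrm X := by unfold nrm; positivity
lemma nrm_zero {X : Matrix ξ ξ ℂ} (h : nrm X = 0) : X = 0 := by
  unfold nrm at h
  rw [Finset.sum_eq_zero_iff_of_nonneg (fun _ _ => by positivity)] at h
  ext x y
  have h1 := h x (Finset.mem_univ _)
  rw [Finset.sum_eq_zero_iff_of_nonneg (fun _ _ => by positivity)] at h1
  simpa using h1 y (Finset.mem_univ _)
lemma hs_unitary (X Y U : Matrix ξ ξ ℂ) (hU : U ∈ Matrix.unitaryGroup ξ ℂ) :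
    hs (Uᴴ * X * U) (Uᴴ * Y * U) = hs X Y := by
  unfold hs
  have h1 : U * Uᴴ = 1 := Matrix.mem_unitaryGroup_iff.1 hU
  simp only [Matrix.conjTranspose_mul, Matrix.conjTranspose_conjTranspose]
  have : Uᴴ * (Xᴴ * U) * (Uᴴ * Y * U) = Uᴴ * (Xᴴ * Y * U) := by
    rw [mul_assoc Uᴴ Y U, mul_assoc Uᴴ (Xᴴ * U), mul_assoc Xᴴ U, ← mul_assoc U Uᴴ, h1, one_mul,
      mul_assoc Xᴴ]
  rw [this, Matrix.trace_mul_comm, mul_assoc, h1, mul_one]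
lemma nrm_unitary (X U : Matrix ξ ξ ℂ) (hU : U ∈ Matrix.unitaryGroup ξ ℂ) :
    nrm (Uᴴ * X * U) = nrm X := by
  have := hs_unitary X X U hU
  rw [nrm_eq, nrm_eq] at this
  exact_mod_cast this
end hs

section D
variable {n : ℕ}

/-- depolarising map at one qubit -/
def D (q : Fin n) : MQ n →ₗ[ℂ] MQ n where
  toFun X := (1/2 : ℂ) • ∑ i, ∑ j, mu q i j * X * mu q j i
  map_add' X Y := by
    simp only [mul_add, add_mul, Finset.sum_add_distrib, smul_add]
  map_smul' c X := by
    simp only [mul_smul_comm, smul_mul_assoc, ← Finset.smul_sum, RingHom.id_apply]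
    rw [smul_comm]

lemma D_apply (q : Fin n) (X : MQ n) :
    D q X = (1/2 : ℂ) • ∑ i, ∑ j, mu q i j * X * mu q j i := rfl

lemma D_sa (q : Fin n) (X Y : MQ n) : hs (D q X) Y = hs X (D q Y) := by
  rw [← hs_conj, D_apply, D_apply, hs_smul_right, hs_smul_right, map_mul, hs_sum_right, hs_sum_right,
    map_sum]
  congr 1
  · rw [map_div₀, map_one, map_ofNat]
  rw [Finset.sum_congr rfl (g := fun i => ∑ j, hs X (mu q j i * Y * mu q i j))]
  · rw [Finset.sum_comm]
    refine Finset.sum_congr rfl fun i _ => ?_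
    rw [hs_sum_right]
  · intro i _
    rw [hs_sum_right, map_sum]
    refine Finset.sum_congr rfl fun j _ => ?_
    rw [hs_conj]
    unfold hs
    rw [Matrix.conjTranspose_mul, Matrix.conjTranspose_mul, mu_star, mu_star,
      mul_assoc, Matrix.trace_mul_comm]
    simp only [mul_assoc]

lemma D_commutes (q : Fin n) (X : MQ n) (k l : Fin 2) : mu q k l * D q X = D q X * mu q k l := by
  rw [D_apply, mul_smul_comm, smul_mul_assoc]
  congr 1
  rw [Finset.mul_sum, Finset.sum_mul]
  have h1 : ∀ i, mu q k l * ∑ j, mu q i j * X * mu q j i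
      = if l = i then ∑ j, mu q k j * X * mu q j i else 0 := by
    intro i
    rw [Finset.mul_sum]
    split_ifs with h
    · refine Finset.sum_congr rfl fun j _ => ?_
      rw [← mul_assoc, ← mul_assoc, mu_mul_mu, if_pos h]
    · refine Finset.sum_eq_zero fun j _ => ?_
      rw [← mul_assoc, ← mul_assoc, mu_mul_mu, if_neg h]; simp
  have h2 : ∀ i, (∑ j, mu q i j * X * mu q j i) * mu q k l
      = if i = k then ∑ j, mu q i j * X * mu q j l else 0 := by
    intro i
    rw [Finset.sum_mul]
    split_ifs with h
    · refine Finset.sum_congr rfl fun j _ => ?_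
      rw [mul_assoc, mu_mul_mu, if_pos h]
    · refine Finset.sum_eq_zero fun j _ => ?_
      rw [mul_assoc, mu_mul_mu, if_neg h]; simp
  simp only [h1, h2]
  simp

lemma D_fix (q : Fin n) (X : MQ n) (h : ∀ i j, mu q i j * X = X * mu q i j) : D q X = X := by
  rw [D_apply]
  simp only [h, mul_assoc, mu_mul_mu, if_true]
  simp only [← Finset.mul_sum, Finset.sum_const, Finset.card_univ, Fintype.card_fin]
  rw [← Finset.smul_sum, mu_sum, mul_smul_comm, mul_one, ← Nat.cast_smul_eq_nsmul ℂ, smul_smul]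
  norm_num

lemma D_idem (q : Fin n) (X : MQ n) : D q (D q X) = D q X := D_fix q _ (D_commutes q X)

lemma D_fix_Loc {S : Finset (Fin n)} {q : Fin n} (hq : q ∉ S) {X : MQ n} (hX : X ∈ Loc S) :
    D q X = X := D_fix q X (mem_Loc.1 hX q hq)

lemma D_Loc {S : Finset (Fin n)} (q : Fin n) {X : MQ n} (hX : X ∈ Loc S) :
    D q X ∈ Loc (S.erase q) := by
  rw [mem_Loc]
  intro r hr k l
  by_cases hrq : r = q
  · subst hrq; exact D_commutes r X k l
  · have hrS : r ∉ S := fun h => hr (Finset.mem_erase.2 ⟨hrq, h⟩)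
    have hx := mem_Loc.1 hX r hrS k l
    rw [D_apply, mul_smul_comm, smul_mul_assoc, Finset.mul_sum, Finset.sum_mul]
    congr 1
    refine Finset.sum_congr rfl fun i _ => ?_
    rw [Finset.mul_sum, Finset.sum_mul]
    refine Finset.sum_congr rfl fun j _ => ?_
    rw [← mul_assoc, ← mul_assoc, mu_comm hrq, mul_assoc (mu q i j), hx, mul_assoc, mul_assoc,
      mu_comm hrq]
    simp only [mul_assoc]

lemma D_conj {S : Finset (Fin n)} {q : Fin n} (hq : q ∉ S) {A B : MQ n} (hA : A ∈ Loc S)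
    (hB : B ∈ Loc S) (X : MQ n) : D q (A * X * B) = A * D q X * B := by
  rw [D_apply, D_apply, mul_smul_comm, smul_mul_assoc, Finset.mul_sum, Finset.sum_mul]
  congr 1
  refine Finset.sum_congr rfl fun i _ => ?_
  rw [Finset.mul_sum, Finset.sum_mul]
  refine Finset.sum_congr rfl fun j _ => ?_
  have e : mu q i j * (A * X * B) * mu q j i = (mu q i j * A) * X * (B * mu q j i) := by
    simp only [mul_assoc]
  rw [e, mem_Loc.1 hA q hq, ← mem_Loc.1 hB q hq]
  simp only [mul_assoc]

lemma D_comm (q r : Fin n) (X : MQ n) : D q (D r X) = D r (D q X) := by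
  by_cases h : q = r
  · rw [h]
  rw [D_apply r X, map_smul, map_sum, D_apply r (D q X)]
  congr 1
  refine Finset.sum_congr rfl fun i _ => ?_
  rw [map_sum]
  refine Finset.sum_congr rfl fun j _ => ?_
  exact D_conj (S := {r}) (by simpa using h) (mu_mem_Loc (by simp) _ _) (mu_mem_Loc (by simp) _ _) X

lemma nrm_D (q : Fin n) (X : MQ n) : ((nrm (D q X) : ℝ) : ℂ) = hs X (D q X) := by
  rw [← nrm_eq, D_sa, D_idem]

lemma nrm_sub_proj {ξ : Type*} [Fintype ξ] [DecidableEq ξ] (P : Matrix ξ ξ ℂ → Matrix ξ ξ ℂ)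
    (X : Matrix ξ ξ ℂ) (h : hs X (P X) = hs (P X) (P X)) : nrm (X - P X) = nrm X - nrm (P X) := by
  have h2 : hs (P X) X = hs (P X) (P X) := by
    rw [← hs_conj X (P X), h, hs_conj]
  have : hs (X - P X) (X - P X) = hs X X - hs (P X) (P X) := by
    rw [hs_sub_left, hs_sub_right, hs_sub_right, h, h2]; ring
  rw [nrm_eq, nrm_eq, nrm_eq] at this
  exact_mod_cast this

lemma nrm_D_le (q : Fin n) (X : MQ n) : nrm (D q X) ≤ nrm X := by
  have := nrm_sub_proj (D q) X (by rw [← nrm_D, nrm_eq])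
  have h := nrm_nonneg (X - D q X)
  linarith

end D
end TPE

namespace TPE

lemma VU_rel {ξ : Type*} [Fintype ξ] [DecidableEq ξ] {t : ℕ} (v : HS t ξ) (hv : v ∈ VU t ξ) :
    Rel (fun x y => v (x, y)) := by
  apply rel_of_dmom
  intro a b
  refine dmom_of_unitary_fixed (⊤ : Submodule ℂ (Matrix ξ ξ ℂ)) (fun _ _ => trivial) v ?_ _ trivial
  intro X _ hX
  exact hv ⟨_, exp_skew_unitary X hX⟩

/-- two-qubit version of one-qubit matrix units -/
def eps (i j : Fin 2) : Matrix (Fin 4) (Fin 4) ℂ :=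
  Matrix.of fun a b => if hiB a = i ∧ hiB b = j ∧ loB a = loB b then 1 else 0

lemma gate_eps {n : ℕ} {q q' : Fin n} (h : q ≠ q') (i j : Fin 2) : gate n q q' h (eps i j) = mu q i j := by
  rw [gate_expand]
  simp only [gate_unit]
  rw [← sum_pair]
  have : ∀ c d : Fin 2, (∑ b, eps i j (pairIdx c d) b • (mu q (hiB (pairIdx c d)) (hiB b) * mu q' (loB (pairIdx c d)) (loB b)))
      = if c = i then mu q i j * mu q' d d else 0 := by
    intro c d
    rw [← sum_pair]
    simp only [hiB_pair, loB_pair, eps, Matrix.of_apply]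
    by_cases hc : c = i
    · subst hc
      rw [Finset.sum_eq_single j, Finset.sum_eq_single d]
      · simp
      · intro b _ hb; simp [hb.symm]
      · simp
      · intro b _ hb; simp [hb]
      · simp
    · simp [hc]
  simp only [this]
  rw [Finset.sum_comm]
  simp only [Finset.sum_ite_eq', Finset.mem_univ, if_true]
  rw [← Finset.mul_sum, mu_sum, mul_one]

/-- pointwise two-fold twirl -/
def Tw (w : Matrix (Fin 4) (Fin 4) ℂ) (a b c d : Fin 4) : ℂ :=
  ∑ i, ∑ j, (w * eps i j * wᴴ) a b * (w * eps j i * wᴴ) c d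

/-- vector of the two-fold twirl -/
def tau : HS 2 (Fin 4) := WithLp.toLp 2 fun x =>
  ∑ i, ∑ j, eps i j (x.1 0) (x.2 0) * eps j i (x.1 1) (x.2 1)

lemma Tw_eq (w : Matrix (Fin 4) (Fin 4) ℂ) (a b c d : Fin 4) :
    Tw w a b c d = op (momentMat 2 w) tau (![a, c], ![b, d]) := by
  rw [op_apply, Fintype.sum_prod_type]
  simp only [momentMat, tau, Fin.prod_univ_two, Matrix.cons_val_zero, Matrix.cons_val_one]
  have e : ∀ f : (Fin 2 → Fin 4) → ℂ, ∑ x, f x = ∑ a', ∑ c', f ![a', c'] := by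
    intro f
    rw [← (finTwoArrowEquiv (Fin 4)).symm.sum_comp, Fintype.sum_prod_type]
    rfl
  rw [e]
  simp only [e, Matrix.cons_val_zero, Matrix.cons_val_one]
  unfold Tw
  simp only [Matrix.mul_apply, Matrix.conjTranspose_apply, Finset.mul_sum, Finset.sum_mul]
  -- reorganise sums
  have l : ∀ (g : Fin 2 → Fin 2 → Fin 4 → Fin 4 → Fin 4 → Fin 4 → ℂ),
      (∑ i, ∑ j, ∑ r', ∑ p', ∑ r, ∑ p, g i j r' p' r p)
        = ∑ p, ∑ p', ∑ r, ∑ r', ∑ i, ∑ j, g i j r' p' r p := by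
    intro g
    simp only [← Fintype.sum_prod_type']
    refine Fintype.sum_equiv
      ⟨fun z => (z.2.2.2.2.2, z.2.2.2.1, z.2.2.2.2.1, z.2.2.1, z.1, z.2.1),
       fun z => (z.2.2.2.2.1, z.2.2.2.2.2, z.2.2.2.1, z.2.1, z.2.2.1, z.1), fun _ => rfl, fun _ => rfl⟩ _ _ ?_
    intro z; rfl
  rw [l (fun i j r' p' r p => w a p * eps i j p r * star (w b r) * (w c p' * eps j i p' r' * star (w d r')))]
  refine Finset.sum_congr rfl fun p _ => Finset.sum_congr rfl fun p' _ =>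
    Finset.sum_congr rfl fun r _ => Finset.sum_congr rfl fun r' _ =>
    Finset.sum_congr rfl fun i _ => Finset.sum_congr rfl fun j _ => ?_
  simp only [starRingEnd_apply]
  ring

/-- averaged two-fold twirl -/
def TT (a b c d : Fin 4) : ℂ := ∫ w : Matrix.unitaryGroup (Fin 4) ℂ, Tw w a b c d ∂(nu (Fin 4))

lemma Tw_cont (a b c d : Fin 4) :
    Continuous fun w : Matrix.unitaryGroup (Fin 4) ℂ => Tw w a b c d := by
  have h : Continuous fun w : Matrix (Fin 4) (Fin 4) ℂ => Tw w a b c d := by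
    unfold Tw
    refine continuous_finsetSum _ fun i _ => continuous_finsetSum _ fun j _ => Continuous.mul ?_ ?_
    · have : Continuous fun w : Matrix (Fin 4) (Fin 4) ℂ => w * eps i j * wᴴ := by fun_prop
      exact (continuous_apply_apply a b).comp this
    · have : Continuous fun w : Matrix (Fin 4) (Fin 4) ℂ => w * eps j i * wᴴ := by fun_prop
      exact (continuous_apply_apply c d).comp this
  exact h.comp continuous_subtype_val

lemma TT_form : ∃ A B : ℂ, ∀ a b c d, TT a b c d =
    (if a = b ∧ c = d then A else 0) + (if a = d ∧ c = b then B else 0) := by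
  have hmem : op (haarMomentMat 2 (nu (Fin 4))) tau ∈ VU 2 (Fin 4) := by
    rw [haar_eq_proj]; exact Submodule.starProjection_apply_mem _ _
  have hT : ∀ a b c d, TT a b c d = op (haarMomentMat 2 (nu (Fin 4))) tau (![a, c], ![b, d]) := by
    intro a b c d
    have h1 := op_integral (nu (Fin 4)) (fun U : Matrix.unitaryGroup (Fin 4) ℂ => momentMat 2 (U : Matrix (Fin 4) (Fin 4) ℂ))
      (momentMat_continuous.comp continuous_subtype_val) tau
    have h2 : op (haarMomentMat 2 (nu (Fin 4))) tau = _ := h1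
    rw [h2]
    unfold TT
    simp only [Tw_eq]
    have hi : Integrable (fun w : Matrix.unitaryGroup (Fin 4) ℂ => op (momentMat 2 (w : Matrix (Fin 4) (Fin 4) ℂ)) tau) (nu (Fin 4)) :=
      integrable_cont _ _ ((op_continuous tau).comp (momentMat_continuous.comp continuous_subtype_val))
    exact (EuclideanSpace.proj (𝕜 := ℂ) (![a, c], ![b, d])).integral_comp_comm hi
  obtain ⟨c, hc⟩ := schur_weyl (by simp) (VU_rel _ hmem)
  refine ⟨c 1, c (Equiv.swap 0 1), ?_⟩
  intro a b e d
  rw [hT, hc]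
  have hu : (Finset.univ : Finset (Equiv.Perm (Fin 2))) = {1, Equiv.swap 0 1} := by decide
  rw [hu, Finset.sum_pair (by decide)]
  congr 1
  · unfold psi
    rw [mul_ite, mul_one, mul_zero]
    congr 1
    rw [eq_iff_iff, funext_iff, Fin.forall_fin_two]
    simp
  · unfold psi
    rw [mul_ite, mul_one, mul_zero]
    congr 1
    rw [eq_iff_iff, funext_iff, Fin.forall_fin_two]
    simp

lemma eps_mul (i j k l : Fin 2) : eps i j * eps k l = if j = k then eps i l else 0 := by
  have h : (⟨0, by omega⟩ : Fin 2) ≠ ⟨1, by omega⟩ := by decide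
  apply gate_inj (n := 2) h
  rw [gate_mul, gate_eps, gate_eps, mu_mul_mu]
  split_ifs
  · rw [gate_eps]
  · simp

lemma eps_trace (i j : Fin 2) : (eps i j).trace = if i = j then 2 else 0 := by
  rw [Matrix.trace]
  simp only [Matrix.diag]
  rw [← sum_pair]
  simp only [eps, Matrix.of_apply, hiB_pair, loB_pair, and_true]
  rw [Finset.sum_comm]
  by_cases h : i = j
  · subst h
    have : ∀ x : Fin 2, (x = i ∧ x = i) ↔ x = i := fun x => by tauto
    simp
  · have : ∀ x : Fin 2, ¬ (x = i ∧ x = j) := by rintro x ⟨rfl, rfl⟩; exact h rfl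
    simp [this, h]

lemma conj_trace (w : Matrix.unitaryGroup (Fin 4) ℂ) (X : Matrix (Fin 4) (Fin 4) ℂ) :
    ((w : Matrix (Fin 4) (Fin 4) ℂ) * X * (w : Matrix (Fin 4) (Fin 4) ℂ)ᴴ).trace = X.trace := by
  rw [Matrix.trace_mul_comm, ← mul_assoc]
  have : (w : Matrix (Fin 4) (Fin 4) ℂ)ᴴ * w = 1 := Matrix.mem_unitaryGroup_iff'.1 w.2
  rw [this, one_mul]

lemma TT_trace1 : ∑ a, ∑ c, TT a a c c = 8 := by
  have h : ∀ w : Matrix.unitaryGroup (Fin 4) ℂ, ∑ a, ∑ c, Tw w a a c c = 8 := by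
    intro w
    have : ∑ a, ∑ c, Tw w a a c c = ∑ i, ∑ j, (eps i j).trace * (eps j i).trace := by
      unfold Tw
      simp only [← conj_trace w (eps _ _)]
      simp only [Matrix.trace, Matrix.diag, Finset.sum_mul_sum]
      simp only [← Fintype.sum_prod_type']
      refine Fintype.sum_equiv ⟨fun z => (z.2.2.1, z.2.2.2, z.1, z.2.1),
        fun z => (z.2.2.1, z.2.2.2, z.1, z.2.1), fun _ => rfl, fun _ => rfl⟩ _ _ ?_
      intro z; rfl
    rw [this]
    simp only [eps_trace, Fin.sum_univ_two]
    norm_num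
  unfold TT
  have hIntg : ∀ a c, Integrable (fun w : Matrix.unitaryGroup (Fin 4) ℂ => Tw w a a c c) (nu (Fin 4)) :=
    fun a c => integrable_cont _ _ (Tw_cont _ _ _ _)
  simp only [← integral_finsetSum _ (fun c _ => hIntg _ c)]
  rw [← integral_finsetSum _ (fun a _ => integrable_finsetSum _ fun c _ => hIntg a c)]
  simp [h]

lemma TT_trace2 : ∑ a, ∑ b, TT a b b a = 8 := by
  have h : ∀ w : Matrix.unitaryGroup (Fin 4) ℂ, ∑ a, ∑ b, Tw w a b b a = 8 := by
    intro w
    have hw : (w : Matrix (Fin 4) (Fin 4) ℂ)ᴴ * w = 1 := Matrix.mem_unitaryGroup_iff'.1 w.2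
    have : ∑ a, ∑ b, Tw w a b b a = ∑ i, ∑ j, (eps i j * eps j i).trace := by
      unfold Tw
      have e : ∀ i j, (eps i j * eps j i).trace =
          (((w : Matrix (Fin 4) (Fin 4) ℂ) * eps i j * (w : Matrix (Fin 4) (Fin 4) ℂ)ᴴ) *
          ((w : Matrix (Fin 4) (Fin 4) ℂ) * eps j i * (w : Matrix (Fin 4) (Fin 4) ℂ)ᴴ)).trace := by
        intro i j
        rw [← conj_trace w]
        congr 1
        simp only [mul_assoc]
        rw [← mul_assoc (w : Matrix (Fin 4) (Fin 4) ℂ)ᴴ, hw, one_mul]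
      simp only [e]
      simp only [Matrix.trace, Matrix.diag, Matrix.mul_apply (M := _ * eps _ _ * _)]
      simp only [← Fintype.sum_prod_type']
      refine Fintype.sum_equiv ⟨fun z => (z.2.2.1, z.2.2.2, z.1, z.2.1),
        fun z => (z.2.2.1, z.2.2.2, z.1, z.2.1), fun _ => rfl, fun _ => rfl⟩ _ _ ?_
      intro z; rfl
    rw [this]
    simp only [eps_mul, eps_trace, if_true, Fin.sum_univ_two]
    norm_num
  unfold TT
  have hIntg : ∀ a c, Integrable (fun w : Matrix.unitaryGroup (Fin 4) ℂ => Tw w a c c a) (nu (Fin 4)) :=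
    fun a c => integrable_cont _ _ (Tw_cont _ _ _ _)
  simp only [← integral_finsetSum _ (fun c _ => hIntg _ c)]
  rw [← integral_finsetSum _ (fun a _ => integrable_finsetSum _ fun c _ => hIntg a c)]
  simp [h]

lemma TT_val (a b c d : Fin 4) : TT a b c d =
    (if a = b ∧ c = d then 2/5 else 0) + (if a = d ∧ c = b then 2/5 else 0) := by
  obtain ⟨A, B, hT⟩ := TT_form
  have h1 := TT_trace1
  have h2 := TT_trace2
  simp only [hT] at h1 h2
  simp [Fin.sum_univ_succ] at h1 h2
  have hA : A = 2/5 := by linear_combination (4 * h1 - h2)/60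
  have hB : B = 2/5 := by linear_combination (4 * h2 - h1)/60
  rw [hT, hA, hB]

end TPE

namespace TPE

section
variable {n : ℕ} {q q' : Fin n} (h : q ≠ q')

lemma D_pair (Y : MQ n) : D q (D q' Y) = (1/4 : ℂ) • ∑ a, ∑ b,
    gate n q q' h (Matrix.single a b 1) * Y * gate n q q' h (Matrix.single b a 1) := by
  rw [D_apply q' Y, map_smul, D_apply, smul_smul]
  congr 1
  · norm_num
  rw [← sum_pair]
  refine Finset.sum_congr rfl fun i _ => ?_
  have e : ∀ a, (∑ b, gate n q q' h (Matrix.single a b 1) * Y * gate n q q' h (Matrix.single b a 1))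
      = ∑ j, ∑ l, mu q (hiB a) j * (mu q' (loB a) l * Y * mu q' l (loB a)) * mu q j (hiB a) := by
    intro a
    rw [← sum_pair]
    refine Finset.sum_congr rfl fun j _ => Finset.sum_congr rfl fun l _ => ?_
    rw [gate_unit, gate_unit, hiB_pair, loB_pair, mu_comm h j]
    simp only [mul_assoc]
  simp only [e, hiB_pair, loB_pair, Finset.mul_sum, Finset.sum_mul]
  rw [Finset.sum_comm]

lemma D_pair_inv (w : Matrix (Fin 4) (Fin 4) ℂ) (hw : w ∈ Matrix.unitaryGroup (Fin 4) ℂ) (Y : MQ n) :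
    D q (D q' ((gate n q q' h w)ᴴ * Y * gate n q q' h w)) = D q (D q' Y) := by
  rw [D_pair h, D_pair h Y]
  refine congrArg (fun z => (1/4 : ℂ) • z) ?_
  have hw1 : w * wᴴ = 1 := Matrix.mem_unitaryGroup_iff.1 hw
  have e1 : ∀ a b, gate n q q' h (Matrix.single a b 1) * (gate n q q' h w)ᴴ
      = ∑ c, wᴴ b c • gate n q q' h (Matrix.single a c 1) := by
    intro a b
    rw [← gate_star, ← gate_mul]
    simp only [← map_smul, ← map_sum]
    congr 1
    ext x y
    simp only [Matrix.sum_apply, Matrix.smul_apply, smul_eq_mul]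
    by_cases hx : x = a
    · subst hx
      rw [Matrix.single_mul_apply_same, Finset.sum_eq_single y]
      · simp
      · intro c _ hc; simp [hc]
      · simp
    · rw [Matrix.single_mul_apply_of_ne _ _ _ _ _ hx]
      symm
      apply Finset.sum_eq_zero
      intro c _
      simp [Ne.symm hx]
  have e2 : ∀ a b, gate n q q' h w * gate n q q' h (Matrix.single b a 1)
      = ∑ d, w d b • gate n q q' h (Matrix.single d a 1) := by
    intro a b
    rw [← gate_mul]
    simp only [← map_smul, ← map_sum]
    congr 1
    ext x y
    simp only [Matrix.sum_apply, Matrix.smul_apply, smul_eq_mul]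
    by_cases hy : y = a
    · subst hy
      rw [Matrix.mul_single_apply_same, Finset.sum_eq_single x]
      · simp
      · intro c _ hc; simp [hc]
      · simp
    · rw [Matrix.mul_single_apply_of_ne _ _ _ _ _ hy]
      symm
      apply Finset.sum_eq_zero
      intro c _
      simp [Ne.symm hy]
  refine Finset.sum_congr rfl fun a _ => ?_
  have e3 : ∀ b, gate n q q' h (Matrix.single a b 1) * ((gate n q q' h w)ᴴ * Y * gate n q q' h w)
      * gate n q q' h (Matrix.single b a 1)
      = ∑ c, ∑ d, (w d b * wᴴ b c) •
        (gate n q q' h (Matrix.single a c 1) * Y * gate n q q' h (Matrix.single d a 1)) := by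
    intro b
    have : gate n q q' h (Matrix.single a b 1) * ((gate n q q' h w)ᴴ * Y * gate n q q' h w)
      * gate n q q' h (Matrix.single b a 1)
      = (gate n q q' h (Matrix.single a b 1) * (gate n q q' h w)ᴴ) * Y *
        (gate n q q' h w * gate n q q' h (Matrix.single b a 1)) := by simp only [mul_assoc]
    rw [this, e1, e2, Finset.sum_mul, Finset.sum_mul]
    refine Finset.sum_congr rfl fun c _ => ?_
    rw [Finset.mul_sum]
    refine Finset.sum_congr rfl fun d _ => ?_
    rw [smul_mul_assoc, smul_mul_smul_comm, mul_comm]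
  simp only [e3]
  rw [Finset.sum_comm]
  refine Finset.sum_congr rfl fun c _ => ?_
  rw [Finset.sum_comm]
  simp only [← Finset.sum_smul, ← Matrix.mul_apply, hw1]
  rw [Finset.sum_eq_single c]
  · simp
  · intro d _ hd; simp [hd]
  · simp

lemma nrm_D_conj (w : Matrix (Fin 4) (Fin 4) ℂ) (Y : MQ n) :
    ((nrm (D q ((gate n q q' h w)ᴴ * Y * gate n q q' h w)) : ℝ) : ℂ) = (1/2) * ∑ a, ∑ b, ∑ c, ∑ d,
      Tw w a b c d * (Yᴴ * gate n q q' h (Matrix.single a b 1) * Y * gate n q q' h (Matrix.single c d 1)).trace := by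
  rw [nrm_D, D_apply, hs_smul_right]
  congr 1
  rw [hs_sum_right]
  have e : ∀ i j, hs ((gate n q q' h w)ᴴ * Y * gate n q q' h w)
      (mu q i j * ((gate n q q' h w)ᴴ * Y * gate n q q' h w) * mu q j i)
      = ∑ a, ∑ b, ∑ c, ∑ d, (w * eps i j * wᴴ) a b * (w * eps j i * wᴴ) c d *
        (Yᴴ * gate n q q' h (Matrix.single a b 1) * Y * gate n q q' h (Matrix.single c d 1)).trace := by
    intro i j
    have e0 : hs ((gate n q q' h w)ᴴ * Y * gate n q q' h w)
      (mu q i j * ((gate n q q' h w)ᴴ * Y * gate n q q' h w) * mu q j i)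
      = (Yᴴ * gate n q q' h (w * eps i j * wᴴ) * (Y * gate n q q' h (w * eps j i * wᴴ))).trace := by
      rw [gate_mul, gate_mul, gate_mul, gate_mul, gate_eps, gate_eps, gate_star]
      unfold hs
      simp only [Matrix.conjTranspose_mul, Matrix.conjTranspose_conjTranspose, mul_assoc]
      rw [Matrix.trace_mul_comm]
      simp only [mul_assoc]
    rw [e0, gate_expand h (w * eps i j * wᴴ), gate_expand h (w * eps j i * wᴴ)]
    simp only [Finset.mul_sum, Finset.sum_mul, mul_smul_comm, smul_mul_assoc, Matrix.trace_sum,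
      Matrix.trace_smul, smul_eq_mul]
    simp only [← Fintype.sum_prod_type']
    refine Fintype.sum_equiv ⟨fun z => (z.2.2.1, z.2.2.2, z.1, z.2.1),
        fun z => (z.2.2.1, z.2.2.2, z.1, z.2.1), fun _ => rfl, fun _ => rfl⟩ _ _ ?_
    intro z
    simp only [Equiv.coe_fn_mk, mul_assoc]
    ring_nf
  simp only [hs_sum_right, e]
  unfold Tw
  simp only [Finset.sum_mul]
  simp only [← Fintype.sum_prod_type']
  refine Fintype.sum_equiv ⟨fun z => (z.2.2.1, z.2.2.2.1, z.2.2.2.2.1, z.2.2.2.2.2, z.1, z.2.1),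
        fun z => (z.2.2.2.2.1, z.2.2.2.2.2, z.1, z.2.1, z.2.2.1, z.2.2.2.1), fun _ => rfl, fun _ => rfl⟩ _ _ ?_
  intro z
  rfl

lemma second_moment (Y : MQ n) :
    ∫ w : Matrix.unitaryGroup (Fin 4) ℂ, nrm (D q ((gate n q q' h w)ᴴ * Y * gate n q q' h w)) ∂(nu (Fin 4))
      = (1/5) * (nrm Y + 4 * nrm (D q (D q' Y))) := by
  have hC : (((∫ w : Matrix.unitaryGroup (Fin 4) ℂ, nrm (D q ((gate n q q' h w)ᴴ * Y * gate n q q' h w)) ∂(nu (Fin 4)) : ℝ)) : ℂ)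
      = (((1/5) * (nrm Y + 4 * nrm (D q (D q' Y))) : ℝ) : ℂ) := by
    rw [← integral_complex_ofReal]
    simp only [nrm_D_conj]
    rw [integral_const_mul]
    have hIntg : ∀ a b c d (z : ℂ), Integrable (fun w : Matrix.unitaryGroup (Fin 4) ℂ => Tw w a b c d * z) (nu (Fin 4)) :=
      fun a b c d z => (integrable_cont _ _ (Tw_cont a b c d)).mul_const z
    rw [integral_finsetSum _ (fun a _ => integrable_finsetSum _ fun b _ => integrable_finsetSum _ fun c _ =>
      integrable_finsetSum _ fun d _ => hIntg _ _ _ _ _)]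
    simp only [integral_finsetSum _ (fun b _ => integrable_finsetSum _ fun c _ =>
      integrable_finsetSum _ fun d _ => hIntg _ b c d _),
      integral_finsetSum _ (fun c _ => integrable_finsetSum _ fun d _ => hIntg _ _ c d _),
      integral_finsetSum _ (fun d _ => hIntg _ _ _ d _), integral_mul_const]
    have hTT : ∀ a b c d, ∫ w : Matrix.unitaryGroup (Fin 4) ℂ, Tw w a b c d ∂(nu (Fin 4)) = TT a b c d :=
      fun _ _ _ _ => rfl
    simp only [hTT, TT_val, add_mul, Finset.sum_add_distrib]
    have s1 : ∑ a, ∑ b, ∑ c, ∑ d, (if a = b ∧ c = d then (2/5 : ℂ) else 0) *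
        (Yᴴ * gate n q q' h (Matrix.single a b 1) * Y * gate n q q' h (Matrix.single c d 1)).trace
        = (2/5) * nrm Y := by
      have : ∀ a b, (∑ c, ∑ d, (if a = b ∧ c = d then (2/5 : ℂ) else 0) *
        (Yᴴ * gate n q q' h (Matrix.single a b 1) * Y * gate n q q' h (Matrix.single c d 1)).trace)
        = if a = b then (2/5) * (Yᴴ * gate n q q' h (Matrix.single a b 1) * Y).trace else 0 := by
        intro a b
        by_cases hab : a = b
        · subst hab
          simp only [true_and, ite_mul, zero_mul, Finset.sum_ite_eq, Finset.mem_univ, if_true]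
          rw [← Finset.mul_sum, ← Matrix.trace_sum, ← Finset.mul_sum, ← map_sum]
          have : ∑ c : Fin 4, Matrix.single c c (1:ℂ) = 1 := by
            ext x y; simp [Matrix.sum_apply, Matrix.single_apply, Matrix.one_apply, ite_and]
          rw [this, gate_one, mul_one]
        · simp [hab]
      simp only [this, Finset.sum_ite_eq, Finset.mem_univ, if_true]
      rw [← Finset.mul_sum, ← Matrix.trace_sum, ← Finset.sum_mul, ← Finset.mul_sum, ← map_sum]
      have : ∑ c : Fin 4, Matrix.single c c (1:ℂ) = 1 := by
        ext x y; simp [Matrix.sum_apply, Matrix.single_apply, Matrix.one_apply, ite_and]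
      rw [this, gate_one, mul_one, ← nrm_eq]; rfl
    have s2 : ∑ a, ∑ b, ∑ c, ∑ d, (if a = d ∧ c = b then (2/5 : ℂ) else 0) *
        (Yᴴ * gate n q q' h (Matrix.single a b 1) * Y * gate n q q' h (Matrix.single c d 1)).trace
        = (8/5) * nrm (D q (D q' Y)) := by
      have e : ∀ a b, (∑ c, ∑ d, (if a = d ∧ c = b then (2/5 : ℂ) else 0) *
        (Yᴴ * gate n q q' h (Matrix.single a b 1) * Y * gate n q q' h (Matrix.single c d 1)).trace)
        = (2/5) * (Yᴴ * (gate n q q' h (Matrix.single a b 1) * Y * gate n q q' h (Matrix.single b a 1))).trace := by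
        intro a b
        rw [Finset.sum_eq_single b, Finset.sum_eq_single a]
        · simp [mul_assoc]
        · intro d _ hd; simp [hd.symm]
        · simp
        · intro c _ hc; simp [hc]
        · simp
      simp only [e]
      have hn : ((nrm (D q (D q' Y)) : ℝ) : ℂ) = hs Y (D q (D q' Y)) := by
        rw [← nrm_eq, D_sa, D_sa, D_idem, D_comm q' q, D_idem]
      rw [hn, D_pair h, hs_smul_right, hs_sum_right]
      simp only [hs_sum_right]
      unfold hs
      simp only [← Finset.mul_sum]
      ring
    rw [s1, s2]
    push_cast
    ring
  exact_mod_cast hC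

end
end TPE

namespace TPE

section edges
variable {n t : ℕ} {e : ℕ}

/-- gate on the edge `(e, e+1)` -/
def eG (he : e + 1 < n) : Matrix (Fin 4) (Fin 4) ℂ →ₗ[ℂ] MQ n :=
  gate n ⟨e, by omega⟩ ⟨e + 1, he⟩ (by simp)

/-- support of the edge -/
def eS (he : e + 1 < n) : Finset (Fin n) := {⟨e, by omega⟩, ⟨e + 1, he⟩}

lemma eG_mem (he : e + 1 < n) (U : Matrix (Fin 4) (Fin 4) ℂ) : eG he U ∈ Loc (eS he) := gate_mem _ U

lemma eG_unitary (he : e + 1 < n) {U : Matrix (Fin 4) (Fin 4) ℂ}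
    (hU : U ∈ Matrix.unitaryGroup (Fin 4) ℂ) : eG he U ∈ Matrix.unitaryGroup (Q n) ℂ :=
  gate_unitary _ hU

lemma eG_mul (he : e + 1 < n) (U V : Matrix (Fin 4) (Fin 4) ℂ) :
    eG he (U * V) = eG he U * eG he V := gate_mul _ U V
lemma eG_star (he : e + 1 < n) (U : Matrix (Fin 4) (Fin 4) ℂ) :
    eG he Uᴴ = (eG he U)ᴴ := gate_star _ U
lemma eG_one (he : e + 1 < n) : eG he 1 = 1 := gate_one _
lemma eG_continuous (he : e + 1 < n) : Continuous (eG he) := gate_continuous _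

lemma eG_comm_Loc (he : e + 1 < n) {S : Finset (Fin n)} (hS : Disjoint (eS he) S) {X : MQ n}
    (hX : X ∈ Loc S) (U : Matrix (Fin 4) (Fin 4) ℂ) : Commute (eG he U) X := by
  have h1 : (⟨e, by omega⟩ : Fin n) ∉ S := fun h =>
    (Finset.disjoint_left.1 hS) (by simp [eS]) h
  have h2 : (⟨e + 1, he⟩ : Fin n) ∉ S := fun h =>
    (Finset.disjoint_left.1 hS) (by simp [eS]) h
  unfold eG
  rw [gate_expand]
  refine Commute.sum_left _ _ _ fun a _ => Commute.sum_left _ _ _ fun b _ => ?_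
  refine Commute.smul_left ?_ _
  rw [gate_unit]
  exact Commute.mul_left (Loc_comm_mu hX h1 _ _) (Loc_comm_mu hX h2 _ _)

/-- vectors fixed by all gates on the edge `e` -/
def WE (t n e : ℕ) : Submodule ℂ (HS t (Q n)) :=
  if he : e + 1 < n then
    { carrier := {v | ∀ U : Matrix.unitaryGroup (Fin 4) ℂ,
        op (momentMat t (eG he (U : Matrix (Fin 4) (Fin 4) ℂ))) v = v}
      add_mem' := by
        intro a b ha hb U
        rw [map_add, ha, hb]
      zero_mem' := by intro U; rw [map_zero]
      smul_mem' := by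
        intro c a ha U
        rw [map_smul, ha] }
  else ⊤

lemma mem_WE (he : e + 1 < n) (v : HS t (Q n)) : v ∈ WE t n e ↔
    ∀ U : Matrix.unitaryGroup (Fin 4) ℂ, op (momentMat t (eG he (U : Matrix (Fin 4) (Fin 4) ℂ))) v = v := by
  unfold WE
  rw [dif_pos he]; rfl

lemma WE_top (he : ¬ e + 1 < n) : WE t n e = ⊤ := by
  unfold WE
  rw [dif_neg he]

lemma eG_moment_continuous (he : e + 1 < n) :
    Continuous fun U : Matrix.unitaryGroup (Fin 4) ℂ => momentMat t (eG he (U : Matrix (Fin 4) (Fin 4) ℂ)) :=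
  momentMat_continuous.comp ((eG_continuous he).comp continuous_subtype_val)

lemma WE_avg (he : e + 1 < n) (v : HS t (Q n)) :
    ∫ U : Matrix.unitaryGroup (Fin 4) ℂ, op (momentMat t (eG he (U : Matrix (Fin 4) (Fin 4) ℂ))) v
      ∂(nu (Fin 4)) = (WE t n e).starProjection v := by
  refine avg_proj (nu (Fin 4)) (fun U : Matrix.unitaryGroup (Fin 4) ℂ =>
    op (momentMat t (eG he (U : Matrix (Fin 4) (Fin 4) ℂ)))) ?_ ?_ ?_ (WE t n e) ?_ v
  · intro g h v
    rw [← op_mul_apply, ← momentMat_mul, ← eG_mul]; rfl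
  · intro v
    exact (op_continuous v).comp (eG_moment_continuous he)
  · intro g v w
    rw [op_adj, momentMat_conjTranspose, ← eG_star]; rfl
  · intro v; exact mem_WE he v

/-- vectors killed by the infinitesimal action of `Loc S` -/
def VS (t : ℕ) (S : Finset (Fin n)) : Submodule ℂ (HS t (Q n)) where
  carrier := {v | ∀ X ∈ Loc S, op (dmom t X) v = 0}
  add_mem' := by
    intro a b ha hb X hX
    rw [map_add, ha X hX, hb X hX, add_zero]
  zero_mem' := by intro X _; rw [map_zero]
  smul_mem' := by
    intro c a ha X hX
    rw [map_smul, ha X hX, smul_zero]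

lemma mem_VS {S : Finset (Fin n)} {v : HS t (Q n)} : v ∈ VS t S ↔ ∀ X ∈ Loc S, op (dmom t X) v = 0 :=
  Iff.rfl

lemma WE_le_VS (he : e + 1 < n) : WE t n e ≤ VS t (eS he) := by
  intro v hv X hX
  refine dmom_of_unitary_fixed (Subalgebra.toSubmodule (Loc (eS he))) (fun Y hY => Loc_star hY) v ?_ X hX
  intro Y hY hs
  have h1 := exp_skew_unitary Y hs
  obtain ⟨U, hU⟩ := gate_surj (n := n) (q := ⟨e, by omega⟩) (q' := ⟨e + 1, he⟩) (by simp) _ (Loc_exp hY)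
  rw [hU] at h1 ⊢
  exact (mem_WE he v).1 hv ⟨U, unitary_of_gate _ h1⟩

lemma WE_maps_Loc (he : e + 1 < n) {S : Finset (Fin n)} (hS : Disjoint (eS he) S) {X : MQ n}
    (hX : X ∈ Loc S) (v : HS t (Q n)) (hv : v ∈ WE t n e) : op (momentMat t X) v ∈ WE t n e := by
  rw [mem_WE he] at hv ⊢
  intro U
  rw [← op_mul_apply, ← momentMat_mul, (eG_comm_Loc he hS hX U).eq, momentMat_mul, op_mul_apply, hv]

lemma WE_proj_Loc (he : e + 1 < n) {S : Finset (Fin n)} (hS : Disjoint (eS he) S) {X : MQ n}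
    (hX : X ∈ Loc S) (v : HS t (Q n)) :
    op (momentMat t X) ((WE t n e).starProjection v) = (WE t n e).starProjection (op (momentMat t X) v) := by
  refine proj_comm_of_maps (WE t n e) _ (op (momentMat t X)ᴴ) (fun v w => op_adj _ _ _)
    (fun v hv => WE_maps_Loc he hS hX v hv) (fun v hv => ?_) v
  rw [momentMat_conjTranspose]
  exact WE_maps_Loc he hS (Loc_star hX) v hv

lemma eS_disjoint {e e' : ℕ} (he : e + 1 < n) (he' : e' + 1 < n) (h : e + 2 ≤ e') :
    Disjoint (eS he) (eS he') := by
  rw [Finset.disjoint_left]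
  intro q hq hq'
  simp only [eS, Finset.mem_insert, Finset.mem_singleton, Fin.ext_iff] at hq hq'
  omega

lemma WE_commute (t n : ℕ) (e e' : ℕ) (h : e + 2 ≤ e') :
    Commute (WE t n e).starProjection (WE t n e').starProjection := by
  by_cases he' : e' + 1 < n
  swap
  · rw [WE_top he', Submodule.starProjection_top]
    exact Commute.one_right _
  have he : e + 1 < n := by omega
  have hd := eS_disjoint he he' h
  ext1 v
  change (WE t n e).starProjection ((WE t n e').starProjection v)
    = (WE t n e').starProjection ((WE t n e).starProjection v)
  refine proj_comm_of_maps (WE t n e') _ _ (fun v w => inner_proj_symm _ _ _) ?_ ?_ v <;>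
  · intro v hv
    rw [mem_WE he'] at hv ⊢
    intro U
    rw [WE_proj_Loc he hd (eG_mem he' _), hv]

end edges

section EE
variable {n : ℕ}

/-- depolarising map indexed by ℕ -/
def Dn (n q : ℕ) : MQ n →ₗ[ℂ] MQ n := if h : q < n then D ⟨q, h⟩ else LinearMap.id

lemma Dn_pos {q : ℕ} (h : q < n) (X : MQ n) : Dn n q X = D ⟨q, h⟩ X := by
  unfold Dn; rw [dif_pos h]
lemma Dn_neg {q : ℕ} (h : ¬ q < n) (X : MQ n) : Dn n q X = X := by
  unfold Dn; rw [dif_neg h]; rfl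

lemma Dn_comm (q r : ℕ) (X : MQ n) : Dn n q (Dn n r X) = Dn n r (Dn n q X) := by
  by_cases hq : q < n <;> by_cases hr : r < n
  · simp only [Dn_pos hq, Dn_pos hr]; exact D_comm _ _ _
  · simp only [Dn_pos hq, Dn_neg hr]
  · simp only [Dn_neg hq, Dn_pos hr]
  · simp only [Dn_neg hq, Dn_neg hr]
lemma Dn_idem (q : ℕ) (X : MQ n) : Dn n q (Dn n q X) = Dn n q X := by
  by_cases hq : q < n
  · simp only [Dn_pos hq]; exact D_idem _ _
  · simp only [Dn_neg hq]
lemma Dn_sa (q : ℕ) (X Y : MQ n) : hs (Dn n q X) Y = hs X (Dn n q Y) := by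
  by_cases hq : q < n
  · simp only [Dn_pos hq]; exact D_sa _ _ _
  · simp only [Dn_neg hq]
lemma nrm_Dn_le (q : ℕ) (X : MQ n) : nrm (Dn n q X) ≤ nrm X := by
  by_cases hq : q < n
  · simp only [Dn_pos hq]; exact nrm_D_le _ _
  · simp only [Dn_neg hq]; exact le_rfl

/-- depolarise the first `p` qubits starting at `o` -/
def EE (n o : ℕ) : ℕ → MQ n →ₗ[ℂ] MQ n
  | 0 => LinearMap.id
  | p + 1 => Dn n (o + p) ∘ₗ EE n o p

lemma EE_zero (o : ℕ) (X : MQ n) : EE n o 0 X = X := rfl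
lemma EE_succ (o p : ℕ) (X : MQ n) : EE n o (p + 1) X = Dn n (o + p) (EE n o p X) := rfl

lemma EE_Dn (o p q : ℕ) (X : MQ n) : EE n o p (Dn n q X) = Dn n q (EE n o p X) := by
  induction p with
  | zero => rfl
  | succ p ih => rw [EE_succ, EE_succ, ih, Dn_comm]

lemma EE_comm (o p p' : ℕ) (X : MQ n) : EE n o p (EE n o p' X) = EE n o p' (EE n o p X) := by
  induction p' with
  | zero => rfl
  | succ p' ih => rw [EE_succ, EE_succ, EE_Dn, ih]

lemma EE_sa (o p : ℕ) (X Y : MQ n) : hs (EE n o p X) Y = hs X (EE n o p Y) := by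
  induction p generalizing Y with
  | zero => rfl
  | succ p ih => rw [EE_succ, EE_succ, Dn_sa, ih, EE_Dn]

lemma EE_absorb (o : ℕ) {p p' : ℕ} (h : p ≤ p') (X : MQ n) : EE n o p' (EE n o p X) = EE n o p' X := by
  induction p', h using Nat.le_induction with
  | base =>
    induction p with
    | zero => rfl
    | succ p ih => rw [EE_succ, EE_succ, EE_Dn, ih, Dn_idem]
  | succ p' h ih => rw [EE_succ, ih, EE_succ]

lemma nrm_EE_succ (o p : ℕ) (X : MQ n) : nrm (EE n o (p + 1) X) ≤ nrm (EE n o p X) := nrm_Dn_le _ _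

lemma nrm_EE_sub (o : ℕ) {p p' : ℕ} (h : p ≤ p') (X : MQ n) :
    nrm (EE n o p X - EE n o p' X) = nrm (EE n o p X) - nrm (EE n o p' X) := by
  have := nrm_sub_proj (EE n o p') (EE n o p X) 
    (by rw [EE_sa o p' (EE n o p X) (EE n o p' (EE n o p X)), EE_absorb o (le_refl p')])
  rwa [EE_absorb o h] at this

lemma EE_conj {e : ℕ} (he : e + 1 < n) (o p : ℕ) (hp : o + p ≤ e) {A B : MQ n} (hA : A ∈ Loc (eS he))
    (hB : B ∈ Loc (eS he)) (X : MQ n) : EE n o p (A * X * B) = A * EE n o p X * B := by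
  induction p with
  | zero => rfl
  | succ p ih =>
    rw [EE_succ, ih (by omega), EE_succ, Dn_pos (by omega), Dn_pos (by omega)]
    refine D_conj ?_ hA hB _
    simp only [eS, Finset.mem_insert, Finset.mem_singleton, Fin.ext_iff]
    omega

lemma EE_two (o j : ℕ) (he : o + j + 1 < n) (X : MQ n) :
    EE n o (j + 2) X = D ⟨o + j, by omega⟩ (D ⟨o + j + 1, he⟩ (EE n o j X)) := by
  rw [EE_succ, EE_succ, ← D_comm, Dn_pos (q := o + j) (by omega), Dn_pos (q := o + (j + 1)) (by omega)]
  rfl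

lemma EE_inv (o j p : ℕ) (he : o + j + 1 < n) (hp : j + 2 ≤ p) (w : Matrix (Fin 4) (Fin 4) ℂ)
    (hw : w ∈ Matrix.unitaryGroup (Fin 4) ℂ) (X : MQ n) :
    EE n o p ((eG he w)ᴴ * X * eG he w) = EE n o p X := by
  induction p, hp using Nat.le_induction with
  | base =>
    rw [EE_two o j he, EE_two o j he, EE_conj he o j le_rfl (Loc_star (eG_mem he w)) (eG_mem he w)]
    exact D_pair_inv _ w hw _
  | succ p h ih => rw [EE_succ, ih, EE_succ]

lemma EE_Loc (o p : ℕ) {S : Finset (Fin n)} {X : MQ n} (hX : X ∈ Loc S) :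
    EE n o p X ∈ Loc (S.filter fun q => ¬ (o ≤ (q : ℕ) ∧ (q : ℕ) < o + p)) := by
  induction p with
  | zero =>
    refine Loc_mono ?_ hX
    intro q hq
    rw [Finset.mem_filter]
    exact ⟨hq, by omega⟩
  | succ p ih =>
    rw [EE_succ]
    by_cases h : o + p < n
    · rw [Dn_pos h]
      refine Loc_mono ?_ (D_Loc _ ih)
      intro q hq
      simp only [Finset.mem_erase, Finset.mem_filter, ne_eq, Fin.ext_iff] at hq ⊢
      exact ⟨hq.2.1, by omega⟩
    · rw [Dn_neg h]
      refine Loc_mono ?_ ih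
      intro q hq
      simp only [Finset.mem_filter] at hq ⊢
      have := q.2
      exact ⟨hq.1, by omega⟩

lemma Loc_empty {X : MQ n} (hX : X ∈ Loc (∅ : Finset (Fin n))) : ∃ c : ℂ, X = c • 1 := by
  refine ⟨X 0 0, ?_⟩
  ext x y
  rw [Loc_apply hX x y 0]
  simp only [Finset.notMem_empty, not_false_eq_true, forall_const, Finset.piecewise_empty,
    Matrix.smul_apply, Matrix.one_apply, smul_eq_mul, mul_ite, mul_one, mul_zero, ← funext_iff]

/-- the interval `[o, o+L)` of qubits -/
def Iv (n o L : ℕ) : Finset (Fin n) := Finset.univ.filter fun q => o ≤ (q : ℕ) ∧ (q : ℕ) < o + L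

lemma mem_Iv {o L : ℕ} {q : Fin n} : q ∈ Iv n o L ↔ o ≤ (q : ℕ) ∧ (q : ℕ) < o + L := by
  simp [Iv]

lemma EE_scalar (o L : ℕ) {X : MQ n} (hX : X ∈ Loc (Iv n o L)) : ∃ c : ℂ, EE n o L X = c • 1 := by
  apply Loc_empty
  refine Loc_mono ?_ (EE_Loc o L hX)
  intro q hq
  simp only [Finset.mem_filter, mem_Iv] at hq
  exact absurd hq.1 hq.2

lemma EE_last (o K : ℕ) (he : o + K + 1 < n) {X : MQ n} (hX : X ∈ Loc (Iv n o (K + 2))) :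
    EE n o K X ∈ Loc (eS he) := by
  refine Loc_mono ?_ (EE_Loc o K hX)
  intro q hq
  simp only [Finset.mem_filter, mem_Iv] at hq
  simp only [eS, Finset.mem_insert, Finset.mem_singleton, Fin.ext_iff]
  omega

end EE
end TPE

namespace TPE

section num
/-- weights -/
def ph (r : ℝ) (p : ℕ) : ℝ := 1 - (5 * r / 9) * (4 ^ (p + 1) - 3 * p - 4)
/-- weight differences -/
def dd (r : ℝ) (j : ℕ) : ℝ := (5 * r / 3) * (4 ^ (j + 1) - 1)

lemma ph_succ (r : ℝ) (p : ℕ) : ph r (p + 1) = ph r p - dd r p := by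
  unfold ph dd; push_cast; ring

/-- the Lyapunov functional -/
def FF (r : ℝ) (K : ℕ) (e : ℕ → ℝ) : ℝ :=
  e 0 - ∑ j ∈ Finset.range K, dd r j * e (j + 1) - ph r K * e (K + 2)

lemma FF_eq (r : ℝ) (K : ℕ) (e : ℕ → ℝ) :
    FF r K e = ∑ p ∈ Finset.range K, ph r p * (e p - e (p + 1)) + ph r K * (e K - e (K + 2)) := by
  have : e 0 - ∑ j ∈ Finset.range K, dd r j * e (j + 1)
      = ∑ p ∈ Finset.range K, ph r p * (e p - e (p + 1)) + ph r K * e K := by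
    induction K with
    | zero => simp [ph]
    | succ K ih =>
      rw [Finset.sum_range_succ, Finset.sum_range_succ, ph_succ]
      linear_combination ih
  unfold FF
  rw [this]; ring

lemma num_sum (r : ℝ) (K : ℕ) (f : ℕ → ℝ) :
    ∑ j ∈ Finset.range K, dd r j * (4 * f (j + 1) - f j) / 5
      = -r * ∑ p ∈ Finset.range K, f p + (4 * r / 3) * (4 ^ K - 1) * f K := by
  induction K with
  | zero => simp
  | succ K ih =>
    rw [Finset.sum_range_succ, Finset.sum_range_succ, ih]
    unfold dd; ring

lemma ph_bounds (r : ℝ) (K : ℕ) (hr : r * 4 ^ (K + 1) = 1) (p : ℕ) (hp : p ≤ K) :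
    4 / 9 ≤ ph r p ∧ ph r p ≤ 1 := by
  have hr0 : 0 < r := by
    by_contra h
    have : r * 4 ^ (K + 1) ≤ 0 := mul_nonpos_of_nonpos_of_nonneg (not_lt.1 h) (by positivity)
    linarith
  have h1 : (4 : ℝ) ^ (p + 1) ≤ 4 ^ (K + 1) := pow_le_pow_right₀ (by norm_num) (by omega)
  have h2 : (0 : ℝ) ≤ 4 ^ (p + 1) - 3 * p - 4 := by
    clear h1 hp
    induction p with
    | zero => norm_num
    | succ p ih =>
      have : (1 : ℝ) ≤ 4 ^ (p + 1) := one_le_pow₀ (by norm_num)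
      push_cast
      rw [pow_succ]
      linarith
  have h3 : r * (4 ^ (p + 1) - 3 * p - 4) ≤ 1 := by
    rw [← hr]
    apply mul_le_mul_of_nonneg_left _ hr0.le
    have : (0 : ℝ) ≤ p := Nat.cast_nonneg p
    linarith
  have h4 := mul_nonneg hr0.le h2
  unfold ph
  constructor <;> linarith

lemma num_final (r : ℝ) (K : ℕ) (hr : r * 4 ^ (K + 1) = 1) (e : ℕ → ℝ) (he : ∀ p, e (p + 1) ≤ e p) :
    ∑ j ∈ Finset.range K, (FF r K e - dd r j * ((e j + 4 * e (j + 2)) / 5 - e (j + 1)))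
      + (FF r K e - ph r K * (e K - e (K + 2))) ≤ (K + 1) * FF r K e - r * FF r K e := by
  have hr0 : 0 < r := by
    by_contra h
    have : r * 4 ^ (K + 1) ≤ 0 := mul_nonpos_of_nonpos_of_nonneg (not_lt.1 h) (by positivity)
    linarith
  have hr1 : r ≤ 1 / 4 := by
    have : (4 : ℝ) ≤ 4 ^ (K + 1) := by
      calc (4 : ℝ) = 4 ^ 1 := by norm_num
        _ ≤ _ := pow_le_pow_right₀ (by norm_num) (by omega)
    nlinarith
  have h1 := num_sum r K (fun p => e p - e (p + 1))
  have h2 : ∑ j ∈ Finset.range K, (FF r K e - dd r j * ((e j + 4 * e (j + 2)) / 5 - e (j + 1)))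
      = K * FF r K e + ∑ j ∈ Finset.range K,
        dd r j * (4 * (e (j + 1) - e (j + 1 + 1)) - (e j - e (j + 1))) / 5 := by
    rw [Finset.sum_sub_distrib, Finset.sum_const, Finset.card_range, nsmul_eq_mul, sub_eq_add_neg,
      ← Finset.sum_neg_distrib]
    congr 1
    refine Finset.sum_congr rfl fun j _ => by ring
  rw [h2, h1]
  have h3 : r * ∑ p ∈ Finset.range K, ph r p * (e p - e (p + 1))
      ≤ r * ∑ p ∈ Finset.range K, (e p - e (p + 1)) := by
    apply mul_le_mul_of_nonneg_left _ hr0.le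
    refine Finset.sum_le_sum fun p hp => ?_
    have := (ph_bounds r K hr p (Finset.mem_range.1 hp).le).2
    have := he p
    nlinarith
  have h4 := ph_bounds r K hr K le_rfl
  have h5 : (4 * r / 3) * (4 ^ K - 1) = (1 - 4 * r) / 3 := by
    rw [pow_succ] at hr; linear_combination hr / 3
  rw [h5]
  have hK := he K
  have hK1 := he (K + 1)
  have h6 : (1 - 4 * r) / 3 * (e K - e (K + 1)) ≤ (1 - r) * ph r K * (e K - e (K + 2)) := by
    have a : (1 - 4 * r) / 3 ≤ (1 - r) * ph r K := by nlinarith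
    have b : 0 ≤ (1 - r) * ph r K := by nlinarith
    have c : e K - e (K + 1) ≤ e K - e (K + 2) := by linarith
    have d : 0 ≤ e K - e (K + 1) := by linarith
    calc _ ≤ (1 - r) * ph r K * (e K - e (K + 1)) := mul_le_mul_of_nonneg_right a d
      _ ≤ _ := mul_le_mul_of_nonneg_left c b
  have h7 := FF_eq r K e
  have h8 : r * FF r K e = r * ∑ p ∈ Finset.range K, ph r p * (e p - e (p + 1)) + r * (ph r K * (e K - e (K + 2))) := by
    rw [h7]; ring
  nlinarith

lemma FF_lower (r : ℝ) (K : ℕ) (hr : r * 4 ^ (K + 1) = 1) (e : ℕ → ℝ) (he : ∀ p, e (p + 1) ≤ e p) :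
    4 / 9 * (e 0 - e (K + 2)) ≤ FF r K e := by
  rw [FF_eq]
  have h1 : e 0 - e (K + 2) = ∑ p ∈ Finset.range K, (e p - e (p + 1)) + (e K - e (K + 2)) := by
    rw [Finset.sum_range_sub']; ring
  rw [h1, mul_add, Finset.mul_sum]
  have h4 := (ph_bounds r K hr K le_rfl).1
  have hK := he K
  have hK1 := he (K + 1)
  refine add_le_add (Finset.sum_le_sum fun p hp => ?_) ?_
  · have := (ph_bounds r K hr p (Finset.mem_range.1 hp).le).1
    have := he p
    nlinarith
  · have d : 0 ≤ e K - e (K + 2) := by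
      have : e (K + 2) ≤ e (K + 1) := hK1
      linarith
    nlinarith

lemma FF_change (r : ℝ) (K j : ℕ) (hj : j < K) (e e' : ℕ → ℝ) (h : ∀ p, p ≠ j + 1 → e' p = e p) :
    FF r K e' = FF r K e - dd r j * (e' (j + 1) - e (j + 1)) := by
  unfold FF
  rw [h 0 (by omega), h (K + 2) (by omega),
    ← Finset.add_sum_erase _ _ (Finset.mem_range.2 hj),
    ← Finset.add_sum_erase (Finset.range K) (fun j => dd r j * e (j + 1)) (Finset.mem_range.2 hj)]
  rw [Finset.sum_congr rfl (g := fun i => dd r i * e (i + 1))]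
  · ring
  · intro i hi
    rw [h (i + 1) (by have := Finset.ne_of_mem_erase hi; omega)]

end num

section partB
variable {n t : ℕ}

/-- the profile -/
def prof (n o : ℕ) (X : MQ n) (p : ℕ) : ℝ := nrm (EE n o p X)

lemma prof_anti (o : ℕ) (X : MQ n) (p : ℕ) : prof n o X (p + 1) ≤ prof n o X p := nrm_EE_succ o p X

lemma dmom_bound (v : HS t (Q n)) : ∃ c, 0 ≤ c ∧ ∀ X : MQ n, ‖op (dmom t X) v‖ ≤ c * Real.sqrt (nrm X) := by
  refine ⟨∑ x, ∑ y, ‖op (dmom t (Matrix.single x y (1:ℂ))) v‖, by positivity, fun X => ?_⟩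
  have h : X = ∑ x, ∑ y, X x y • Matrix.single x y (1:ℂ) := by
    conv_lhs => rw [Matrix.matrix_eq_sum_single X]
    simp
  have h2 : op (dmom t X) v = ∑ x, ∑ y, X x y • op (dmom t (Matrix.single x y (1:ℂ))) v := by
    conv_lhs => rw [h]
    simp only [map_sum, map_smul, op_sum, op_smul, _root_.sum_apply, _root_.smul_apply]
  rw [h2, Finset.sum_mul]
  refine (norm_sum_le _ _).trans (Finset.sum_le_sum fun x _ => ?_)
  rw [Finset.sum_mul]
  refine (norm_sum_le _ _).trans (Finset.sum_le_sum fun y _ => ?_)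
  rw [norm_smul, mul_comm]
  refine mul_le_mul_of_nonneg_left ?_ (norm_nonneg _)
  apply Real.le_sqrt_of_sq_le
  unfold nrm
  calc ‖X x y‖ ^ 2 ≤ ∑ y, ‖X x y‖ ^ 2 := Finset.single_le_sum (f := fun y => ‖X x y‖ ^ 2) (fun _ _ => by positivity) (Finset.mem_univ y)
    _ ≤ _ := Finset.single_le_sum (f := fun x => ∑ y, ‖X x y‖ ^ 2) (fun _ _ => by positivity) (Finset.mem_univ x)

lemma dmom_WE (e : ℕ) (he : e + 1 < n) (X : MQ n) (v : HS t (Q n)) :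
    op (dmom t X) ((WE t n e).starProjection v) =
      ∫ w : Matrix.unitaryGroup (Fin 4) ℂ, op (momentMat t (eG he (w : Matrix (Fin 4) (Fin 4) ℂ)))
        (op (dmom t ((eG he (w : Matrix (Fin 4) (Fin 4) ℂ))ᴴ * X * eG he (w : Matrix (Fin 4) (Fin 4) ℂ))) v) ∂(nu (Fin 4)) := by
  rw [← WE_avg he, ← ContinuousLinearMap.integral_comp_comm]
  · refine integral_congr_ae (Filter.Eventually.of_forall fun w => ?_)
    change op (dmom t X) (op (momentMat t (eG he (w : Matrix (Fin 4) (Fin 4) ℂ))) v) = _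
    rw [← op_mul_apply, dmom_conj _ _ (eG_unitary he w.2), op_mul_apply]
  · exact integrable_cont _ _ ((op_continuous v).comp (eG_moment_continuous he))

lemma am_gm (F s : ℝ) (hF : 0 ≤ F) (hs : 0 < s) : Real.sqrt F ≤ (F / s + s) / 2 := by
  have h := Real.mul_self_sqrt hF
  rw [← sub_nonneg]
  have : (F / s + s) / 2 - Real.sqrt F = (Real.sqrt F - s) ^ 2 / (2 * s) := by
    field_simp
    nlinarith
  rw [this]; positivity

lemma eS_sub_Iv (o K j : ℕ) (hj : j ≤ K) (he : o + j + 1 < n) : eS he ⊆ Iv n o (K + 2) := by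
  intro q hq
  simp only [eS, Finset.mem_insert, Finset.mem_singleton, Fin.ext_iff] at hq
  rw [mem_Iv]; omega

lemma conj_Loc {S : Finset (Fin n)} {A X : MQ n} (hA : A ∈ Loc S) (hX : X ∈ Loc S) :
    Aᴴ * X * A ∈ Loc S := mul_mem (mul_mem (Loc_star hA) hX) hA

lemma prof_conj (o j p : ℕ) (he : o + j + 1 < n) (hp : p ≠ j + 1) (w : Matrix (Fin 4) (Fin 4) ℂ)
    (hw : w ∈ Matrix.unitaryGroup (Fin 4) ℂ) (X : MQ n) :
    prof n o ((eG he w)ᴴ * X * eG he w) p = prof n o X p := by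
  unfold prof
  rcases Nat.lt_or_gt_of_ne hp with h | h
  · rw [EE_conj he o p (by omega) (Loc_star (eG_mem he w)) (eG_mem he w),
      nrm_unitary _ _ (eG_unitary he hw)]
  · rw [EE_inv o j p he (by omega) w hw]

lemma prof_conj_avg (o j : ℕ) (he : o + j + 1 < n) (X : MQ n) :
    ∫ w : Matrix.unitaryGroup (Fin 4) ℂ,
      prof n o ((eG he (w : Matrix (Fin 4) (Fin 4) ℂ))ᴴ * X * eG he (w : Matrix (Fin 4) (Fin 4) ℂ)) (j + 1) ∂(nu (Fin 4))
      = (prof n o X j + 4 * prof n o X (j + 2)) / 5 := by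
  have h : ∀ w : Matrix.unitaryGroup (Fin 4) ℂ,
      prof n o ((eG he (w : Matrix (Fin 4) (Fin 4) ℂ))ᴴ * X * eG he (w : Matrix (Fin 4) (Fin 4) ℂ)) (j + 1)
      = nrm (D ⟨o + j, by omega⟩ ((eG he (w : Matrix (Fin 4) (Fin 4) ℂ))ᴴ * EE n o j X * eG he (w : Matrix (Fin 4) (Fin 4) ℂ))) := by
    intro w
    unfold prof
    rw [EE_succ, EE_conj he o j le_rfl (Loc_star (eG_mem he w)) (eG_mem he w), Dn_pos (q := o + j)]
  simp only [h]
  have := second_moment (n := n) (q := ⟨o + j, by omega⟩) (q' := ⟨o + j + 1, he⟩) (by simp) (EE n o j X)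
  unfold eG
  rw [this]
  unfold prof
  rw [EE_two o j he]
  ring

lemma prof_conj_cont (o p : ℕ) {e : ℕ} (he : e + 1 < n) (X : MQ n) :
    Continuous fun w : Matrix.unitaryGroup (Fin 4) ℂ =>
      prof n o ((eG he (w : Matrix (Fin 4) (Fin 4) ℂ))ᴴ * X * eG he (w : Matrix (Fin 4) (Fin 4) ℂ)) p := by
  unfold prof
  have h1 : Continuous fun w : Matrix.unitaryGroup (Fin 4) ℂ => eG he (w : Matrix (Fin 4) (Fin 4) ℂ) :=
    (eG_continuous he).comp continuous_subtype_val
  have h2 : Continuous (EE n o p) := (EE n o p).continuous_of_finiteDimensional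
  have h3 : Continuous (nrm : MQ n → ℝ) := by
    unfold nrm
    refine continuous_finsetSum _ fun x _ => continuous_finsetSum _ fun y _ => ?_
    exact ((continuous_apply_apply x y).norm).pow 2
  exact h3.comp (h2.comp (((h1.matrix_conjTranspose).mul continuous_const).mul h1))

lemma step_edge (o K j : ℕ) (hj : j < K) (hn : o + K + 2 ≤ n) (r : ℝ) (hr : r * 4 ^ (K + 1) = 1)
    (v : HS t (Q n)) (c : ℝ) (hc0 : 0 ≤ c)
    (hc : ∀ X ∈ Loc (Iv n o (K + 2)), ‖op (dmom t X) v‖ ≤ c * Real.sqrt (FF r K (prof n o X)))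
    (X : MQ n) (hX : X ∈ Loc (Iv n o (K + 2))) (s : ℝ) (hs : 0 < s) :
    ‖op (dmom t X) ((WE t n (o + j)).starProjection v)‖ ≤
      c * (((FF r K (prof n o X) - dd r j * ((prof n o X j + 4 * prof n o X (j + 2)) / 5 - prof n o X (j + 1))) / s + s) / 2) := by
  have he : o + j + 1 < n := by omega
  rw [dmom_WE (o + j) he]
  have hFF : ∀ w : Matrix.unitaryGroup (Fin 4) ℂ,
      FF r K (prof n o ((eG he (w : Matrix (Fin 4) (Fin 4) ℂ))ᴴ * X * eG he (w : Matrix (Fin 4) (Fin 4) ℂ)))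
      = FF r K (prof n o X) - dd r j * (prof n o ((eG he (w : Matrix (Fin 4) (Fin 4) ℂ))ᴴ * X * eG he (w : Matrix (Fin 4) (Fin 4) ℂ)) (j + 1) - prof n o X (j + 1)) :=
    fun w => FF_change r K j hj _ _ fun p hp => prof_conj o j p he hp w w.2 X
  have hIntg := integrable_cont (nu (Fin 4)) _ (prof_conj_cont o (j + 1) he X)
  have hg : Integrable (fun w : Matrix.unitaryGroup (Fin 4) ℂ =>
      c * (((FF r K (prof n o X) - dd r j * (prof n o ((eG he (w : Matrix (Fin 4) (Fin 4) ℂ))ᴴ * X * eG he (w : Matrix (Fin 4) (Fin 4) ℂ)) (j + 1) - prof n o X (j + 1))) / s + s) / 2)) (nu (Fin 4)) := by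
    apply integrable_cont
    have := prof_conj_cont o (j + 1) he X
    fun_prop
  refine (norm_integral_le_of_norm_le hg (Filter.Eventually.of_forall fun w => ?_)).trans (le_of_eq ?_)
  · rw [momentMat_norm _ (eG_unitary he w.2)]
    have hL : ((eG he (w : Matrix (Fin 4) (Fin 4) ℂ))ᴴ * X * eG he (w : Matrix (Fin 4) (Fin 4) ℂ)) ∈ Loc (Iv n o (K + 2)) :=
      conj_Loc (Loc_mono (eS_sub_Iv o K j hj.le he) (eG_mem he _)) hX
    refine (hc _ hL).trans (mul_le_mul_of_nonneg_left ?_ hc0)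
    rw [hFF]
    refine am_gm _ _ ?_ hs
    rw [← hFF]
    refine le_trans ?_ (FF_lower r K hr _ (prof_anti o _))
    have h1 : ∀ q p, q ≤ p → prof n o ((eG he (w : Matrix (Fin 4) (Fin 4) ℂ))ᴴ * X * eG he (w : Matrix (Fin 4) (Fin 4) ℂ)) p ≤ prof n o ((eG he (w : Matrix (Fin 4) (Fin 4) ℂ))ᴴ * X * eG he (w : Matrix (Fin 4) (Fin 4) ℂ)) q :=
      fun q p h => antitone_nat_of_succ_le (prof_anti o _) h
    have := h1 0 (K + 2) (by omega)
    linarith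
  · rw [integral_const_mul, integral_div, integral_add, integral_div, integral_sub, integral_const_mul,
      integral_sub, prof_conj_avg]
    · simp
    · exact hIntg
    · exact integrable_const _
    · exact integrable_const _
    · exact (hIntg.sub (integrable_const _)).const_mul _
    · exact ((integrable_const _).sub ((hIntg.sub (integrable_const _)).const_mul _)).div_const _
    · exact integrable_const _

lemma step_last (o K : ℕ) (hn : o + K + 2 ≤ n) (r : ℝ) (hr : r * 4 ^ (K + 1) = 1)
    (v : HS t (Q n)) (c : ℝ) (hc0 : 0 ≤ c)
    (hc : ∀ X ∈ Loc (Iv n o (K + 2)), ‖op (dmom t X) v‖ ≤ c * Real.sqrt (FF r K (prof n o X)))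
    (X : MQ n) (hX : X ∈ Loc (Iv n o (K + 2))) (s : ℝ) (hs : 0 < s) :
    ‖op (dmom t X) ((WE t n (o + K)).starProjection v)‖ ≤
      c * (((FF r K (prof n o X) - ph r K * (prof n o X K - prof n o X (K + 2))) / s + s) / 2) := by
  have he : o + K + 1 < n := by omega
  have h0 : op (dmom t (EE n o K X)) ((WE t n (o + K)).starProjection v) = 0 :=
    (WE_le_VS he) (Submodule.starProjection_apply_mem _ _) _ (EE_last o K he hX)
  set X' := X - EE n o K X with hX'
  have h1 : op (dmom t X) ((WE t n (o + K)).starProjection v) = op (dmom t X') ((WE t n (o + K)).starProjection v) := by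
    rw [hX', map_sub, op_sub, _root_.sub_apply, h0, sub_zero]
  rw [h1, dmom_WE (o + K) he]
  have hX'L : X' ∈ Loc (Iv n o (K + 2)) :=
    sub_mem hX (Loc_mono (eS_sub_Iv o K K le_rfl he) (EE_last o K he hX))
  have hz : ∀ p, K ≤ p → EE n o p X' = 0 := by
    intro p hp
    rw [hX', map_sub, EE_absorb o hp, sub_self]
  have hnrm0 : nrm (0 : MQ n) = 0 := by simp [nrm]
  have hprof : ∀ w : Matrix.unitaryGroup (Fin 4) ℂ,
      FF r K (prof n o ((eG he (w : Matrix (Fin 4) (Fin 4) ℂ))ᴴ * X' * eG he (w : Matrix (Fin 4) (Fin 4) ℂ)))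
      = FF r K (prof n o X) - ph r K * (prof n o X K - prof n o X (K + 2)) := by
    intro w
    rw [FF_eq, FF_eq r K (prof n o X)]
    have a : ∀ p, p ≤ K → prof n o ((eG he (w : Matrix (Fin 4) (Fin 4) ℂ))ᴴ * X' * eG he (w : Matrix (Fin 4) (Fin 4) ℂ)) p
        = prof n o X p - prof n o X K := by
      intro p hp
      rw [prof_conj o K p he (by omega) w w.2]
      unfold prof
      rw [← nrm_EE_sub o hp, hX', map_sub, EE_comm o p K, EE_absorb o hp]
    have b : prof n o ((eG he (w : Matrix (Fin 4) (Fin 4) ℂ))ᴴ * X' * eG he (w : Matrix (Fin 4) (Fin 4) ℂ)) (K + 2) = 0 := by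
      rw [prof_conj o K (K + 2) he (by omega) w w.2]
      unfold prof
      rw [hz _ (by omega), hnrm0]
    rw [b, a K le_rfl, Finset.sum_congr rfl (g := fun p => ph r p * (prof n o X p - prof n o X (p + 1)))]
    · ring
    · intro p hp
      have := Finset.mem_range.1 hp
      rw [a p (by omega), a (p + 1) (by omega)]
      ring
  refine (norm_integral_le_of_norm_le (integrable_const
    (c * (((FF r K (prof n o X) - ph r K * (prof n o X K - prof n o X (K + 2))) / s + s) / 2)))
    (Filter.Eventually.of_forall fun w => ?_)).trans (le_of_eq ?_)
  · rw [momentMat_norm _ (eG_unitary he w.2)]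
    have hL : ((eG he (w : Matrix (Fin 4) (Fin 4) ℂ))ᴴ * X' * eG he (w : Matrix (Fin 4) (Fin 4) ℂ)) ∈ Loc (Iv n o (K + 2)) :=
      conj_Loc (Loc_mono (eS_sub_Iv o K K le_rfl he) (eG_mem he _)) hX'L
    refine (hc _ hL).trans (mul_le_mul_of_nonneg_left ?_ hc0)
    rw [hprof]
    refine am_gm _ _ ?_ hs
    rw [← hprof w]
    refine le_trans ?_ (FF_lower r K hr _ (prof_anti o _))
    have := antitone_nat_of_succ_le (prof_anti o ((eG he (w : Matrix (Fin 4) (Fin 4) ℂ))ᴴ * X' * eG he (w : Matrix (Fin 4) (Fin 4) ℂ))) (Nat.zero_le (K + 2))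
    linarith
  · simp

lemma FF_nonneg (r : ℝ) (K : ℕ) (hr : r * 4 ^ (K + 1) = 1) (o : ℕ) (X : MQ n) :
    0 ≤ FF r K (prof n o X) := by
  refine le_trans ?_ (FF_lower r K hr _ (prof_anti o _))
  have := antitone_nat_of_succ_le (prof_anti o X) (Nat.zero_le (K + 2))
  linarith

theorem partB (o K : ℕ) (hn : o + K + 2 ≤ n) (r : ℝ) (hr : r * 4 ^ (K + 1) = 1)
    (v : HS t (Q n)) (lam : ℝ) (hlam : lam < r / 2)
    (hev : ∑ j ∈ Finset.range (K + 1), cproj (WE t n (o + j)) v = (lam : ℂ) • v) :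
    v ∈ VS t (Iv n o (K + 2)) := by
  have hr0 : 0 < r := by
    by_contra h
    have : r * 4 ^ (K + 1) ≤ 0 := mul_nonpos_of_nonpos_of_nonneg (not_lt.1 h) (by positivity)
    linarith
  have hr1 : r ≤ 1 := by
    have : (1 : ℝ) ≤ 4 ^ (K + 1) := one_le_pow₀ (by norm_num)
    nlinarith
  have hK0 : (0 : ℝ) ≤ K := Nat.cast_nonneg K
  -- initial bound
  obtain ⟨c0, hc00, hc0⟩ := dmom_bound (t := t) (n := n) v
  have hinit : ∀ X ∈ Loc (Iv n o (K + 2)), ‖op (dmom t X) v‖ ≤ (c0 * Real.sqrt (9 / 4)) * Real.sqrt (FF r K (prof n o X)) := by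
    intro X hX
    obtain ⟨z, hz⟩ := EE_scalar o (K + 2) hX
    have h1 : op (dmom t X) v = op (dmom t (X - EE n o (K + 2) X)) v := by
      rw [map_sub, hz, dmom_scalar, sub_zero]
    rw [h1, mul_assoc, ← Real.sqrt_mul (by norm_num)]
    refine (hc0 _).trans (mul_le_mul_of_nonneg_left (Real.sqrt_le_sqrt ?_) hc00)
    have h2 := nrm_EE_sub o (Nat.zero_le (K + 2)) X
    rw [EE_zero] at h2
    rw [h2]
    have := FF_lower r K hr _ (prof_anti o X)
    unfold prof at this ⊢
    rw [EE_zero] at this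
    linarith
  set θ : ℝ := (K + 1 - r / 2) / (K + 1 - lam) with hθ
  have hden : 0 < (K : ℝ) + 1 - lam := by linarith
  have hnum : 0 ≤ (K : ℝ) + 1 - r / 2 := by linarith
  have hθ0 : 0 ≤ θ := div_nonneg hnum hden.le
  have hθ1 : θ < 1 := by rw [hθ, div_lt_one hden]; linarith
  have hsum : ∑ j ∈ Finset.range (K + 1), (WE t n (o + j)).starProjection v = ((K + 1 - lam : ℝ) : ℂ) • v := by
    simp only [cproj, Finset.sum_sub_distrib, Finset.sum_const, Finset.card_range] at hev
    rw [Complex.ofReal_sub, sub_smul, ← hev, ← Nat.cast_smul_eq_nsmul ℂ]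
    push_cast
    abel
  have hstep : ∀ c, 0 ≤ c →
      (∀ X ∈ Loc (Iv n o (K + 2)), ‖op (dmom t X) v‖ ≤ c * Real.sqrt (FF r K (prof n o X))) →
      (∀ X ∈ Loc (Iv n o (K + 2)), ‖op (dmom t X) v‖ ≤ (c * θ) * Real.sqrt (FF r K (prof n o X))) := by
    intro c hcn hc X hX
    have hF0 := FF_nonneg (n := n) r K hr o X
    rcases hF0.eq_or_lt with hF | hF
    · have := hc X hX
      rw [← hF, Real.sqrt_zero, mul_zero] at this ⊢
      exact this
    set F := FF r K (prof n o X) with hFd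
    set s := Real.sqrt F with hs
    have hs0 : 0 < s := Real.sqrt_pos.2 hF
    have hss : s * s = F := Real.mul_self_sqrt hF.le
    have h1 : ‖op (dmom t X) (((K + 1 - lam : ℝ) : ℂ) • v)‖ = (K + 1 - lam) * ‖op (dmom t X) v‖ := by
      rw [map_smul, norm_smul, Complex.norm_real, Real.norm_of_nonneg hden.le]
    have h2 : ‖op (dmom t X) (((K + 1 - lam : ℝ) : ℂ) • v)‖ ≤
        ∑ j ∈ Finset.range K, c * (((F - dd r j * ((prof n o X j + 4 * prof n o X (j + 2)) / 5 - prof n o X (j + 1))) / s + s) / 2)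
        + c * (((F - ph r K * (prof n o X K - prof n o X (K + 2))) / s + s) / 2) := by
      rw [← hsum, map_sum, Finset.sum_range_succ]
      refine (norm_add_le _ _).trans (add_le_add ?_ (step_last o K hn r hr v c hcn hc X hX s hs0))
      refine (norm_sum_le _ _).trans (Finset.sum_le_sum fun j hj => ?_)
      exact step_edge o K j (Finset.mem_range.1 hj) hn r hr v c hcn hc X hX s hs0
    have h3 := num_final r K hr (prof n o X) (prof_anti o X)
    rw [← hFd] at h3
    have h4 : ∑ j ∈ Finset.range K, c * (((F - dd r j * ((prof n o X j + 4 * prof n o X (j + 2)) / 5 - prof n o X (j + 1))) / s + s) / 2)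
        + c * (((F - ph r K * (prof n o X K - prof n o X (K + 2))) / s + s) / 2)
        = c * (((∑ j ∈ Finset.range K, (F - dd r j * ((prof n o X j + 4 * prof n o X (j + 2)) / 5 - prof n o X (j + 1)))
          + (F - ph r K * (prof n o X K - prof n o X (K + 2)))) / s + (K + 1) * s) / 2) := by
      rw [← Finset.mul_sum, ← Finset.sum_div, Finset.sum_add_distrib, ← Finset.sum_div, Finset.sum_const,
        Finset.card_range, nsmul_eq_mul]
      ring
    have h5 : ((K + 1) * F - r * F) / s = (K + 1 - r) * s := by
      rw [← hss]; field_simp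
    have h6 : (K + 1 - lam) * ‖op (dmom t X) v‖ ≤ c * ((K + 1 - r / 2) * s) := by
      rw [← h1]
      refine h2.trans ?_
      rw [h4]
      refine mul_le_mul_of_nonneg_left ?_ hcn
      have h7 := div_le_div_of_nonneg_right h3 hs0.le
      rw [h5] at h7
      linarith
    have h8 : ‖op (dmom t X) v‖ ≤ c * ((K + 1 - r / 2) * s) / (K + 1 - lam) := by
      rw [le_div_iff₀ hden, mul_comm]; exact h6
    refine h8.trans (le_of_eq ?_)
    rw [hθ]; ring
  have hiter : ∀ m : ℕ, ∀ X ∈ Loc (Iv n o (K + 2)), ‖op (dmom t X) v‖ ≤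
      (c0 * Real.sqrt (9 / 4) * θ ^ m) * Real.sqrt (FF r K (prof n o X)) := by
    intro m
    induction m with
    | zero => simpa using hinit
    | succ m ih =>
      have := hstep _ (by positivity) ih
      rw [pow_succ, ← mul_assoc]; exact this
  rw [mem_VS]
  intro X hX
  have hlim : Filter.Tendsto (fun m : ℕ => (c0 * Real.sqrt (9 / 4) * θ ^ m) * Real.sqrt (FF r K (prof n o X)))
      Filter.atTop (nhds 0) := by
    have := (((tendsto_pow_atTop_nhds_zero_of_lt_one hθ0 hθ1).const_mul (c0 * Real.sqrt (9 / 4))).mul_const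
      (Real.sqrt (FF r K (prof n o X))))
    simpa using this
  have := ge_of_tendsto' hlim (fun m => hiter m X hX)
  exact norm_le_zero_iff.1 this

end partB
end TPE

namespace TPE

section pkron
variable {n t : ℕ}

/-- regrouping copies and qubits -/
def colE (n t : ℕ) : Idx t (Q n) ≃ (Fin n → Idx t (Fin 2)) where
  toFun x q := (fun s => x.1 s q, fun s => x.2 s q)
  invFun w := (fun s q => (w q).1 s, fun s q => (w q).2 s)
  left_inv _ := rfl
  right_inv _ := rfl

/-- product over qubits of matrices acting on the copies of each qubit -/
def pk (F : Fin n → Matrix (Idx t (Fin 2)) (Idx t (Fin 2)) ℂ) : Matrix (Idx t (Q n)) (Idx t (Q n)) ℂ :=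
  Matrix.of fun x y => ∏ q, F q (colE n t x q) (colE n t y q)

lemma pk_apply (F : Fin n → Matrix (Idx t (Fin 2)) (Idx t (Fin 2)) ℂ) (x y) :
    pk F x y = ∏ q, F q (colE n t x q) (colE n t y q) := rfl

lemma pk_mul (F G : Fin n → Matrix (Idx t (Fin 2)) (Idx t (Fin 2)) ℂ) :
    pk F * pk G = pk (fun q => F q * G q) := by
  ext x z
  rw [Matrix.mul_apply, pk_apply]
  simp only [pk_apply, Matrix.mul_apply]
  rw [Finset.prod_univ_sum, Fintype.piFinset_univ]
  rw [← (colE n t).sum_comp]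
  refine Finset.sum_congr rfl fun y _ => ?_
  rw [Finset.prod_mul_distrib]

lemma pk_star (F : Fin n → Matrix (Idx t (Fin 2)) (Idx t (Fin 2)) ℂ) :
    (pk F)ᴴ = pk (fun q => (F q)ᴴ) := by
  ext x z
  rw [Matrix.conjTranspose_apply, pk_apply, pk_apply, star_prod]
  rfl

lemma pk_smul (c : Fin n → ℂ) (F : Fin n → Matrix (Idx t (Fin 2)) (Idx t (Fin 2)) ℂ) :
    pk (fun q => c q • F q) = (∏ q, c q) • pk F := by
  ext x z
  rw [Matrix.smul_apply, pk_apply, pk_apply, smul_eq_mul, ← Finset.prod_mul_distrib]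
  rfl

/-- the rank-one overlap `|σ⟩⟨τ|` -/
def pr (σ τ : Equiv.Perm (Fin t)) : Matrix (Idx t (Fin 2)) (Idx t (Fin 2)) ℂ :=
  Matrix.of fun a b => if a.1 = a.2 ∘ σ ∧ b.1 = b.2 ∘ τ then ((2 : ℂ) ^ t)⁻¹ else 0

lemma pr_apply (σ τ : Equiv.Perm (Fin t)) (a b) :
    pr σ τ a b = if a.1 = a.2 ∘ σ ∧ b.1 = b.2 ∘ τ then ((2 : ℂ) ^ t)⁻¹ else 0 := rfl

/-- overlap of two permutation states of qubits -/
def gam (σ τ : Equiv.Perm (Fin t)) : ℝ :=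
  ((Finset.univ.filter fun f : Fin t → Fin 2 => f ∘ σ = f ∘ τ).card : ℝ) / 2 ^ t

lemma gam_nonneg (σ τ : Equiv.Perm (Fin t)) : 0 ≤ gam σ τ := by unfold gam; positivity

lemma gam_symm (σ τ : Equiv.Perm (Fin t)) : gam σ τ = gam τ σ := by
  unfold gam; simp only [eq_comm]

lemma gam_self (σ : Equiv.Perm (Fin t)) : gam σ σ = 1 := by
  unfold gam; simp

lemma pr_mul (σ τ σ' τ' : Equiv.Perm (Fin t)) : pr σ τ * pr σ' τ' = ((gam τ σ' : ℝ) : ℂ) • pr σ τ' := by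
  ext a b
  rw [Matrix.mul_apply, Matrix.smul_apply, pr_apply, Fintype.sum_prod_type, Finset.sum_comm]
  have : ∀ c2 c1 : Fin t → Fin 2, pr σ τ a (c1, c2) * pr σ' τ' (c1, c2) b
      = if c1 = c2 ∘ τ then (if c2 ∘ τ = c2 ∘ σ' then
        (if a.1 = a.2 ∘ σ ∧ b.1 = b.2 ∘ τ' then ((2 : ℂ) ^ t)⁻¹ * ((2 : ℂ) ^ t)⁻¹ else 0) else 0) else 0 := by
    intro c2 c1
    rw [pr_apply, pr_apply]
    by_cases h1 : c1 = c2 ∘ τ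
    · subst h1
      by_cases h2 : c2 ∘ τ = c2 ∘ σ' <;> by_cases h3 : a.1 = a.2 ∘ σ <;>
        by_cases h4 : b.1 = b.2 ∘ τ' <;> simp [h2, h3, h4]
    · simp [h1]
  simp only [this, Finset.sum_ite_eq', Finset.mem_univ, if_true]
  rw [← Finset.sum_filter, Finset.sum_const, nsmul_eq_mul, smul_eq_mul]
  unfold gam
  split_ifs
  · push_cast; ring
  · simp

lemma pr_star (σ τ : Equiv.Perm (Fin t)) : (pr σ τ)ᴴ = pr τ σ := by
  ext a b
  rw [Matrix.conjTranspose_apply, pr_apply, pr_apply]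
  simp only [and_comm]
  split_ifs <;> simp

/-- the projector onto the permutation state `σ` on the qubits `S` -/
def PS (σ : Equiv.Perm (Fin t)) (S : Finset (Fin n)) : Matrix (Idx t (Q n)) (Idx t (Q n)) ℂ :=
  pk fun q => if q ∈ S then pr σ σ else 1

lemma PS_star (σ : Equiv.Perm (Fin t)) (S : Finset (Fin n)) : (PS σ S)ᴴ = PS σ S := by
  unfold PS
  rw [pk_star]
  refine congrArg pk (funext fun q => ?_)
  split_ifs
  · exact pr_star σ σ
  · simp

lemma PS_mul_same (σ : Equiv.Perm (Fin t)) (S T : Finset (Fin n)) : PS σ S * PS σ T = PS σ (S ∪ T) := by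
  unfold PS
  rw [pk_mul]
  refine congrArg pk (funext fun q => ?_)
  by_cases h1 : q ∈ S <;> by_cases h2 : q ∈ T <;> simp [h1, h2, pr_mul, gam_self]

lemma PS_comm (σ τ : Equiv.Perm (Fin t)) {S T : Finset (Fin n)} (h : Disjoint S T) :
    PS σ S * PS τ T = PS τ T * PS σ S := by
  unfold PS
  rw [pk_mul, pk_mul]
  refine congrArg pk (funext fun q => ?_)
  by_cases h1 : q ∈ S
  · have h2 : q ∉ T := Finset.disjoint_left.1 h h1
    simp [h1, h2]
  · simp [h1]

lemma PS_sandwich (σ τ : Equiv.Perm (Fin t)) (S : Finset (Fin n)) :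
    PS σ S * PS τ S * PS σ S = (((gam σ τ ^ S.card) ^ 2 : ℝ) : ℂ) • PS σ S := by
  have e : (((gam σ τ ^ S.card) ^ 2 : ℝ) : ℂ) = ∏ q : Fin n, if q ∈ S then ((gam σ τ : ℝ) : ℂ) ^ 2 else 1 := by
    rw [Finset.prod_ite_mem, Finset.univ_inter, Finset.prod_const]
    push_cast; ring
  rw [e]
  unfold PS
  rw [← pk_smul, pk_mul, pk_mul]
  refine congrArg pk (funext fun q => ?_)
  by_cases h1 : q ∈ S
  · simp only [h1, if_true, pr_mul, Matrix.smul_mul, smul_smul, gam_symm τ σ, sq]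
  · simp [h1]

lemma PS_apply (σ : Equiv.Perm (Fin t)) (S : Finset (Fin n)) (x y : Idx t (Q n)) :
    PS σ S x y = if (∀ q, q ∉ S → ∀ s, x.1 s q = y.1 s q ∧ x.2 s q = y.2 s q) ∧
      (∀ q ∈ S, ∀ s, x.1 s q = x.2 (σ s) q) ∧ (∀ q ∈ S, ∀ s, y.1 s q = y.2 (σ s) q)
      then (((2 : ℂ) ^ t)⁻¹) ^ S.card else 0 := by
  unfold PS
  rw [pk_apply]
  have h : ∀ q : Fin n, (if q ∈ S then pr σ σ else 1) (colE n t x q) (colE n t y q)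
      = if (q ∉ S → ∀ s, x.1 s q = y.1 s q ∧ x.2 s q = y.2 s q) ∧
      (q ∈ S → (∀ s, x.1 s q = x.2 (σ s) q) ∧ (∀ s, y.1 s q = y.2 (σ s) q)) then
        (if q ∈ S then ((2 : ℂ) ^ t)⁻¹ else 1) else 0 := by
    intro q
    by_cases hq : q ∈ S
    · simp only [hq, if_true, pr_apply, colE, Equiv.coe_fn_mk, funext_iff, Function.comp]
      simp
    · simp only [hq, if_false, Matrix.one_apply, colE, Equiv.coe_fn_mk, Prod.mk.injEq, funext_iff]
      simp [forall_and]
  simp only [h]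
  have e2 : (∏ q : Fin n, if q ∈ S then ((2 : ℂ) ^ t)⁻¹ else 1) = (((2 : ℂ) ^ t)⁻¹) ^ S.card := by
    rw [Finset.prod_ite_mem, Finset.univ_inter, Finset.prod_const]
  by_cases H : ∀ q, (q ∉ S → ∀ s, x.1 s q = y.1 s q ∧ x.2 s q = y.2 s q) ∧
      (q ∈ S → (∀ s, x.1 s q = x.2 (σ s) q) ∧ (∀ s, y.1 s q = y.2 (σ s) q))
  · rw [if_pos ⟨fun q => (H q).1, fun q hq => ((H q).2 hq).1, fun q hq => ((H q).2 hq).2⟩, ← e2]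
    exact Finset.prod_congr rfl fun q _ => if_pos (H q)
  · rw [if_neg (fun h => H fun q => ⟨h.1 q, fun hq => ⟨h.2.1 q hq, h.2.2 q hq⟩⟩)]
    obtain ⟨q, hq⟩ := not_forall.1 H
    exact Finset.prod_eq_zero (Finset.mem_univ q) (if_neg hq)

lemma PS_sym (σ : Equiv.Perm (Fin t)) (S : Finset (Fin n)) (x y : HS t (Q n)) :
    inner ℂ (op (PS σ S) x) y = inner ℂ x (op (PS σ S) y) := by
  rw [op_adj, PS_star]

lemma PS_idem (σ : Equiv.Perm (Fin t)) (S : Finset (Fin n)) (x : HS t (Q n)) :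
    op (PS σ S) (op (PS σ S) x) = op (PS σ S) x := by
  rw [← op_mul_apply, PS_mul_same, Finset.union_self]

lemma PS_overlap (σ τ : Equiv.Perm (Fin t)) {S T B : Finset (Fin n)} (hS : B ⊆ S) (hT : B ⊆ T)
    (x y : HS t (Q n)) : ‖inner ℂ (op (PS σ S) x) (op (PS τ T) y)‖
      ≤ gam σ τ ^ B.card * (‖op (PS σ S) x‖ * ‖op (PS τ T) y‖) := by
  have h1 : op (PS σ B) (op (PS σ S) x) = op (PS σ S) x := by
    rw [← op_mul_apply, PS_mul_same, Finset.union_eq_right.2 hS]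
  have h2 : op (PS τ B) (op (PS τ T) y) = op (PS τ T) y := by
    rw [← op_mul_apply, PS_mul_same, Finset.union_eq_right.2 hT]
  set a := op (PS σ S) x
  set b := op (PS τ T) y
  have hb : ‖op (PS σ B) b‖ ≤ gam σ τ ^ B.card * ‖b‖ := by
    refine abs_le_of_sq_le_sq' ?_ (by have := gam_nonneg σ τ; positivity) |>.2
    have : (‖op (PS σ B) b‖ : ℝ) ^ 2 = (gam σ τ ^ B.card) ^ 2 * ‖b‖ ^ 2 := by
      have e1 : inner ℂ (op (PS σ B) b) (op (PS σ B) b) = (((gam σ τ ^ B.card) ^ 2 : ℝ) : ℂ) * inner ℂ b b := by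
        rw [PS_sym, PS_idem]
        conv_lhs => rw [← h2]
        rw [PS_sym, ← op_mul_apply, ← op_mul_apply, PS_sandwich, op_smul,
          gam_symm τ σ, _root_.smul_apply, inner_smul_right, h2]
      rw [inner_self_eq_norm_sq_to_K, inner_self_eq_norm_sq_to_K] at e1
      have e2 := congrArg Complex.re e1
      rw [Complex.re_ofReal_mul] at e2
      rw [← Complex.ofReal_re (‖op (PS σ B) b‖ ^ 2), ← Complex.ofReal_re (‖b‖ ^ 2)]
      push_cast at e2 ⊢
      exact e2
    rw [this, mul_pow]
  rw [← h1, PS_sym]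
  calc _ ≤ ‖a‖ * ‖op (PS σ B) b‖ := norm_inner_le_norm _ _
    _ ≤ ‖a‖ * (gam σ τ ^ B.card * ‖b‖) := by gcongr
    _ = _ := by rw [h1]; ring

end pkron
end TPE

namespace TPE

section ranPS
variable {n t : ℕ}

lemma RR_PS_one {S : Finset (Fin n)} {A B : MQ n} (hA : A ∈ Loc S) (hB : B ∈ Loc S) (hAB : A * Bᵀ = 1)
    (x1 x2 z1 z2 : Q n) :
    ∑ w : Q n, (if ∀ q, q ∉ S → w q = z2 q then A x1 (S.piecewise w z1) * B x2 w else 0)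
      = if (∀ q, q ∉ S → x1 q = z1 q ∧ x2 q = z2 q) ∧ (∀ q ∈ S, x1 q = x2 q) then 1 else 0 := by
  by_cases hx1 : ∀ q, q ∉ S → x1 q = z1 q
  swap
  · rw [if_neg (fun h => hx1 fun q hq => (h.1 q hq).1)]
    refine Finset.sum_eq_zero fun w _ => ?_
    have hA0 : A x1 (S.piecewise w z1) = 0 := by
      rw [Loc_apply hA x1 _ x1, if_neg]
      intro h
      apply hx1
      intro q hq
      have := h q hq
      rwa [Finset.piecewise_eq_of_notMem _ _ _ hq] at this
    rw [hA0, zero_mul, ite_self]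
  by_cases hx2 : ∀ q, q ∉ S → x2 q = z2 q
  swap
  · rw [if_neg (fun h => hx2 fun q hq => (h.1 q hq).2)]
    refine Finset.sum_eq_zero fun w _ => ?_
    split_ifs with hw
    · rw [Loc_apply hB x2 w x1, if_neg, mul_zero]
      intro h
      exact hx2 fun q hq => (h q hq).trans (hw q hq)
    · rfl
  have e : ∀ w : Q n, (if ∀ q, q ∉ S → w q = z2 q then A x1 (S.piecewise w z1) * B x2 w else 0)
      = A (S.piecewise x1 x2) w * B x2 w := by
    intro w
    split_ifs with hw
    · have h1 := Loc_glue hA (x := x1) (y := S.piecewise w z1) (fun q hq => by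
        rw [Finset.piecewise_eq_of_notMem _ _ _ hq, hx1 q hq]) x2
      rw [← h1]
      congr 2
      funext q
      by_cases hq : q ∈ S
      · simp [hq]
      · simp [hq, hx2 q hq, hw q hq]
    · have : ∃ q, q ∉ S ∧ w q ≠ z2 q := by push Not at hw; exact hw
      obtain ⟨q, hq, hne⟩ := this
      rw [Loc_zero hB hq (fun h => hne (by rw [← h, hx2 q hq])), mul_zero]
  rw [Finset.sum_congr rfl fun w _ => e w]
  have h2 := congrFun (congrFun hAB (S.piecewise x1 x2)) x2
  rw [Matrix.mul_apply, Matrix.one_apply] at h2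
  simp only [Matrix.transpose_apply] at h2
  rw [h2]
  refine if_congr ?_ rfl rfl
  constructor
  · intro h
    refine ⟨fun q hq => ⟨hx1 q hq, hx2 q hq⟩, fun q hq => ?_⟩
    have := congrFun h q
    rwa [Finset.piecewise_eq_of_mem _ _ _ hq] at this
  · rintro ⟨_, h⟩
    funext q
    by_cases hq : q ∈ S
    · rw [Finset.piecewise_eq_of_mem _ _ _ hq, h q hq]
    · rw [Finset.piecewise_eq_of_notMem _ _ _ hq]

lemma RR_PS {S : Finset (Fin n)} {A B : MQ n} (hA : A ∈ Loc S) (hB : B ∈ Loc S) (hAB : A * Bᵀ = 1)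
    (σ : Equiv.Perm (Fin t)) : RR t A B * PS σ S = PS σ S := by
  ext x z
  rw [Matrix.mul_apply, PS_apply]
  by_cases hz : ∀ q ∈ S, ∀ s, z.1 s q = z.2 (σ s) q
  swap
  · rw [if_neg (fun h => hz h.2.2)]
    refine Finset.sum_eq_zero fun y _ => ?_
    rw [PS_apply, if_neg (fun h => hz h.2.2), mul_zero]
  set c : ℂ := (((2 : ℂ) ^ t)⁻¹) ^ S.card
  have e : ∀ y2 y1 : Fin t → Q n, RR t A B x (y1, y2) * PS σ S (y1, y2) z
      = if y1 = (fun s => S.piecewise (y2 (σ s)) (z.1 s)) then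
        c * (∏ s, if ∀ q, q ∉ S → y2 s q = z.2 s q then
          A (x.1 (σ.symm s)) (S.piecewise (y2 s) (z.1 (σ.symm s))) * B (x.2 s) (y2 s) else 0) else 0 := by
    intro y2 y1
    rw [PS_apply]
    split_ifs with h1 h2 h2
    · have e1 : (∏ s, if ∀ q, q ∉ S → y2 s q = z.2 s q then
          A (x.1 (σ.symm s)) (S.piecewise (y2 s) (z.1 (σ.symm s))) * B (x.2 s) (y2 s) else 0)
          = ∏ s, A (x.1 (σ.symm s)) (S.piecewise (y2 s) (z.1 (σ.symm s))) * B (x.2 s) (y2 s) :=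
        Finset.prod_congr rfl fun s _ => if_pos fun q hq => (h1.1 q hq s).2
      rw [e1, Finset.prod_mul_distrib]
      have e2 : ∏ s, A (x.1 (σ.symm s)) (S.piecewise (y2 s) (z.1 (σ.symm s)))
          = ∏ s, A (x.1 s) (S.piecewise (y2 (σ s)) (z.1 s)) := by
        rw [← Equiv.prod_comp σ]
        simp
      rw [e2, h2]
      unfold RR
      ring
    · exfalso
      apply h2
      funext s q
      by_cases hq : q ∈ S
      · rw [Finset.piecewise_eq_of_mem _ _ _ hq]; exact h1.2.1 q hq s
      · rw [Finset.piecewise_eq_of_notMem _ _ _ hq]; exact (h1.1 q hq s).1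
    · have : ∃ s q, q ∉ S ∧ y2 s q ≠ z.2 s q := by
        by_contra hcon
        push Not at hcon
        apply h1
        refine ⟨fun q hq s => ⟨?_, hcon s q hq⟩, fun q hq s => ?_, hz⟩
        · rw [h2]; simp [hq]
        · rw [h2]; simp [hq]
      obtain ⟨s, q, hq, hne⟩ := this
      rw [Finset.prod_eq_zero (Finset.mem_univ s), mul_zero, mul_zero]
      rw [if_neg]
      intro h
      exact hne (h q hq)
    · rw [mul_zero]
  rw [Fintype.sum_prod_type, Finset.sum_comm]
  simp only [e, Finset.sum_ite_eq', Finset.mem_univ, if_true]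
  rw [← Finset.mul_sum]
  have e3 := Finset.prod_univ_sum (fun _ : Fin t => (Finset.univ : Finset (Q n)))
    (fun s w => if ∀ q, q ∉ S → w q = z.2 s q then
          A (x.1 (σ.symm s)) (S.piecewise w (z.1 (σ.symm s))) * B (x.2 s) w else 0)
  rw [Fintype.piFinset_univ] at e3
  rw [← e3]
  simp only [RR_PS_one hA hB hAB]
  by_cases H : ∀ s, (∀ q, q ∉ S → x.1 (σ.symm s) q = z.1 (σ.symm s) q ∧ x.2 s q = z.2 s q) ∧
      (∀ q ∈ S, x.1 (σ.symm s) q = x.2 s q)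
  · rw [Finset.prod_congr rfl fun s _ => if_pos (H s), Finset.prod_const_one, mul_one, if_pos]
    refine ⟨fun q hq s => ⟨?_, ((H s).1 q hq).2⟩, fun q hq s => ?_, hz⟩
    · have := ((H (σ s)).1 q hq).1
      simpa using this
    · have := (H (σ s)).2 q hq
      simpa using this
  · rw [if_neg]
    · obtain ⟨s, hs⟩ := not_forall.1 H
      rw [Finset.prod_eq_zero (Finset.mem_univ s) (if_neg hs), mul_zero]
    · rintro ⟨h1, h2, _⟩
      apply H
      intro s
      refine ⟨fun q hq => ⟨(h1 q hq _).1, (h1 q hq s).2⟩, fun q hq => ?_⟩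
      rw [h2 q hq]; simp

lemma Loc_transpose {S : Finset (Fin n)} {X : MQ n} (h : X ∈ Loc S) : Xᵀ ∈ Loc S := by
  refine mem_Loc_of ?_ ?_
  · intro q hq x y hxy
    exact Loc_zero h hq (Ne.symm hxy)
  · intro q hq x y hxy j
    exact Loc_update h hq hxy.symm j

lemma PS_fixed {S : Finset (Fin n)} (σ : Equiv.Perm (Fin t)) (v : HS t (Q n)) (U : MQ n)
    (hU : U ∈ Matrix.unitaryGroup (Q n) ℂ) (hL : U ∈ Loc S) :
    op (momentMat t U) (op (PS σ S) v) = op (PS σ S) v := by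
  rw [← op_mul_apply, momentMat_eq, RR_PS hL]
  · have : cj U = (Uᴴ)ᵀ := by rw [← cj_transpose, Matrix.transpose_transpose]
    rw [this]
    exact Loc_transpose (Loc_star hL)
  · rw [cj_transpose]
    exact Matrix.mem_unitaryGroup_iff.1 hU

lemma PS_ran {S : Finset (Fin n)} (σ : Equiv.Perm (Fin t)) (v : HS t (Q n)) : op (PS σ S) v ∈ VS t S := by
  intro X hX
  refine dmom_of_fixed X _ fun z => ?_
  have h1 : (z : ℂ) • X ∈ Loc S := Subalgebra.smul_mem _ hX _
  rw [← op_mul_apply, RR_PS (Loc_exp h1)]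
  · exact Loc_transpose (Loc_exp (neg_mem h1))
  · rw [Matrix.transpose_transpose, ← Matrix.exp_add_of_commute _ _ (Commute.neg_right (Commute.refl ((z : ℂ) • X)))]
    simp

/-- gluing a configuration on `S` with one outside -/
def glu (S : Finset (Fin n)) (a : S → Fin 2) (z : Q n) : Q n := fun q => if h : q ∈ S then a ⟨q, h⟩ else z q

lemma glu_in {S : Finset (Fin n)} (a : S → Fin 2) (z : Q n) (q : S) : glu S a z q = a q := by
  unfold glu; rw [dif_pos q.2]

lemma glu_out {S : Finset (Fin n)} (a : S → Fin 2) (z : Q n) {q : Fin n} (h : q ∉ S) : glu S a z q = z q := by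
  unfold glu; rw [dif_neg h]

lemma glu_inj {S : Finset (Fin n)} {a b : S → Fin 2} {z : Q n} (h : glu S a z = glu S b z) : a = b := by
  funext q
  rw [← glu_in a z q, h, glu_in]

/-- matrix units on `S` -/
def un (S : Finset (Fin n)) (a b : S → Fin 2) : MQ n :=
  Matrix.of fun x y => if (x = glu S a y ∧ y = glu S b x) then 1 else 0

lemma un_apply (S : Finset (Fin n)) (a b : S → Fin 2) (x y) :
  un S a b x y = if (x = glu S a y ∧ y = glu S b x) then 1 else 0 := rfl

lemma un_iff {S : Finset (Fin n)} (a b c : S → Fin 2) (z y : Q n) :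
    (glu S c z = glu S a y ∧ y = glu S b (glu S c z)) ↔ c = a ∧ y = glu S b z := by
  constructor
  · rintro ⟨h1, h2⟩
    refine ⟨?_, ?_⟩
    · funext q; rw [← glu_in c z q, h1, glu_in]
    · rw [h2]
      funext q
      by_cases hq : q ∈ S
      · simp [glu, hq]
      · simp [glu, hq]
  · rintro ⟨rfl, rfl⟩
    constructor <;>
    · funext q
      by_cases hq : q ∈ S
      · simp [glu, hq]
      · simp [glu, hq]

lemma un_iff' {S : Finset (Fin n)} (a b c : S → Fin 2) (z x : Q n) :
    (x = glu S a (glu S c z) ∧ glu S c z = glu S b x) ↔ c = b ∧ x = glu S a z := by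
  rw [and_comm, un_iff]

lemma un_mem (S : Finset (Fin n)) (a b : S → Fin 2) : un S a b ∈ Loc S := by
  refine mem_Loc_of ?_ ?_
  · intro q hq x y hxy
    rw [un_apply, if_neg]
    rintro ⟨h, _⟩
    apply hxy
    rw [h, glu_out _ _ hq]
  · intro q hq x y hxy j
    rw [un_apply, un_apply]
    refine if_congr ?_ rfl rfl
    have key : ∀ (c : S → Fin 2) (u v : Q n), u q = v q → ((Function.update u q j = glu S c (Function.update v q j)) ↔ u = glu S c v) := by
      intro c u v huv
      constructor
      · intro h
        funext r
        by_cases hr : r = q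
        · subst hr; rw [glu_out _ _ hq, huv]
        · have := congrFun h r
          rw [Function.update_of_ne hr] at this
          rw [this]
          by_cases hrS : r ∈ S
          · simp [glu, hrS]
          · simp [glu, hrS, Function.update_of_ne hr]
      · intro h
        funext r
        by_cases hr : r = q
        · subst hr; rw [glu_out _ _ hq]; simp
        · rw [Function.update_of_ne hr, h]
          by_cases hrS : r ∈ S
          · simp [glu, hrS]
          · simp [glu, hrS, Function.update_of_ne hr]
    rw [key a x y hxy, key b y x hxy.symm]

lemma VS_rel {S : Finset (Fin n)} {v : HS t (Q n)} (hv : v ∈ VS t S) (z : Idx t (Q n)) :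
    Rel (fun x y : Fin t → (S → Fin 2) => v (fun s => glu S (x s) (z.1 s), fun s => glu S (y s) (z.2 s))) := by
  intro a b x y
  have h := congrArg (fun w : HS t (Q n) => w (fun s => glu S (x s) (z.1 s), fun s => glu S (y s) (z.2 s)))
    (hv (un S a b) (un_mem S a b))
  simp only [dmom_op_apply] at h
  have h' := sub_eq_zero.1 h
  simp only [un_apply, un_iff, un_iff', ite_mul, one_mul, zero_mul, ite_and] at h'
  have c1 : ∀ (x : Fin t → (S → Fin 2)) (w : Fin t → Q n) (s : Fin t) (d : S → Fin 2),
      Function.update (fun s => glu S (x s) (w s)) s (glu S d (w s))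
      = fun r => glu S (Function.update x s d r) (w r) := by
    intro x w s d
    funext r
    by_cases hr : r = s
    · subst hr; simp
    · simp [Function.update_of_ne hr]
  simp only [Finset.sum_ite_irrel, Finset.sum_ite_eq', Finset.mem_univ, if_true, Finset.sum_const_zero, c1] at h'
  exact h'

lemma PS_inj {S : Finset (Fin n)} (hc : 2 * t ≤ 2 ^ S.card) {v : HS t (Q n)} (hv : v ∈ VS t S)
    (h0 : ∀ σ : Equiv.Perm (Fin t), op (PS σ S) v = 0) : v = 0 := by
  ext z
  set w : (Fin t → (S → Fin 2)) → (Fin t → (S → Fin 2)) → ℂ :=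
    fun x y => v (fun s => glu S (x s) (z.1 s), fun s => glu S (y s) (z.2 s)) with hw
  obtain ⟨c, hcw⟩ := schur_weyl (ξ := S → Fin 2) (by simpa using hc) (VS_rel hv z)
  have hps : ∀ σ : Equiv.Perm (Fin t), ∑ p : (Fin t → (S → Fin 2)) × (Fin t → (S → Fin 2)),
      psi σ p.1 p.2 * w p.1 p.2 = 0 := by
    intro σ
    set d : ℂ := (((2 : ℂ) ^ t)⁻¹) ^ S.card with hd
    have hd0 : d ≠ 0 := by positivity
    have h1 := congrArg (fun u : HS t (Q n) => u (fun s => glu S 0 (z.1 s), fun s => glu S 0 (z.2 s))) (h0 σ)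
    simp only [op_apply] at h1
    have h2 : d * ∑ p : (Fin t → (S → Fin 2)) × (Fin t → (S → Fin 2)), psi σ p.1 p.2 * w p.1 p.2 = 0 := by
      rw [Finset.mul_sum]
      refine Eq.trans ?_ h1
      refine Finset.sum_of_injOn
        (fun p : (Fin t → (S → Fin 2)) × (Fin t → (S → Fin 2)) =>
          ((fun s => glu S (p.1 s) (z.1 s), fun s => glu S (p.2 s) (z.2 s)) : Idx t (Q n))) ?_ ?_ ?_ ?_
      · rintro ⟨a, b⟩ _ ⟨a', b'⟩ _ h
        simp only [Prod.mk.injEq] at h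
        refine Prod.ext ?_ ?_
        · funext s; exact glu_inj (congrFun h.1 s)
        · funext s; exact glu_inj (congrFun h.2 s)
      · intro p _; simp
      · intro y _ hy
        rw [PS_apply, if_neg, zero_mul]
        rintro ⟨h1, -, -⟩
        apply hy
        refine ⟨(fun s q => y.1 s q, fun s q => y.2 s q), by simp, ?_⟩
        refine Prod.ext ?_ ?_
        · funext s q
          by_cases hq : q ∈ S
          · simp [glu, hq]
          · have := (h1 q hq s).1
            simp only [glu_out _ _ hq] at this ⊢
            exact this
        · funext s q
          by_cases hq : q ∈ S
          · simp [glu, hq]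
          · have := (h1 q hq s).2
            simp only [glu_out _ _ hq] at this ⊢
            exact this
      · rintro ⟨a, b⟩ _
        rw [PS_apply]
        simp only [psi]
        have hiff : ((∀ q, q ∉ S → ∀ s, glu S 0 (z.1 s) q = glu S (a s) (z.1 s) q ∧ glu S 0 (z.2 s) q = glu S (b s) (z.2 s) q) ∧
          (∀ q ∈ S, ∀ s, glu S 0 (z.1 s) q = glu S 0 (z.2 (σ s)) q) ∧
          (∀ q ∈ S, ∀ s, glu S (a s) (z.1 s) q = glu S (b (σ s)) (z.2 (σ s)) q)) ↔ a = b ∘ σ := by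
          constructor
          · rintro ⟨-, -, h⟩
            funext s q
            have := h q q.2 s
            rw [glu_in, glu_in] at this
            exact this
          · rintro rfl
            refine ⟨fun q hq s => ?_, fun q hq s => ?_, fun q hq s => ?_⟩
            · simp [glu_out _ _ hq]
            · simp [glu, hq]
            · simp [glu, hq]
        simp only [hiff]
        split_ifs
        · simp [hd, hw]
        · simp
    exact (mul_eq_zero.1 h2).resolve_left hd0
  have hz : ∑ p : (Fin t → (S → Fin 2)) × (Fin t → (S → Fin 2)), (starRingEnd ℂ) (w p.1 p.2) * w p.1 p.2 = 0 := by
    have : ∀ p : (Fin t → (S → Fin 2)) × (Fin t → (S → Fin 2)), (starRingEnd ℂ) (w p.1 p.2) * w p.1 p.2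
        = ∑ σ, (starRingEnd ℂ) (c σ) * (psi σ p.1 p.2 * w p.1 p.2) := by
      intro p
      have : (starRingEnd ℂ) (w p.1 p.2) = ∑ σ, (starRingEnd ℂ) (c σ) * psi σ p.1 p.2 := by
        rw [show w p.1 p.2 = _ from hcw p.1 p.2, map_sum]
        refine Finset.sum_congr rfl fun σ _ => ?_
        rw [map_mul]
        congr 1
        unfold psi
        split_ifs <;> simp
      rw [this, Finset.sum_mul]
      exact Finset.sum_congr rfl fun σ _ => by ring
    rw [Finset.sum_congr rfl fun p _ => this p, Finset.sum_comm]
    refine Finset.sum_eq_zero fun σ _ => ?_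
    rw [← Finset.mul_sum, hps σ, mul_zero]
  have hz2 : ∑ p : (Fin t → (S → Fin 2)) × (Fin t → (S → Fin 2)), ‖w p.1 p.2‖ ^ 2 = 0 := by
    have := congrArg Complex.re hz
    rw [Complex.re_sum] at this
    rw [← Complex.zero_re, ← this]
    refine Finset.sum_congr rfl fun p _ => ?_
    rw [Complex.conj_mul']
    norm_cast
  have hall := (Finset.sum_eq_zero_iff_of_nonneg (fun p _ => by positivity)).1 hz2
  have := hall (fun s q => z.1 s q, fun s q => z.2 s q) (Finset.mem_univ _)
  have h3 : w (fun s q => z.1 s q) (fun s q => z.2 s q) = v z := by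
    rw [hw]
    refine congrArg (fun i => v i) ?_
    refine Prod.ext ?_ ?_ <;>
    · funext s q
      by_cases hq : q ∈ S <;> simp [glu, hq]
  simp only [h3] at this
  simpa using this

/-- infinitesimally invariant vectors are invariant -/
lemma VS_fixed {S : Finset (Fin n)} (hc : 2 * t ≤ 2 ^ S.card) {v : HS t (Q n)} (hv : v ∈ VS t S) (U : MQ n)
    (hU : U ∈ Matrix.unitaryGroup (Q n) ℂ) (hL : U ∈ Loc S) : op (momentMat t U) v = v := by
  let W : Submodule ℂ (HS t (Q n)) := VS t S ⊓
    LinearMap.ker ((op (momentMat t U) - 1 : HS t (Q n) →L[ℂ] HS t (Q n)) : HS t (Q n) →ₗ[ℂ] HS t (Q n))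
  have hW : ∀ u, u ∈ W ↔ u ∈ VS t S ∧ op (momentMat t U) u = u := by
    intro u
    simp only [W, Submodule.mem_inf, LinearMap.mem_ker, ContinuousLinearMap.coe_coe, _root_.sub_apply,
      one_apply_eq_self, sub_eq_zero]
  have hp : W.starProjection v ∈ W := Submodule.starProjection_apply_mem _ _
  have h1 : v - W.starProjection v = 0 := by
    refine PS_inj hc (Submodule.sub_mem _ hv ((hW _).1 hp).1) fun σ => ?_
    have hin : op (PS σ S) (v - W.starProjection v) ∈ W := (hW _).2 ⟨PS_ran σ _, PS_fixed σ _ U hU hL⟩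
    have ho : v - W.starProjection v ∈ Wᗮ := Submodule.sub_starProjection_mem_orthogonal v
    have := ho _ hin
    rw [PS_sym] at this
    have h2 : inner ℂ (op (PS σ S) (v - W.starProjection v)) (op (PS σ S) (v - W.starProjection v)) = 0 := by
      rw [← PS_sym, PS_idem, PS_sym]; exact this
    exact inner_self_eq_zero.1 h2
  have h2 : v = W.starProjection v := sub_eq_zero.1 h1
  rw [h2]
  exact ((hW _).1 hp).2

end ranPS
end TPE

namespace TPE

section count

lemma perm_count (κ : Type*) [Fintype κ] (t : ℕ) :
    ∑ π : Equiv.Perm (Fin t), ∑ F : Fin t → κ, (if F ∘ π = F then 1 else 0 : ℕ)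
      = ∏ i ∈ Finset.range t, (Fintype.card κ + i) := by
  induction t with
  | zero => simp
  | succ t ih =>
    rw [Finset.prod_range_succ, ← ih, ← (Equiv.Perm.decomposeFin (n := t)).symm.sum_comp,
      Fintype.sum_prod_type, Finset.sum_comm, Finset.sum_mul]
    refine Finset.sum_congr rfl fun e _ => ?_
    have hiff : ∀ (p : Fin (t + 1)) (a : κ) (G : Fin t → κ),
        ((Fin.cons a G : Fin (t + 1) → κ) ∘ (Equiv.Perm.decomposeFin.symm (p, e)) = Fin.cons a G)
        ↔ (Fin.cons a G : Fin (t + 1) → κ) p = a ∧ G ∘ e = G := by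
      intro p a G
      set F : Fin (t + 1) → κ := Fin.cons a G with hF
      have hF0 : F 0 = a := rfl
      have hFs : ∀ x : Fin t, F x.succ = G x := fun x => rfl
      have hsw : F p = a → ∀ y, F (Equiv.swap 0 p y) = F y := by
        intro hp y
        by_cases h0 : y = 0
        · subst h0; rw [Equiv.swap_apply_left, hp, hF0]
        · by_cases h1 : y = p
          · subst h1; rw [Equiv.swap_apply_right, hp, hF0]
          · rw [Equiv.swap_apply_of_ne_of_ne h0 h1]
      constructor
      · intro h
        have hp : F p = a := by
          have := congrFun h 0
          rw [Function.comp, Equiv.Perm.decomposeFin_symm_apply_zero] at this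
          exact this
        refine ⟨hp, ?_⟩
        funext x
        have := congrFun h x.succ
        rw [Function.comp, Equiv.Perm.decomposeFin_symm_apply_succ, hsw hp] at this
        exact this
      · rintro ⟨hp, hG⟩
        funext y
        refine Fin.cases ?_ (fun x => ?_) y
        · rw [Function.comp, Equiv.Perm.decomposeFin_symm_apply_zero, hp, hF0]
        · rw [Function.comp, Equiv.Perm.decomposeFin_symm_apply_succ, hsw hp]
          exact congrFun hG x
    have hsum : ∀ p : Fin (t + 1), (∑ F : Fin (t + 1) → κ,
        (if F ∘ (Equiv.Perm.decomposeFin.symm (p, e)) = F then 1 else 0 : ℕ))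
        = ∑ a : κ, ∑ G : Fin t → κ, if (Fin.cons a G : Fin (t + 1) → κ) p = a ∧ G ∘ e = G then 1 else 0 := by
      intro p
      rw [← (Fin.consEquiv (fun _ : Fin (t + 1) => κ)).sum_comp, Fintype.sum_prod_type]
      refine Finset.sum_congr rfl fun a _ => Finset.sum_congr rfl fun G _ => ?_
      refine if_congr ?_ rfl rfl
      exact hiff p a G
    rw [Finset.sum_congr rfl fun p _ => hsum p, Fin.sum_univ_succ]
    simp only [Fin.cons_zero, true_and, Fin.cons_succ]
    rw [Finset.sum_const, Finset.card_univ, smul_eq_mul, mul_add, mul_comm]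
    congr 1
    have : ∀ x : Fin t, (∑ a : κ, ∑ G : Fin t → κ, if G x = a ∧ G ∘ e = G then 1 else 0 : ℕ)
        = ∑ F : Fin t → κ, if F ∘ e = F then 1 else 0 := by
      intro x
      rw [Finset.sum_comm]
      refine Finset.sum_congr rfl fun G _ => ?_
      by_cases hG : G ∘ e = G <;> simp [hG]
    rw [Finset.sum_congr rfl fun x _ => this x, Finset.sum_const, Finset.card_univ, Fintype.card_fin,
      smul_eq_mul, mul_comm]

variable {t : ℕ}

lemma gam_pow (σ τ : Equiv.Perm (Fin t)) (s : ℕ) : gam σ τ ^ s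
    = ((∑ F : Fin t → (Fin s → Fin 2), if F ∘ (σ * τ⁻¹ : Equiv.Perm (Fin t)) = F then 1 else 0 : ℕ) : ℝ)
      / (2 ^ s) ^ t := by
  unfold gam
  rw [div_pow, ← pow_mul, ← pow_mul, mul_comm t s]
  congr 1
  rw [← Nat.cast_pow, ← Finset.card_filter]
  congr 1
  have h := Fintype.card_piFinset (fun _ : Fin s => (Finset.univ.filter fun f : Fin t → Fin 2 => f ∘ σ = f ∘ τ))
  rw [Finset.prod_const, Finset.card_univ, Fintype.card_fin] at h
  rw [← h]
  refine Finset.card_equiv (Equiv.piComm (fun _ _ => Fin 2)) ?_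
  intro F
  simp only [Fintype.mem_piFinset, Finset.mem_filter, Finset.mem_univ, true_and]
  constructor
  · intro h
    funext x q
    have := congrFun (h q) (τ⁻¹ x)
    have e : τ (τ⁻¹ x) = x := τ.apply_symm_apply x
    simp only [Function.comp, e] at this
    exact this
  · intro h q
    funext x
    have := congrFun (congrFun h (τ x)) q
    have e : τ⁻¹ (τ x) = x := τ.symm_apply_apply x
    simp only [Function.comp, Equiv.Perm.coe_mul, e] at this
    exact this

lemma gam_sum (σ : Equiv.Perm (Fin t)) (s : ℕ) : ∑ τ, gam σ τ ^ s
    = ∏ i ∈ Finset.range t, (1 + (i : ℝ) / 2 ^ s) := by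
  simp only [gam_pow]
  rw [← Finset.sum_div]
  have h1 := perm_count (Fin s → Fin 2) t
  have h2 : (∑ τ : Equiv.Perm (Fin t), ((∑ F : Fin t → (Fin s → Fin 2),
      if F ∘ (σ * τ⁻¹ : Equiv.Perm (Fin t)) = F then 1 else 0 : ℕ) : ℝ))
      = ∑ π : Equiv.Perm (Fin t), ((∑ F : Fin t → (Fin s → Fin 2), if F ∘ π = F then 1 else 0 : ℕ) : ℝ) := by
    refine Equiv.sum_comp ((Equiv.inv (Equiv.Perm (Fin t))).trans (Equiv.mulLeft σ))
      (fun π : Equiv.Perm (Fin t) => ((∑ F : Fin t → (Fin s → Fin 2), if F ∘ π = F then 1 else 0 : ℕ) : ℝ))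
  have h1' : (∑ π : Equiv.Perm (Fin t), (∑ F : Fin t → (Fin s → Fin 2), if F ∘ π = F then 1 else 0 : ℕ))
      = ∏ i ∈ Finset.range t, (Fintype.card (Fin s → Fin 2) + i) := by
    convert h1
  rw [h2, ← Nat.cast_sum, h1']
  rw [Nat.cast_prod, div_eq_iff (by positivity)]
  have h3 : ((2 : ℝ) ^ s) ^ t = ∏ _i ∈ Finset.range t, (2 : ℝ) ^ s := by simp
  rw [h3, ← Finset.prod_mul_distrib]
  refine Finset.prod_congr rfl fun i _ => ?_
  simp
  field_simp

lemma gam_bound (σ : Equiv.Perm (Fin t)) (s : ℕ) (ρ : ℝ) (hρ : 1 < ρ)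
    (h : ρ * (t : ℝ) ^ 2 ≤ 2 * 2 ^ s) : ∑ τ, gam σ τ ^ s - 1 ≤ 1 / (ρ - 1) := by
  rw [gam_sum]
  have h1 : ∏ i ∈ Finset.range t, (1 + (i : ℝ) / 2 ^ s) ≤ Real.exp (∑ i ∈ Finset.range t, (i : ℝ) / 2 ^ s) := by
    rw [Real.exp_sum]
    refine Finset.prod_le_prod (fun i _ => by positivity) fun i _ => ?_
    have := Real.add_one_le_exp ((i : ℝ) / 2 ^ s)
    linarith
  have h2 : ∑ i ∈ Finset.range t, (i : ℝ) / 2 ^ s ≤ 1 / ρ := by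
    rw [← Finset.sum_div, div_le_div_iff₀ (by positivity) (by positivity)]
    have h3 : (∑ i ∈ Finset.range t, (i : ℝ)) * 2 ≤ (t : ℝ) ^ 2 := by
      have := Finset.sum_range_id_mul_two t
      have h4 : t * (t - 1) ≤ t ^ 2 := by rw [sq]; exact Nat.mul_le_mul_left _ (Nat.sub_le _ _)
      rw [← this] at h4
      have h5 : (((∑ i ∈ Finset.range t, i) * 2 : ℕ) : ℝ) ≤ ((t ^ 2 : ℕ) : ℝ) := Nat.cast_le.2 h4
      rw [Nat.cast_mul, Nat.cast_sum, Nat.cast_pow] at h5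
      exact h5
    nlinarith
  have h5 : Real.exp (1 / ρ) ≤ 1 / (1 - 1 / ρ) := by
    have h6 := Real.add_one_le_exp (-(1 / ρ))
    have h7 : 1 / ρ < 1 := by rw [div_lt_one (by linarith)]; exact hρ
    rw [Real.exp_neg] at h6
    rw [le_div_iff₀ (by linarith)]
    have h8 := Real.exp_pos (1 / ρ)
    have h9 : Real.exp (1 / ρ) * (1 - 1 / ρ) ≤ Real.exp (1 / ρ) * (Real.exp (1 / ρ))⁻¹ := by
      apply mul_le_mul_of_nonneg_left _ h8.le
      linarith
    rwa [mul_inv_cancel₀ h8.ne'] at h9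
  have h10 : 1 / (1 - 1 / ρ) - 1 = 1 / (ρ - 1) := by
    have : ρ - 1 ≠ 0 := by linarith
    have : ρ ≠ 0 := by linarith
    field_simp
    ring
  have := Real.exp_le_exp.2 h2
  linarith

/-- overlap kernel -/
def ovk (s : ℕ) (σ τ : Equiv.Perm (Fin t)) : ℝ := if σ = τ then 0 else gam σ τ ^ s

lemma ovk_sum (σ : Equiv.Perm (Fin t)) (s : ℕ) : ∑ τ, ovk s σ τ = ∑ τ, gam σ τ ^ s - 1 := by
  have : ∀ τ, ovk s σ τ = gam σ τ ^ s - if σ = τ then 1 else 0 := by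
    intro τ
    unfold ovk
    split_ifs with h
    · subst h; simp [gam_self]
    · simp
  simp [this, Finset.sum_sub_distrib]

lemma ovk_symm (σ τ : Equiv.Perm (Fin t)) (s : ℕ) : ovk s σ τ = ovk s τ σ := by
  unfold ovk; rw [gam_symm]; simp only [eq_comm]

lemma ovk_prop (s : ℕ) (ρ : ℝ) (hρ : 1 < ρ) (h : ρ * (t : ℝ) ^ 2 ≤ 2 * 2 ^ s) :
    (∀ i j : Equiv.Perm (Fin t), 0 ≤ ovk s i j) ∧ (∀ i : Equiv.Perm (Fin t), ∑ j, ovk s i j ≤ 1 / (ρ - 1)) ∧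
      (∀ j : Equiv.Perm (Fin t), ∑ i, ovk s i j ≤ 1 / (ρ - 1)) := by
  refine ⟨fun i j => ?_, fun i => ?_, fun j => ?_⟩
  · unfold ovk
    split_ifs
    · exact le_rfl
    · exact pow_nonneg (gam_nonneg _ _) _
  · rw [ovk_sum]; exact gam_bound i s ρ hρ h
  · simp only [ovk_symm _ j]
    rw [ovk_sum]; exact gam_bound j s ρ hρ h

variable {n : ℕ}

lemma VS_ao (S : Finset (Fin n)) (hc : 2 * t ≤ 2 ^ S.card) (ρ : ℝ) (hρ : 1 < ρ)
    (h : ρ * (t : ℝ) ^ 2 ≤ 2 * 2 ^ S.card) :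
    AlmostOrth (fun σ : Equiv.Perm (Fin t) => op (PS σ S)) (VS t S) (1 / (ρ - 1)) where
  eps := by apply div_nonneg <;> linarith
  sym i x y := PS_sym i S x y
  idem i x := PS_idem i S x
  ran i x := PS_ran i x
  inj v hv h0 := PS_inj hc hv h0
  ov := by
    obtain ⟨h1, h2, h3⟩ := ovk_prop (t := t) S.card ρ hρ h
    refine ⟨ovk S.card, h1, h2, h3, fun i j hij x y => ?_⟩
    unfold ovk
    rw [if_neg hij]
    exact PS_overlap i j subset_rfl subset_rfl x y

/-- adjacent blocks -/
lemma VS_overlap {S T B : Finset (Fin n)} (hB : B ⊆ S) (hB' : B ⊆ T) (hBc : 4 * t ^ 2 ≤ 2 ^ B.card)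
    (hS : 8 * t ^ 2 ≤ 2 ^ S.card) (hT : 8 * t ^ 2 ≤ 2 ^ T.card) (x : HS t (Q n)) :
    ‖(VS t S).starProjection ((VS t T).starProjection x) - (VS t (S ∪ T)).starProjection x‖
      ≤ (9 / 25) * ‖x‖ := by
  have hST : 8 * t ^ 2 ≤ 2 ^ (S ∪ T).card :=
    hS.trans (Nat.pow_le_pow_right (by norm_num) (Finset.card_le_card Finset.subset_union_left))
  have ht : 2 * t ≤ 8 * t ^ 2 := by nlinarith [Nat.zero_le t]
  have key : ∀ A : Finset (Fin n), 8 * t ^ 2 ≤ 2 ^ A.card →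
      AlmostOrth (fun σ : Equiv.Perm (Fin t) => op (PS σ A)) (VS t A) (1 / ((16 : ℝ) - 1)) := by
    intro A hA
    refine VS_ao A (ht.trans hA) 16 (by norm_num) ?_
    have : (8 * (t : ℝ) ^ 2) ≤ 2 ^ A.card := by exact_mod_cast hA
    linarith
  obtain ⟨h1, h2, h3⟩ := ovk_prop (t := t) B.card 8 (by norm_num) (by
    have : (4 * (t : ℝ) ^ 2) ≤ 2 ^ B.card := by exact_mod_cast hBc
    linarith)
  have := AlmostOrth.overlap (key S hS) (key T hT) (key _ hST) (εB := 1 / ((8 : ℝ) - 1)) (by norm_num)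
    (fun i x => by rw [← op_mul_apply, PS_mul_same])
    ⟨ovk B.card, h1, h2, h3, fun i j hij x y => by
      unfold ovk
      rw [if_neg hij]
      exact PS_overlap i j hB hB' x y⟩ x
  refine this.trans ?_
  apply mul_le_mul_of_nonneg_right _ (norm_nonneg _)
  norm_num

lemma VS_commute {S T : Finset (Fin n)} (hd : Disjoint S T)
    (hS : 8 * t ^ 2 ≤ 2 ^ S.card) (hT : 8 * t ^ 2 ≤ 2 ^ T.card) (x : HS t (Q n)) :
    (VS t S).starProjection ((VS t T).starProjection x) = (VS t T).starProjection ((VS t S).starProjection x) := by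
  have ht : 2 * t ≤ 8 * t ^ 2 := by nlinarith [Nat.zero_le t]
  have key : ∀ A : Finset (Fin n), 8 * t ^ 2 ≤ 2 ^ A.card →
      AlmostOrth (fun σ : Equiv.Perm (Fin t) => op (PS σ A)) (VS t A) (1 / ((16 : ℝ) - 1)) := by
    intro A hA
    refine VS_ao A (ht.trans hA) 16 (by norm_num) ?_
    have : (8 * (t : ℝ) ^ 2) ≤ 2 ^ A.card := by exact_mod_cast hA
    linarith
  refine AlmostOrth.comm (key S hS) (key T hT) (fun i j x => ?_) x
  rw [← op_mul_apply, ← op_mul_apply, PS_comm i j hd]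

end count
end TPE

namespace TPE

section gap
variable {n t : ℕ}

lemma VS_anti {S T : Finset (Fin n)} (h : S ⊆ T) : VS t T ≤ VS t S := by
  intro v hv X hX
  exact hv X (Loc_mono h hX)

lemma VS_le_WE {S : Finset (Fin n)} (hc : 2 * t ≤ 2 ^ S.card) {e : ℕ} (he : e + 1 < n) (hS : eS he ⊆ S) :
    VS t S ≤ WE t n e := by
  intro v hv
  rw [mem_WE he]
  intro U
  exact VS_fixed hc hv _ (eG_unitary he U.2) (Loc_mono hS (eG_mem he _))

lemma VS_univ_le (hc : 2 * t ≤ 2 ^ n) : VS t (Finset.univ : Finset (Fin n)) ≤ VU t (Q n) := by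
  intro v hv U
  refine VS_fixed (by simpa using hc) hv _ U.2 ?_
  rw [mem_Loc]
  intro q hq
  exact absurd (Finset.mem_univ q) hq

lemma VU_le_WE (e : ℕ) : VU t (Q n) ≤ WE t n e := by
  by_cases he : e + 1 < n
  · intro v hv
    rw [mem_WE he]
    intro U
    exact hv ⟨_, eG_unitary he U.2⟩
  · rw [WE_top he]; exact le_top

lemma Iv_card (o L : ℕ) (h : o + L ≤ n) : (Iv n o L).card = L := by
  have : Finset.map Fin.valEmbedding (Iv n o L) = Finset.Ico o (o + L) := by
    ext i
    simp only [Finset.mem_map, mem_Iv, Fin.valEmbedding_apply, Finset.mem_Ico]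
    constructor
    · rintro ⟨q, hq, rfl⟩; exact hq
    · intro hi; exact ⟨⟨i, by omega⟩, hi, rfl⟩
  rw [← Finset.card_map Fin.valEmbedding, this]; simp

lemma local_gap' (o K : ℕ) (hn : o + K + 2 ≤ n) (hc : 2 * t ≤ 2 ^ (K + 2)) (φ : HS t (Q n)) :
    1 / (2 * 4 ^ (K + 1)) * ‖cproj (VS t (Iv n o (K + 2))) φ‖ ^ 2
      ≤ ∑ j ∈ Finset.range (K + 1), ‖cproj (WE t n (o + j)) φ‖ ^ 2 := by
  set V := VS t (Iv n o (K + 2)) with hV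
  let T : HS t (Q n) →ₗ[ℂ] HS t (Q n) :=
    ∑ j ∈ Finset.range (K + 1), ((WE t n (o + j))ᗮ.starProjection : HS t (Q n) →ₗ[ℂ] HS t (Q n))
  have hTv : ∀ v, T v = ∑ j ∈ Finset.range (K + 1), cproj (WE t n (o + j)) v := by
    intro v; simp [T, cproj_eq]
  have hin : ∀ v, (inner ℂ v (T v)).re = ∑ j ∈ Finset.range (K + 1), ‖cproj (WE t n (o + j)) v‖ ^ 2 := by
    intro v
    rw [hTv, inner_sum, Complex.re_sum]
    exact Finset.sum_congr rfl fun j _ => inner_cproj _ _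
  have hsymm : T.IsSymmetric := by
    intro x y
    rw [hTv, hTv, inner_sum, sum_inner]
    refine Finset.sum_congr rfl fun j _ => ?_
    rw [cproj_eq, cproj_eq, inner_proj_symm]
  have hg := gap_of_eigen T hsymm V (1 / (2 * 4 ^ (K + 1))) (by
    intro v l hv hl
    rw [hTv] at hv
    refine partB o K hn (1 / 4 ^ (K + 1)) (by field_simp) v l ?_ hv
    rw [div_div, mul_comm]; exact hl)
  have hmem : cproj V φ ∈ Vᗮ := Submodule.sub_starProjection_mem_orthogonal φ
  have h1 := hg _ hmem
  rw [hin] at h1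
  refine h1.trans (le_of_eq ?_)
  refine Finset.sum_congr rfl fun j hj => ?_
  have hj' : j ≤ K := by simpa [Nat.lt_succ_iff] using hj
  have he : o + j + 1 < n := by omega
  have hle : V ≤ WE t n (o + j) := VS_le_WE (by rwa [Iv_card _ _ (by omega)]) he (eS_sub_Iv o K j hj' he)
  have h2 : (WE t n (o + j)).starProjection (V.starProjection φ) = V.starProjection φ :=
    Submodule.starProjection_eq_self_iff.2 (hle (Submodule.starProjection_apply_mem _ _))
  unfold cproj
  rw [map_sub, h2]
  congr 2
  abel

lemma local_gap (o L : ℕ) (hL : 2 ≤ L) (ho : o + 2 ≤ n) (hc : 2 * t ≤ 2 ^ L) (hc' : 2 * t ≤ 2 ^ (n - o))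
    (φ : HS t (Q n)) :
    1 / (2 * 4 ^ (L - 1)) * ‖cproj (VS t (Iv n o L)) φ‖ ^ 2
      ≤ ∑ e ∈ Finset.range (n - 1), if o ≤ e ∧ e + 1 < o + L then ‖cproj (WE t n e) φ‖ ^ 2 else 0 := by
  obtain ⟨K, hK⟩ : ∃ K, min L (n - o) = K + 2 := ⟨min L (n - o) - 2, by omega⟩
  have hIv : Iv n o L = Iv n o (K + 2) := by
    ext q
    rw [mem_Iv, mem_Iv]
    have := q.2
    omega
  have h1 := local_gap' (t := t) o K (by omega : o + K + 2 ≤ n) (by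
    rw [← hK]
    rcases le_total L (n - o) with h | h
    · rwa [min_eq_left h]
    · rwa [min_eq_right h]) φ
  rw [hIv]
  have h2 : (1 : ℝ) / (2 * 4 ^ (L - 1)) ≤ 1 / (2 * 4 ^ (K + 1)) := by
    apply one_div_le_one_div_of_le (by positivity)
    apply mul_le_mul_of_nonneg_left _ (by norm_num)
    exact pow_le_pow_right₀ (by norm_num) (by omega)
  refine (mul_le_mul_of_nonneg_right h2 (by positivity)).trans (h1.trans ?_)
  rw [← Finset.sum_filter]
  have h3 : ∑ j ∈ Finset.range (K + 1), ‖cproj (WE t n (o + j)) φ‖ ^ 2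
      = ∑ e ∈ (Finset.range (K + 1)).map (addLeftEmbedding o), ‖cproj (WE t n e) φ‖ ^ 2 := by
    rw [Finset.sum_map]; rfl
  rw [h3]
  refine Finset.sum_le_sum_of_subset_of_nonneg ?_ fun _ _ _ => by positivity
  intro e he
  simp only [Finset.mem_map, Finset.mem_range, addLeftEmbedding_apply] at he
  obtain ⟨j, hj, rfl⟩ := he
  simp only [Finset.mem_filter, Finset.mem_range]
  omega

lemma cproj_eq_zero {E : Type*} [NormedAddCommGroup E] [InnerProductSpace ℂ E] [FiniteDimensional ℂ E]
    (V : Submodule ℂ E) (v : E) : cproj V v = 0 ↔ v ∈ V := by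
  unfold cproj
  rw [sub_eq_zero, eq_comm, Submodule.starProjection_eq_self_iff]

lemma univ_gap (hn : 2 ≤ n) (hc : 2 * t ≤ 2 ^ n) (φ : HS t (Q n)) (hφ : φ ∈ (VU t (Q n))ᗮ) :
    1 / (2 * 4 ^ (n - 1)) * ‖φ‖ ^ 2 ≤ ∑ e ∈ Finset.range (n - 1), ‖cproj (WE t n e) φ‖ ^ 2 := by
  have h := local_gap (t := t) 0 n hn (by omega) hc (by simpa using hc) φ
  have hI : Iv n 0 n = Finset.univ := by
    ext q; rw [mem_Iv]; simp
  rw [hI] at h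
  have h1 : cproj (VS t (Finset.univ : Finset (Fin n))) φ = φ := by
    unfold cproj
    rw [sub_eq_self, Submodule.starProjection_apply_eq_zero_iff]
    exact Submodule.orthogonal_le (VS_univ_le hc) hφ
  rw [h1] at h
  refine h.trans (Finset.sum_le_sum fun e _ => ?_)
  split_ifs
  · exact le_rfl
  · positivity

lemma WE_inter (hn : 2 ≤ n) (hc : 2 * t ≤ 2 ^ n) (v : HS t (Q n)) (hv : ∀ e, e + 1 < n → v ∈ WE t n e) :
    v ∈ VU t (Q n) := by
  rw [← cproj_eq_zero]
  have hm : cproj (VU t (Q n)) v ∈ (VU t (Q n))ᗮ := Submodule.sub_starProjection_mem_orthogonal v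
  have h := univ_gap hn hc _ hm
  have h0 : ∑ e ∈ Finset.range (n - 1), ‖cproj (WE t n e) (cproj (VU t (Q n)) v)‖ ^ 2 = 0 := by
    refine Finset.sum_eq_zero fun e he => ?_
    have he' : e + 1 < n := by have := Finset.mem_range.1 he; omega
    have : cproj (WE t n e) (cproj (VU t (Q n)) v) = 0 := by
      rw [cproj_eq_zero]
      exact Submodule.sub_mem _ (hv e he') (VU_le_WE e (Submodule.starProjection_apply_mem _ _))
    rw [this]; simp
  rw [h0] at h
  have h2 : ‖cproj (VU t (Q n)) v‖ ^ 2 ≤ 0 := by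
    by_contra hcon
    push Not at hcon
    have : 0 < 1 / (2 * 4 ^ (n - 1)) * ‖cproj (VU t (Q n)) v‖ ^ 2 := by positivity
    linarith
  have h3 : ‖cproj (VU t (Q n)) v‖ = 0 := by nlinarith [norm_nonneg (cproj (VU t (Q n)) v)]
  exact norm_eq_zero.1 h3

theorem gap_all (ht : 1 ≤ t) (m : ℕ) (hm : 4 * t ^ 2 ≤ 2 ^ m) (hnt : 2 * t ≤ 2 ^ n) (hn : 2 ≤ n) :
    ∀ φ ∈ (VU t (Q n))ᗮ, (7 / 100) / 4 ^ (2 * m - 1) * ‖φ‖ ^ 2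
      ≤ ∑ e ∈ Finset.range (n - 1), ‖cproj (WE t n e) φ‖ ^ 2 := by
  intro φ hφ
  have hm2 : 2 ≤ m := by
    by_contra hcon
    have : 2 ^ m ≤ 2 ^ 1 := Nat.pow_le_pow_right (by norm_num) (by omega)
    nlinarith
  by_cases hnm : n ≤ 2 * m
  · refine le_trans ?_ (univ_gap hn hnt φ hφ)
    apply mul_le_mul_of_nonneg_right _ (by positivity)
    have h4 : (4 : ℝ) ^ (n - 1) ≤ 4 ^ (2 * m - 1) := pow_le_pow_right₀ (by norm_num) (by omega)
    rw [div_le_div_iff₀ (by positivity) (by positivity)]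
    nlinarith [show (0 : ℝ) < 4 ^ (n - 1) by positivity]
  push Not at hnm
  set J := (n - 1) / m with hJ
  have hJ1 : J * m ≤ n - 1 := Nat.div_mul_le_self _ _
  have hJ2 : n - 1 < (J + 1) * m := by
    have := Nat.lt_div_mul_add (a := n - 1) (b := m) (by omega)
    rw [add_mul, one_mul]; exact this
  have hJ3 : 2 ≤ J := by
    rw [hJ, Nat.le_div_iff_mul_le (by omega)]; omega
  have hb : ∀ j, j < J → j * m + m + 1 ≤ n := by
    intro j hj
    have : (j + 1) * m ≤ J * m := Nat.mul_le_mul_right _ hj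
    rw [add_mul, one_mul] at this
    omega
  have hpow : 8 * t ^ 2 ≤ 2 ^ (m + 1) := by
    have : 2 ^ (m + 1) = 2 ^ m * 2 := pow_succ 2 m
    omega
  have hcard : ∀ j, j < J → 8 * t ^ 2 ≤ 2 ^ (Iv n (j * m) (2 * m)).card := by
    intro j hj
    refine hpow.trans (Nat.pow_le_pow_right (by norm_num) ?_)
    rw [← Iv_card (n := n) (j * m) (m + 1) (by have := hb j hj; omega)]
    refine Finset.card_le_card ?_
    intro q hq
    rw [mem_Iv] at hq ⊢
    omega
  have hct : 2 * t ≤ 2 ^ m := le_trans (by nlinarith) hm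
  let V : ℕ → Submodule ℂ (HS t (Q n)) := fun j => if j < J then VS t (Iv n (j * m) (2 * m)) else ⊤
  have hVl : ∀ j, j < J → V j = VS t (Iv n (j * m) (2 * m)) := fun j hj => if_pos hj
  have hVt : ∀ j, ¬ j < J → V j = ⊤ := fun j hj => if_neg hj
  have htop : ∀ v : HS t (Q n), cproj (⊤ : Submodule ℂ (HS t (Q n))) v = 0 := by
    intro v; rw [cproj_eq_zero]; trivial
  have htop' : ∀ v : HS t (Q n), (⊤ : Submodule ℂ (HS t (Q n))).starProjection v = v := by
    intro v; rw [Submodule.starProjection_eq_self_iff]; trivial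
  have hchain := chain_gap V (VU t (Q n)) J (9 / 25) (by norm_num) ?_ ?_ ?_ φ hφ
  · -- summation
    have hloc : ∀ j ∈ Finset.range J, 1 / (2 * 4 ^ (2 * m - 1)) * ‖cproj (V j) φ‖ ^ 2
        ≤ ∑ e ∈ Finset.range (n - 1), if j * m ≤ e ∧ e + 1 < j * m + 2 * m then ‖cproj (WE t n e) φ‖ ^ 2 else 0 := by
      intro j hj
      have hj' := Finset.mem_range.1 hj
      rw [hVl j hj']
      have := hb j hj'
      refine local_gap (j * m) (2 * m) (by omega) (by omega) ?_ ?_ φ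
      · exact hct.trans (Nat.pow_le_pow_right (by norm_num) (by omega))
      · exact hct.trans (Nat.pow_le_pow_right (by norm_num) (by omega))
    have hsum := Finset.sum_le_sum hloc
    rw [← Finset.mul_sum, Finset.sum_comm] at hsum
    have hdouble : ∑ e ∈ Finset.range (n - 1), (∑ j ∈ Finset.range J,
        if j * m ≤ e ∧ e + 1 < j * m + 2 * m then ‖cproj (WE t n e) φ‖ ^ 2 else 0)
        ≤ ∑ e ∈ Finset.range (n - 1), 2 * ‖cproj (WE t n e) φ‖ ^ 2 := by
      refine Finset.sum_le_sum fun e _ => ?_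
      rw [← Finset.sum_filter, Finset.sum_const, nsmul_eq_mul]
      apply mul_le_mul_of_nonneg_right _ (by positivity)
      have : ((Finset.range J).filter fun j => j * m ≤ e ∧ e + 1 < j * m + 2 * m) ⊆ {e / m, e / m - 1} := by
        intro j hj
        simp only [Finset.mem_filter] at hj
        obtain ⟨-, h1, h2⟩ := hj
        have h3 : j ≤ e / m := (Nat.le_div_iff_mul_le (by omega)).2 h1
        have h4 : e / m < j + 2 := by
          rw [Nat.div_lt_iff_lt_mul (by omega), add_mul]; omega
        simp only [Finset.mem_insert, Finset.mem_singleton]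
        omega
      have h5 := (Finset.card_le_card this).trans Finset.card_le_two
      exact_mod_cast h5
    rw [← Finset.mul_sum] at hdouble
    have h6 : 1 / (2 * 4 ^ (2 * m - 1)) * ((1 - 2 * (9 / 25)) * ‖φ‖ ^ 2)
        ≤ 1 / (2 * (4:ℝ) ^ (2 * m - 1)) * ∑ j ∈ Finset.range J, ‖cproj (V j) φ‖ ^ 2 :=
      mul_le_mul_of_nonneg_left hchain (by positivity)
    have h7 : (7 / 100) / (4 : ℝ) ^ (2 * m - 1) * ‖φ‖ ^ 2
        = 1 / 2 * (1 / (2 * 4 ^ (2 * m - 1)) * ((1 - 2 * (9 / 25)) * ‖φ‖ ^ 2)) := by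
      field_simp; norm_num; ring
    rw [h7]
    linarith
  · -- adjacent
    intro j v
    by_cases hj : j + 1 < J
    · have hj0 : j < J := by omega
      rw [hVl j hj0, hVl (j + 1) hj]
      have hbb := hb (j + 1) hj
      rw [add_mul, one_mul] at hbb
      refine two_proj (VS t (Iv n (j * m) (2 * m) ∪ Iv n ((j + 1) * m) (2 * m))) _ _
        (VS_anti Finset.subset_union_left) (VS_anti Finset.subset_union_right) (9 / 25) (by norm_num) (by norm_num) ?_ v
      intro v
      refine VS_overlap (B := Iv n ((j + 1) * m) m) ?_ ?_ ?_ (hcard j hj0) (hcard (j + 1) hj) v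
      · intro q hq
        rw [mem_Iv] at hq ⊢
        rw [add_mul, one_mul] at hq
        omega
      · intro q hq
        rw [mem_Iv] at hq ⊢
        omega
      · rw [Iv_card _ _ (by rw [add_mul, one_mul]; omega)]; exact hm
    · rw [hVt (j + 1) hj, htop]
      simp only [inner_zero_right, norm_zero, Complex.zero_re, mul_zero]
      have : 0 ≤ ‖cproj (V j) v‖ ^ 2 := by positivity
      nlinarith
  · intro j k hjk v
    by_cases hk : k < J
    · have hj0 : j < J := by omega
      rw [hVl j hj0, hVl k hk]
      refine VS_commute ?_ (hcard j hj0) (hcard k hk) v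
      rw [Finset.disjoint_left]
      intro q hq hq'
      rw [mem_Iv] at hq hq'
      have : (j + 2) * m ≤ k * m := Nat.mul_le_mul_right _ hjk
      rw [add_mul] at this
      omega
    · rw [hVt k hk, htop', htop']
  · intro v hv
    refine WE_inter hn hnt v fun e he => ?_
    have key : ∀ j, j < J → j * m ≤ e → e + 1 < j * m + 2 * m → v ∈ WE t n e := by
      intro j hj h1 h2
      have h3 := hv j hj
      rw [hVl j hj] at h3
      refine VS_le_WE ?_ he ?_ h3
      · exact le_trans (by nlinarith) (hcard j hj)
      · intro q hq
        simp only [eS, Finset.mem_insert, Finset.mem_singleton, Fin.ext_iff] at hq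
        rw [mem_Iv]; omega
    have hd1 : e / m * m ≤ e := Nat.div_mul_le_self _ _
    have hd2 : e < e / m * m + m := Nat.lt_div_mul_add (by omega)
    by_cases hj : e / m < J
    · exact key (e / m) hj hd1 (by omega)
    · have h1 : J * m ≤ e / m * m := Nat.mul_le_mul_right _ (by omega)
      obtain ⟨J', hJ'⟩ : ∃ J', J = J' + 1 := ⟨J - 1, by omega⟩
      refine key J' (by omega) ?_ ?_
      · rw [hJ', add_mul] at h1; omega
      · rw [hJ', add_mul, add_mul] at hJ2; omega

end gap
end TPE

namespace TPE

/-- the denominator inside `Pgap` -/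
def DD (t : ℕ) : ℝ := 425 * ((⌊Real.logb 2 (4 * t)⌋ : ℤ) : ℝ) ^ 2 * (t : ℝ) ^ 5 *
      (t : ℝ) ^ ((3.1 : ℝ) / Real.log 2)

lemma floor_log_ge (t : ℕ) (j : ℕ) (h : 2 ^ j ≤ 4 * t) : (j : ℤ) ≤ ⌊Real.logb 2 (4 * t)⌋ := by
  rw [Int.le_floor]
  have h1 : ((2 : ℝ) ^ j) ≤ 4 * t := by exact_mod_cast h
  have h2 := Real.logb_le_logb_of_le (b := 2) (by norm_num) (by positivity) h1
  rw [Real.logb_pow, Real.logb_self_eq_one (by norm_num)] at h2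
  simpa using h2

lemma exp_bound : (4.4 : ℝ) ≤ 3.1 / Real.log 2 := by
  have h1 := Real.log_two_lt_d9
  have h2 : 0 < Real.log 2 := Real.log_pos (by norm_num)
  rw [le_div_iff₀ h2]
  linarith

lemma DD_one : 1700 ≤ DD 1 := by
  have h := floor_log_ge 1 2 (by norm_num)
  have h' : (2 : ℝ) ≤ ((⌊Real.logb 2 (4 * (1 : ℕ))⌋ : ℤ) : ℝ) := by exact_mod_cast h
  unfold DD
  simp only [Nat.cast_one, Real.one_rpow, one_pow, mul_one] at h' ⊢
  nlinarith

lemma DD_ge {t : ℕ} (ht : 2 ≤ t) : 425 * 9 * 2.55 * (t : ℝ) ^ 8 ≤ DD t := by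
  have h := floor_log_ge t 3 (by omega)
  have h' : (3 : ℝ) ≤ ((⌊Real.logb 2 (4 * t)⌋ : ℤ) : ℝ) := by exact_mod_cast h
  have ht' : (2 : ℝ) ≤ t := by exact_mod_cast ht
  have hq : (2.55 : ℝ) ≤ (2 : ℝ) ^ (1.4 : ℝ) := by
    have h5 : ((2 : ℝ) ^ (1.4 : ℝ)) ^ 5 = 128 := by
      rw [← Real.rpow_natCast, ← Real.rpow_mul (by norm_num)]
      have : (1.4 : ℝ) * ((5 : ℕ) : ℝ) = ((7 : ℕ) : ℝ) := by norm_num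
      rw [this, Real.rpow_natCast]; norm_num
    refine le_of_pow_le_pow_left₀ (n := 5) (by norm_num) (by positivity) ?_
    rw [h5]; norm_num
  have h1 : (2.55 : ℝ) * (t : ℝ) ^ 3 ≤ (t : ℝ) ^ ((3.1 : ℝ) / Real.log 2) := by
    calc (2.55 : ℝ) * (t : ℝ) ^ 3 ≤ (t : ℝ) ^ (1.4 : ℝ) * (t : ℝ) ^ 3 := by
          gcongr
          exact hq.trans (Real.rpow_le_rpow (by norm_num) ht' (by norm_num))
      _ = (t : ℝ) ^ (4.4 : ℝ) := by
          rw [← Real.rpow_natCast, ← Real.rpow_add (by linarith)]; norm_num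
      _ ≤ _ := Real.rpow_le_rpow_of_exponent_le (by linarith) exp_bound
  have h2 : (9 : ℝ) ≤ ((⌊Real.logb 2 (4 * t)⌋ : ℤ) : ℝ) ^ 2 := by nlinarith
  unfold DD
  calc 425 * 9 * 2.55 * (t : ℝ) ^ 8 = 425 * 9 * (t : ℝ) ^ 5 * (2.55 * (t : ℝ) ^ 3) := by ring
    _ ≤ _ := by gcongr

lemma m_exists {t : ℕ} (ht : 1 ≤ t) : ∃ m : ℕ, 4 * t ^ 2 ≤ 2 ^ m ∧ 0 < DD t ∧
    (2 / 3) * (DD t)⁻¹ ≤ (7 / 100) / (4 : ℝ) ^ (2 * m - 1) := by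
  rcases Nat.lt_or_ge t 2 with h | h
  · have : t = 1 := by omega
    subst this
    have h1 := DD_one
    have h0 : 0 < DD 1 := by linarith
    refine ⟨2, by norm_num, h0, ?_⟩
    have : (DD 1)⁻¹ ≤ (1700 : ℝ)⁻¹ := inv_anti₀ (by norm_num) h1
    norm_num at this ⊢
    linarith
  · have h1 := DD_ge h
    have ht' : (2 : ℝ) ≤ t := by exact_mod_cast h
    have h0 : 0 < DD t := lt_of_lt_of_le (by positivity) h1
    have h4 : 1 < 4 * t ^ 2 := by nlinarith
    set m := Nat.clog 2 (4 * t ^ 2) with hm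
    have hm0 : 0 < m := Nat.clog_pos (by norm_num) (by omega)
    refine ⟨m, Nat.le_pow_clog (by norm_num) _, h0, ?_⟩
    have h5 : 2 ^ (m - 1) < 4 * t ^ 2 := Nat.pow_pred_clog_lt_self (by norm_num) h4
    have h6 : (2 : ℝ) ^ (m - 1) ≤ 4 * (t : ℝ) ^ 2 := by exact_mod_cast h5.le
    have h7 : (4 : ℝ) ^ (2 * m - 1) = ((2 : ℝ) ^ (m - 1)) ^ 4 * 4 := by
      obtain ⟨j, hj⟩ : ∃ j, m = j + 1 := ⟨m - 1, by omega⟩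
      rw [hj]
      have : 2 * (j + 1) - 1 = 2 * j + 1 := by omega
      rw [this, Nat.add_sub_cancel, show (4 : ℝ) = 2 ^ 2 by norm_num, ← pow_mul, ← pow_mul, ← pow_add]
      congr 1; omega
    have h8 : (4 : ℝ) ^ (2 * m - 1) ≤ 1024 * (t : ℝ) ^ 8 := by
      rw [h7]
      calc ((2 : ℝ) ^ (m - 1)) ^ 4 * 4 ≤ (4 * (t : ℝ) ^ 2) ^ 4 * 4 := by gcongr
        _ = _ := by ring
    rw [← div_eq_mul_inv, div_le_div_iff₀ h0 (by positivity)]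
    have : 0 < (t : ℝ) ^ 8 := by positivity
    nlinarith

lemma Pgap_eq (t : ℕ) : Pgap t = (1 + (1 / 2) * (DD t)⁻¹) ^ (-(1 / 3 : ℝ)) := rfl

lemma Pgap_pos {t : ℕ} (ht : 1 ≤ t) : 0 < Pgap t := by
  obtain ⟨m, _, h0, _⟩ := m_exists ht
  rw [Pgap_eq]; positivity

lemma Pgap_cube {t : ℕ} (ht : 1 ≤ t) : Pgap t ^ 3 * (1 + (1 / 2) * (DD t)⁻¹) = 1 := by
  obtain ⟨m, _, h0, _⟩ := m_exists ht
  have h1 : 0 < 1 + (1 / 2) * (DD t)⁻¹ := by positivity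
  rw [Pgap_eq, ← Real.rpow_natCast, ← Real.rpow_mul h1.le]
  norm_num
  rw [Real.rpow_neg_one]
  refine inv_mul_cancel₀ ?_
  norm_num at h1
  exact h1.ne'

lemma Pgap_bound {t : ℕ} (ht : 1 ≤ t) {Δ x y : ℝ} (hx : 0 ≤ x) (hy : 0 ≤ y)
    (hΔ : (2 / 3) * (DD t)⁻¹ ≤ Δ) (h : (1 + Δ / 2) * x ^ 2 ≤ y ^ 2) : x ≤ Pgap t * y := by
  obtain ⟨m, _, h0, _⟩ := m_exists ht
  have hP := Pgap_pos ht
  have hc := Pgap_cube ht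
  have hs : 0 < (DD t)⁻¹ := by positivity
  set s := (1 / 2) * (DD t)⁻¹ with hsd
  set P := Pgap t
  have hs0 : 0 < s := by positivity
  have hD : 0 < 1 + Δ / 2 := by linarith
  have key : 1 ≤ P ^ 2 * (1 + Δ / 2) := by
    refine le_of_pow_le_pow_left₀ (n := 3) (by norm_num) (by positivity) ?_
    have h1 : (P ^ 2 * (1 + Δ / 2)) ^ 3 = (P ^ 3) ^ 2 * (1 + Δ / 2) ^ 3 := by ring
    have h2 : (1 + s) ^ 2 ≤ (1 + Δ / 2) ^ 3 := by
      have h3 : 1 + 2 / 3 * s ≤ 1 + Δ / 2 := by linarith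
      calc (1 + s) ^ 2 ≤ (1 + 2 / 3 * s) ^ 3 := by nlinarith [sq_nonneg s, pow_pos hs0 3]
        _ ≤ _ := by gcongr
    rw [h1, one_pow]
    calc (1 : ℝ) = (P ^ 3) ^ 2 * (1 + s) ^ 2 := by rw [← mul_pow, hc, one_pow]
      _ ≤ _ := by gcongr
  refine le_of_sq_le_sq ?_ (by positivity)
  calc x ^ 2 = 1 * x ^ 2 := by ring
    _ ≤ (P ^ 2 * (1 + Δ / 2)) * x ^ 2 := by gcongr
    _ = P ^ 2 * ((1 + Δ / 2) * x ^ 2) := by ring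
    _ ≤ P ^ 2 * y ^ 2 := by gcongr
    _ = (P * y) ^ 2 := by ring

lemma n_ge {t n : ℕ} (ht : 1 ≤ t) (h : ⌊(2.5 : ℝ) * Real.logb 2 (4 * t)⌋ ≤ (n : ℤ)) :
    2 ≤ n ∧ 2 * t ≤ 2 ^ n := by
  have h1 : (2.5 : ℝ) * Real.logb 2 (4 * t) < n + 1 := by
    have := Int.lt_floor_add_one ((2.5 : ℝ) * Real.logb 2 (4 * t))
    have h2 : ((⌊(2.5 : ℝ) * Real.logb 2 (4 * t)⌋ : ℤ) : ℝ) ≤ ((n : ℤ) : ℝ) := by exact_mod_cast h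
    rw [Int.cast_natCast] at h2
    linarith
  have ht' : (1 : ℝ) ≤ t := by exact_mod_cast ht
  have h3 : 2 ≤ Real.logb 2 (4 * t) := by
    rw [Real.le_logb_iff_rpow_le (by norm_num) (by positivity)]
    norm_num; linarith
  refine ⟨?_, ?_⟩
  · have : (1 : ℝ) < n := by linarith
    have : 1 < n := by exact_mod_cast this
    omega
  · have h4 : Real.logb 2 (4 * t) ≤ n := by linarith
    rw [Real.logb_le_iff_le_rpow (by norm_num) (by positivity), Real.rpow_natCast] at h4
    have h5 : 4 * t ≤ 2 ^ n := by exact_mod_cast h4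
    omega

theorem block_proj {t n : ℕ} (ht : 1 ≤ t) (h : ⌊(2.5 : ℝ) * Real.logb 2 (4 * t)⌋ ≤ (n : ℤ)) :
    ‖layer (fun i => (WE t n (2 * i + 1)).starProjection) ((n - 1) / 2)
        * layer (fun i => (WE t n (2 * i)).starProjection) (n / 2)
        - (VU t (Q n)).starProjection‖ ≤ Pgap t := by
  obtain ⟨hn, hnt⟩ := n_ge ht h
  obtain ⟨m, hm, h0, hD⟩ := m_exists ht
  have hP := Pgap_pos ht
  have hodd : layer (fun i => (WE t n (2 * i + 1)).starProjection) (n / 2)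
      = layer (fun i => (WE t n (2 * i + 1)).starProjection) ((n - 1) / 2) := by
    rcases Nat.even_or_odd' n with ⟨j, hj | hj⟩
    · have e1 : n / 2 = (n - 1) / 2 + 1 := by omega
      rw [e1, layer_succ, WE_top (by omega), Submodule.starProjection_top]
      exact mul_one _
    · have e1 : n / 2 = (n - 1) / 2 := by omega
      rw [e1]
  rw [← hodd]
  refine ContinuousLinearMap.opNorm_le_bound _ hP.le fun v => ?_
  set O := layer (fun i => (WE t n (2 * i + 1)).starProjection) (n / 2)
  set EV := layer (fun i => (WE t n (2 * i)).starProjection) (n / 2)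
  have hfix : ∀ (g : ℕ → HS t (Q n) →L[ℂ] HS t (Q n)) (p : HS t (Q n)), (∀ i, g i p = p) →
      ∀ N, layer g N p = p := by
    intro g p hg N
    induction N with
    | zero => rfl
    | succ N ih =>
      rw [layer_succ]
      change layer g N (g N p) = p
      rw [hg, ih]
  have hpV : (VU t (Q n)).starProjection v ∈ VU t (Q n) := Submodule.starProjection_apply_mem _ _
  have hfx : ∀ e, (WE t n e).starProjection ((VU t (Q n)).starProjection v)
      = (VU t (Q n)).starProjection v := fun e =>
    Submodule.starProjection_eq_self_iff.2 (VU_le_WE e hpV)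
  have e1 : O (EV ((VU t (Q n)).starProjection v)) = (VU t (Q n)).starProjection v := by
    rw [hfix _ _ (fun i => hfx (2 * i)), hfix _ _ (fun i => hfx (2 * i + 1))]
  have e2 : (O * EV - (VU t (Q n)).starProjection) v = O (EV (cproj (VU t (Q n)) v)) := by
    change O (EV v) - (VU t (Q n)).starProjection v = _
    unfold cproj
    rw [map_sub, map_sub, e1]
  rw [e2]
  have hψ : cproj (VU t (Q n)) v ∈ (VU t (Q n))ᗮ := by
    rw [cproj_eq]; exact Submodule.starProjection_apply_mem _ _
  have hgap : ∀ φ ∈ (VU t (Q n))ᗮ, (7 / 100) / 4 ^ (2 * m - 1) * ‖φ‖ ^ 2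
      ≤ ∑ e ∈ Finset.range (2 * (n / 2)), ‖cproj (WE t n e) φ‖ ^ 2 := by
    intro φ hφ
    refine (gap_all ht m hm hnt hn φ hφ).trans ?_
    refine Finset.sum_le_sum_of_subset_of_nonneg ?_ fun _ _ _ => by positivity
    exact Finset.range_subset_range.2 (by omega)
  have hd := detect (fun e => WE t n e) (VU t (Q n)) (fun e => VU_le_WE e)
    (fun e e' he => WE_commute t n e e' he) (n / 2) _ hgap _ hψ
  have := Pgap_bound ht (norm_nonneg _) (norm_nonneg _) hD hd
  refine this.trans ?_
  gcongr
  rw [cproj_eq]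
  exact proj_norm_le _ _

end TPE

namespace TPE

section sqrt
open scoped Matrix.Norms.L2Operator

lemma unitary_sqrt (U : Matrix.unitaryGroup (Fin 4) ℂ) :
    ∃ W : Matrix.unitaryGroup (Fin 4) ℂ, W * W = U := by
  have hU : (U : Matrix (Fin 4) (Fin 4) ℂ) ∈ unitary (Matrix (Fin 4) (Fin 4) ℂ) := U.2
  have hn : IsStarNormal (U : Matrix (Fin 4) (Fin 4) ℂ) := ⟨by
    rw [Commute, SemiconjBy, (Unitary.mem_iff.1 hU).1, (Unitary.mem_iff.1 hU).2]⟩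
  set f : ℂ → ℂ := fun z => z ^ (1 / 2 : ℂ) with hf
  have hc : ContinuousOn f (spectrum ℂ (U : Matrix (Fin 4) (Fin 4) ℂ)) :=
    (Matrix.finite_spectrum _).continuousOn _
  have hff : ∀ z, f z * f z = z := by
    intro z
    simp only [hf]
    rw [← pow_two, ← Complex.cpow_nat_mul]
    simp
  have hs : spectrum ℂ (U : Matrix (Fin 4) (Fin 4) ℂ) ⊆ Metric.sphere 0 1 :=
    Unitary.spectrum_subset_circle (⟨_, hU⟩ : unitary (Matrix (Fin 4) (Fin 4) ℂ))
  have hW : cfc f (U : Matrix (Fin 4) (Fin 4) ℂ) ∈ unitary (Matrix (Fin 4) (Fin 4) ℂ) := by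
    rw [cfc_unitary_iff f _ hn hc]
    intro z hz
    have h1 := hs hz
    rw [mem_sphere_zero_iff_norm] at h1
    have h2 : ‖f z‖ * ‖f z‖ = 1 := by rw [← norm_mul, hff, h1]
    have h3 : ‖f z‖ ^ 2 = 1 := by rw [pow_two, h2]
    have h4 := Complex.conj_mul' (f z)
    rw [Complex.star_def, h4, ← Complex.ofReal_pow, h3, Complex.ofReal_one]
  refine ⟨⟨_, hW⟩, Subtype.ext ?_⟩
  change cfc f (U : Matrix (Fin 4) (Fin 4) ℂ) * cfc f (U : Matrix (Fin 4) (Fin 4) ℂ) = U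
  rw [← cfc_mul f f _ hc hc]
  simp only [hff]
  exact cfc_id' ℂ _
end sqrt

end TPE

namespace TPE

section decay
variable {E : Type*} [NormedAddCommGroup E] [InnerProductSpace ℂ E] [FiniteDimensional ℂ E]

lemma pow_decay (R : E →L[ℂ] E)
    (h : ∀ (v : E) (l : ℂ), v ≠ 0 → R v = l • v → ‖l‖ < 1) :
    ∃ A r : ℝ, 1 ≤ A ∧ 0 < r ∧ r < 1 ∧ ∀ k : ℕ, ‖R ^ k‖ ≤ A * r ^ k := by
  rcases subsingleton_or_nontrivial E with hE | hE
  · refine ⟨1, 1 / 2, le_rfl, by norm_num, by norm_num, fun k => ?_⟩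
    have : R ^ k = 0 := by ext v; exact Subsingleton.elim _ _
    rw [this, norm_zero]; positivity
  have hcomp : CompleteSpace E := FiniteDimensional.complete ℂ E
  have hsr : spectralRadius ℂ R < 1 := by
    have := spectrum.spectralRadius_lt_of_forall_lt_of_nonempty (𝕜 := ℂ) (a := R)
      (spectrum.nonempty R) (r := 1) ?_
    · simpa using this
    · intro l hl
      have h1 : l ∈ spectrum ℂ (Module.End.toContinuousLinearMap (𝕜 := ℂ) E (R : E →ₗ[ℂ] E)) := hl
      rw [AlgEquiv.spectrum_eq, ← Module.End.hasEigenvalue_iff_mem_spectrum] at h1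
      obtain ⟨v, hv⟩ := h1.exists_hasEigenvector
      have := h v l hv.2 hv.apply_eq_smul
      exact_mod_cast this
  obtain ⟨r, hr1, hr2⟩ := ENNReal.lt_iff_exists_nnreal_btwn.1 hsr
  have hr0 : 0 < r := by
    have : (0 : ENNReal) < r := lt_of_le_of_lt zero_le hr1
    exact_mod_cast this
  have hr1' : r < 1 := by exact_mod_cast hr2
  have hev := (spectrum.pow_nnnorm_pow_one_div_tendsto_nhds_spectralRadius R).eventually
    (gt_mem_nhds hr1)
  obtain ⟨k0, hk0⟩ := Filter.eventually_atTop.1 hev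
  have hbig : ∀ k, k0 ≤ k → 1 ≤ k → ‖R ^ k‖ ≤ (r : ℝ) ^ k := by
    intro k hk hk1
    have h1 := hk0 k hk
    have hkne : (k : ℝ) ≠ 0 := by positivity
    have h2 := ENNReal.rpow_le_rpow (z := (k : ℝ)) h1.le (by positivity)
    rw [← ENNReal.rpow_mul, one_div, inv_mul_cancel₀ hkne, ENNReal.rpow_one,
      ENNReal.rpow_natCast] at h2
    have h3 : ‖R ^ k‖₊ ≤ r ^ k := by exact_mod_cast h2
    exact_mod_cast h3
  have hrr : (0 : ℝ) < r := by exact_mod_cast hr0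
  refine ⟨1 + ∑ j ∈ Finset.range (k0 + 1), ‖R ^ j‖ / (r : ℝ) ^ j, r, ?_, hrr, by exact_mod_cast hr1', ?_⟩
  · have : 0 ≤ ∑ j ∈ Finset.range (k0 + 1), ‖R ^ j‖ / (r : ℝ) ^ j :=
      Finset.sum_nonneg fun _ _ => by positivity
    linarith
  · intro k
    by_cases hk : k < k0 + 1
    · have h1 : ‖R ^ k‖ / (r : ℝ) ^ k ≤ ∑ j ∈ Finset.range (k0 + 1), ‖R ^ j‖ / (r : ℝ) ^ j :=
        Finset.single_le_sum (f := fun j => ‖R ^ j‖ / (r : ℝ) ^ j) (fun _ _ => by positivity)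
          (Finset.mem_range.2 hk)
      have h2 : ‖R ^ k‖ = ‖R ^ k‖ / (r : ℝ) ^ k * (r : ℝ) ^ k := by field_simp
      rw [h2]
      have : 0 < (r : ℝ) ^ k := by positivity
      nlinarith
    · have h0 : 0 ≤ ∑ j ∈ Finset.range (k0 + 1), ‖R ^ j‖ / (r : ℝ) ^ j :=
        Finset.sum_nonneg fun _ _ => by positivity
      have := hbig k (by omega) (by omega)
      have : 0 < (r : ℝ) ^ k := by positivity
      nlinarith

end decay

section seed
variable {t : ℕ}

/-- moment operator -/
def rho (t : ℕ) (U : Matrix.unitaryGroup (Fin 4) ℂ) : HS t (Fin 4) →L[ℂ] HS t (Fin 4) :=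
  op (momentMat t (U : Matrix (Fin 4) (Fin 4) ℂ))

lemma rho_mul (U W : Matrix.unitaryGroup (Fin 4) ℂ) : rho t (U * W) = rho t U * rho t W := by
  unfold rho
  rw [← op_mul, ← momentMat_mul]; rfl

lemma rho_one : rho t 1 = 1 := by
  unfold rho
  rw [← op_one, ← momentMat_one]; rfl

lemma rho_norm (U : Matrix.unitaryGroup (Fin 4) ℂ) (v : HS t (Fin 4)) : ‖rho t U v‖ = ‖v‖ :=
  momentMat_norm _ U.2 v

lemma rho_opNorm (U : Matrix.unitaryGroup (Fin 4) ℂ) : ‖rho t U‖ ≤ 1 :=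
  ContinuousLinearMap.opNorm_le_bound _ zero_le_one fun v => by rw [rho_norm, one_mul]

lemma rho_continuous (v : HS t (Fin 4)) : Continuous fun U => rho t U v :=
  (op_continuous v).comp (momentMat_continuous.comp continuous_subtype_val)

/-- the projection onto invariant vectors -/
def G4 (t : ℕ) : HS t (Fin 4) →L[ℂ] HS t (Fin 4) := (VU t (Fin 4)).starProjection

lemma rho_G4 (U : Matrix.unitaryGroup (Fin 4) ℂ) : rho t U * G4 t = G4 t := by
  ext1 v
  exact (Submodule.starProjection_apply_mem (VU t (Fin 4)) v) U

lemma rho_adj (U : Matrix.unitaryGroup (Fin 4) ℂ) (v w : HS t (Fin 4)) :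
    inner ℂ (rho t U v) w = inner ℂ v (rho t U⁻¹ w) := by
  unfold rho
  rw [op_adj, momentMat_conjTranspose]; rfl

lemma G4_rho (U : Matrix.unitaryGroup (Fin 4) ℂ) : G4 t * rho t U = G4 t := by
  ext1 v
  refine ext_inner_right ℂ fun w => ?_
  change inner ℂ ((VU t (Fin 4)).starProjection (rho t U v)) w
    = inner ℂ ((VU t (Fin 4)).starProjection v) w
  rw [inner_proj_symm, inner_proj_symm, rho_adj]
  congr 1
  exact (Submodule.starProjection_apply_mem (VU t (Fin 4)) w) _

/-- a vector with a real character under a dense group is invariant -/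
lemma char_fixed (S : Set (Matrix.unitaryGroup (Fin 4) ℂ))
    (hd : Dense ((Subgroup.closure S : Subgroup (Matrix.unitaryGroup (Fin 4) ℂ)) :
      Set (Matrix.unitaryGroup (Fin 4) ℂ)))
    (v : HS t (Fin 4)) (l : ℂ) (hl : l = 1 ∨ l = -1) (h : ∀ U ∈ S, rho t U v = l • v) :
    v ∈ VU t (Fin 4) := by
  have hinv : ∀ U w z, rho t U w = z → rho t U⁻¹ z = w := by
    intro U w z e
    rw [← e]
    change (rho t U⁻¹ * rho t U) w = w
    rw [← rho_mul, inv_mul_cancel, rho_one]; rfl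
  have h1 : ∀ U ∈ Subgroup.closure S, rho t U v = v ∨ rho t U v = -v := by
    intro U hU
    induction hU using Subgroup.closure_induction with
    | mem x hx =>
      rw [h x hx]
      rcases hl with rfl | rfl
      · left; simp
      · right; simp
    | one => left; rw [rho_one]; rfl
    | mul x y _ _ hx hy =>
      rw [rho_mul]
      change rho t x (rho t y v) = v ∨ rho t x (rho t y v) = -v
      rcases hy with hy | hy <;> rcases hx with hx | hx <;> rw [hy] <;>
        simp [hx]
    | inv x _ hx =>
      rcases hx with hx | hx
      · left; exact hinv _ _ _ hx
      · right
        have := hinv _ _ _ hx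
        rw [map_neg] at this
        rw [← this, neg_neg, this]
  have hcl : IsClosed {U | rho t U v = v ∨ rho t U v = -v} :=
    (isClosed_eq (rho_continuous v) continuous_const).union
      (isClosed_eq (rho_continuous v) continuous_const)
  have h2 : ∀ U, rho t U v = v ∨ rho t U v = -v := fun U =>
    hcl.closure_subset_iff.2 h1 (hd U)
  intro U
  obtain ⟨W, rfl⟩ := unitary_sqrt U
  change rho t (W * W) v = v
  rw [rho_mul]
  change rho t W (rho t W v) = v
  rcases h2 W with hw | hw
  · rw [hw, hw]
  · rw [hw, map_neg, hw, neg_neg]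

/-- average over a finite set -/
def av (t : ℕ) (S : Finset (Matrix.unitaryGroup (Fin 4) ℂ)) : HS t (Fin 4) →L[ℂ] HS t (Fin 4) :=
  ((S.card : ℂ)⁻¹) • ∑ U ∈ S, rho t U

lemma av_G4 (S : Finset (Matrix.unitaryGroup (Fin 4) ℂ)) (hS : S.Nonempty) :
    av t S * G4 t = G4 t := by
  have : (S.card : ℂ) ≠ 0 := by exact_mod_cast hS.card_pos.ne'
  unfold av
  rw [smul_mul_assoc, Finset.sum_mul, Finset.sum_congr rfl fun U _ => rho_G4 U, Finset.sum_const,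
    ← Nat.cast_smul_eq_nsmul ℂ, smul_smul, inv_mul_cancel₀ this, one_smul]

lemma G4_av (S : Finset (Matrix.unitaryGroup (Fin 4) ℂ)) (hS : S.Nonempty) :
    G4 t * av t S = G4 t := by
  have : (S.card : ℂ) ≠ 0 := by exact_mod_cast hS.card_pos.ne'
  unfold av
  rw [mul_smul_comm, Finset.mul_sum, Finset.sum_congr rfl fun U _ => G4_rho U, Finset.sum_const,
    ← Nat.cast_smul_eq_nsmul ℂ, smul_smul, inv_mul_cancel₀ this, one_smul]

lemma G4_idem : G4 t * G4 t = G4 t := by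
  ext1 v
  exact proj_idem _ _

lemma av_norm (S : Finset (Matrix.unitaryGroup (Fin 4) ℂ)) : ‖av t S‖ ≤ 1 := by
  unfold av
  rw [norm_smul, norm_inv, Complex.norm_natCast]
  have : ‖∑ U ∈ S, rho t U‖ ≤ S.card := by
    refine (norm_sum_le _ _).trans ?_
    refine (Finset.sum_le_sum fun U _ => rho_opNorm U).trans ?_
    simp
  calc (S.card : ℝ)⁻¹ * ‖∑ U ∈ S, rho t U‖ ≤ (S.card : ℝ)⁻¹ * S.card := by gcongr
    _ ≤ 1 := inv_mul_le_one

lemma av_eigen (S : Finset (Matrix.unitaryGroup (Fin 4) ℂ)) (hS : S.Nonempty)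
    (v : HS t (Fin 4)) (l : ℂ) (hl : 1 ≤ ‖l‖) (h : av t S v = l • v) :
    ∀ U ∈ S, rho t U v = l • v := by
  have hc : (S.card : ℂ) ≠ 0 := by exact_mod_cast hS.card_pos.ne'
  have hsum : ∑ U ∈ S, rho t U v = (S.card : ℂ) • (l • v) := by
    rw [← h]
    unfold av
    rw [_root_.smul_apply, smul_smul, mul_inv_cancel₀ hc, one_smul, _root_.sum_apply]
  have key : ∑ U ∈ S, ‖rho t U v - l • v‖ ^ 2 = S.card * ((1 - ‖l‖ ^ 2) * ‖v‖ ^ 2) := by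
    have e1 : ∀ U ∈ S, ‖rho t U v - l • v‖ ^ 2
        = (‖v‖ ^ 2 + ‖l‖ ^ 2 * ‖v‖ ^ 2) - 2 * (inner ℂ (rho t U v) (l • v)).re := by
      intro U _
      have := norm_sub_sq (𝕜 := ℂ) (rho t U v) (l • v)
      rw [this, rho_norm, norm_smul]
      simp only [RCLike.re_eq_complex_re]
      ring
    rw [Finset.sum_congr rfl e1, Finset.sum_sub_distrib, Finset.sum_const, ← Finset.mul_sum,
      ← Complex.re_sum, ← sum_inner, hsum, inner_smul_left, inner_self_eq_norm_sq_to_K, norm_smul]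
    simp only [map_natCast, nsmul_eq_mul]
    have : ((S.card : ℂ) * (((‖l‖ * ‖v‖ : ℝ)) : ℂ) ^ 2).re = S.card * (‖l‖ * ‖v‖) ^ 2 := by
      rw [← Complex.ofReal_pow, ← Complex.ofReal_natCast, ← Complex.ofReal_mul, Complex.ofReal_re]
    refine (congrArg (fun z : ℝ => (S.card : ℝ) * (‖v‖ ^ 2 + ‖l‖ ^ 2 * ‖v‖ ^ 2) - 2 * z) this).trans ?_
    ring
  have hle : ∑ U ∈ S, ‖rho t U v - l • v‖ ^ 2 ≤ 0 := by
    rw [key]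
    have h1 : 1 - ‖l‖ ^ 2 ≤ 0 := by nlinarith
    have h2 : 0 ≤ ‖v‖ ^ 2 := by positivity
    have h3 : 0 ≤ (S.card : ℝ) := by positivity
    exact mul_nonpos_of_nonneg_of_nonpos h3 (mul_nonpos_of_nonpos_of_nonneg h1 h2)
  have hz := (Finset.sum_eq_zero_iff_of_nonneg fun U _ => by positivity).1
    (le_antisymm hle (Finset.sum_nonneg fun _ _ => by positivity))
  intro U hU
  have := hz U hU
  rw [sq_eq_zero_iff, norm_eq_zero, sub_eq_zero] at this
  exact this

lemma seed_decay (UB UM : Finset (Matrix.unitaryGroup (Fin 4) ℂ))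
    (hMB : UM ⊆ UB) (hMne : UM.Nonempty) (hMinv : ∀ U ∈ UM, U⁻¹ ∈ UM)
    (hdense : Dense ((Subgroup.closure (↑UB : Set (Matrix.unitaryGroup (Fin 4) ℂ)) :
        Subgroup (Matrix.unitaryGroup (Fin 4) ℂ)) : Set (Matrix.unitaryGroup (Fin 4) ℂ))) :
    ∃ A r : ℝ, 1 ≤ A ∧ 0 < r ∧ r < 1 ∧ ∀ k : ℕ, 1 ≤ k → ‖av t UB ^ k - G4 t‖ ≤ A * r ^ k := by
  have hBne : UB.Nonempty := hMne.mono hMB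
  obtain ⟨A, r, hA, hr, hr1, hd⟩ := pow_decay (av t UB - G4 t) (by
    intro v l hv h
    by_contra hl
    push Not at hl
    have hl0 : l ≠ 0 := by
      rintro rfl
      rw [norm_zero] at hl; linarith
    have hG : G4 t v = 0 := by
      have h1 : (G4 t * (av t UB - G4 t)) v = 0 := by
        rw [mul_sub, G4_av _ hBne, G4_idem, sub_self]; rfl
      have h2 : G4 t (l • v) = 0 := by rw [← h]; exact h1
      rw [map_smul] at h2
      exact (smul_eq_zero.1 h2).resolve_left hl0
    have hB : av t UB v = l • v := by
      rw [← h, _root_.sub_apply, hG, sub_zero]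
    have hU := av_eigen UB hBne v l hl hB
    obtain ⟨U, hUM⟩ := hMne
    have h1 := hU U (hMB hUM)
    have h2 := hU U⁻¹ (hMB (hMinv U hUM))
    have h3 : (rho t U⁻¹ * rho t U) v = v := by
      rw [← rho_mul, inv_mul_cancel, rho_one]; rfl
    have h4 : (l * l) • v = v := by
      have h5 : (rho t U⁻¹ * rho t U) v = rho t U⁻¹ (rho t U v) := rfl
      rw [h5, h1, map_smul, h2, smul_smul] at h3
      exact h3
    have h6 : l * l = 1 := by
      have : (l * l - 1) • v = 0 := by rw [sub_smul, h4, one_smul, sub_self]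
      exact sub_eq_zero.1 ((smul_eq_zero.1 this).resolve_right hv)
    have hfix := char_fixed (t := t) _ hdense v l (mul_self_eq_one_iff.1 h6) (fun U hU' => hU U hU')
    have : G4 t v = v := Submodule.starProjection_eq_self_iff.2 hfix
    exact hv (this ▸ hG))
  refine ⟨A, r, hA, hr, hr1, fun k hk => ?_⟩
  have : av t UB ^ k - G4 t = (av t UB - G4 t) ^ k := by
    obtain ⟨j, rfl⟩ : ∃ j, k = j + 1 := ⟨k - 1, by omega⟩
    induction j with
    | zero => simp
    | succ j ih =>
      have h1 : ∀ i : ℕ, av t UB ^ i * G4 t = G4 t := by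
        intro i
        induction i with
        | zero => rw [pow_zero, one_mul]
        | succ i ih => rw [pow_succ, mul_assoc, av_G4 _ hBne, ih]
      rw [pow_succ (av t UB - G4 t), ← ih (by omega), sub_mul, mul_sub, mul_sub, h1, G4_av _ hBne,
        G4_idem, ← pow_succ, sub_self, sub_zero]
  rw [this]
  exact hd k

end seed

end TPE

namespace TPE

lemma sum_prod {A W : Type*} [Ring A] [Fintype W] (h : ℕ → W → A) (N : ℕ) :
    ∑ w : Fin N → W, (List.ofFn fun i : Fin N => h i (w i)).prod
      = layer (fun i => ∑ w, h i w) N := by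
  induction N with
  | zero => simp [layer_zero]
  | succ N ih =>
    rw [layer_succ, ← ih, ← (Fin.snocEquiv fun _ : Fin (N + 1) => W).sum_comp, Fintype.sum_prod_type,
      Finset.sum_comm, Finset.sum_mul_sum]
    refine Finset.sum_congr rfl fun w _ => Finset.sum_congr rfl fun x _ => ?_
    rw [List.ofFn_succ']
    simp [Fin.snocEquiv]

lemma layer_const {A : Type*} [Monoid A] (a : A) (N : ℕ) : layer (fun _ => a) N = a ^ N := by
  simp [layer]

lemma prod_ite {A : Type*} [Ring A] {N : ℕ} (P : Fin N → Prop) [DecidablePred P] (a : Fin N → A) :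
    (List.ofFn fun i => if P i then a i else 0).prod
      = if ∀ i, P i then (List.ofFn a).prod else 0 := by
  induction N with
  | zero => simp
  | succ N ih =>
    rw [List.ofFn_succ, List.ofFn_succ, List.prod_cons, List.prod_cons, ih]
    by_cases h0 : P 0 <;> by_cases h1 : ∀ i : Fin N, P i.succ <;> simp [Fin.forall_fin_succ, h0, h1]

lemma relaxed_sum {A : Type*} [Ring A] (UB UM : Finset (Matrix.unitaryGroup (Fin 4) ℂ))
    (hMB : UM ⊆ UB) (k : ℕ) (F : Matrix.unitaryGroup (Fin 4) ℂ → A) :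
    ∑ f : RelaxedWord UB UM k, (List.ofFn fun i => F (f.1 i)).prod
      = (∑ U ∈ UB, F U) ^ k - (∑ U ∈ UM, F U) ^ k := by
  have h1 := sum_prod (fun (_ : ℕ) (x : {x // x ∈ UB}) => F x) k
  have h2 := sum_prod (fun (_ : ℕ) (x : {x // x ∈ UB}) =>
    if (x : Matrix.unitaryGroup (Fin 4) ℂ) ∈ UM then F x else 0) k
  rw [layer_const] at h1 h2
  have e1 : ∑ x : {x // x ∈ UB}, F x = ∑ U ∈ UB, F U := Finset.sum_coe_sort UB F
  have e2 : ∑ x : {x // x ∈ UB}, (if (x : Matrix.unitaryGroup (Fin 4) ℂ) ∈ UM then F x else 0)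
      = ∑ U ∈ UM, F U := by
    rw [Finset.sum_coe_sort UB (fun U => if U ∈ UM then F U else 0), ← Finset.sum_filter,
      Finset.filter_mem_eq_inter, Finset.inter_eq_right.2 hMB]
  rw [e1] at h1
  rw [e2] at h2
  rw [← h1, ← h2]
  rw [Finset.sum_congr rfl fun (f : Fin k → {x // x ∈ UB}) _ =>
    prod_ite (fun i => (f i : Matrix.unitaryGroup (Fin 4) ℂ) ∈ UM) (fun i => F (f i))]
  rw [← Finset.sum_sub_distrib]
  rw [← Finset.sum_subtype (s := Finset.univ.filter fun f : Fin k → {x // x ∈ UB} =>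
      ∃ i, (f i : Matrix.unitaryGroup (Fin 4) ℂ) ∉ UM)
      (p := fun f : Fin k → {x // x ∈ UB} => ∃ i, (f i : Matrix.unitaryGroup (Fin 4) ℂ) ∉ UM)
      (by simp) (fun f => (List.ofFn fun i => F (f i)).prod), Finset.sum_filter]
  refine Finset.sum_congr rfl fun f _ => ?_
  by_cases h : ∃ i, (f i : Matrix.unitaryGroup (Fin 4) ℂ) ∉ UM
  · have h' : ¬ ∀ i, (f i : Matrix.unitaryGroup (Fin 4) ℂ) ∈ UM := by push Not; exact h
    rw [if_pos h, if_neg h', sub_zero]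
  · have h' : ∀ i, (f i : Matrix.unitaryGroup (Fin 4) ℂ) ∈ UM := by push Not at h; exact h
    rw [if_neg h, if_pos h', sub_self]

lemma relaxed_card (UB UM : Finset (Matrix.unitaryGroup (Fin 4) ℂ))
    (hMB : UM ⊆ UB) (k : ℕ) :
    (Fintype.card (RelaxedWord UB UM k) : ℂ) = (UB.card : ℂ) ^ k - (UM.card : ℂ) ^ k := by
  have := relaxed_sum UB UM hMB k (fun _ => (1 : ℂ))
  simpa using this

lemma alg_id {M : Type*} [AddCommGroup M] [Module ℂ M] (x y g : M) (c : ℂ) :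
    x - c • y - (1 - c) • g = x - g - c • (y - g) := by module

lemma word_unitary {k : ℕ} (f : Fin k → Matrix.unitaryGroup (Fin 4) ℂ) :
    wordMat f ∈ Matrix.unitaryGroup (Fin 4) ℂ := by
  refine Submonoid.list_prod_mem _ ?_
  intro x hx
  rw [List.mem_ofFn] at hx
  obtain ⟨i, rfl⟩ := hx
  exact (f i).2

lemma op_moment_list {ξ : Type*} [Fintype ξ] [DecidableEq ξ] {t : ℕ} (l : List (Matrix ξ ξ ℂ)) :
    op (momentMat t l.prod) = (l.map fun U => op (momentMat t U)).prod := by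
  induction l with
  | nil => simp [momentMat_one, op_one]
  | cons a l ih => rw [List.prod_cons, momentMat_mul, op_mul, ih, List.map_cons, List.prod_cons]

/-- the relaxed average at the 4-dimensional level -/
lemma relaxed_decay {t : ℕ} (UB UM : Finset (Matrix.unitaryGroup (Fin 4) ℂ))
    (hMB : UM ⊆ UB) (hMne : UM.Nonempty) (hproper : UM ≠ UB) (hMinv : ∀ U ∈ UM, U⁻¹ ∈ UM)
    (hdense : Dense ((Subgroup.closure (↑UB : Set (Matrix.unitaryGroup (Fin 4) ℂ)) :
        Subgroup (Matrix.unitaryGroup (Fin 4) ℂ)) : Set (Matrix.unitaryGroup (Fin 4) ℂ))) :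
    ∃ A r : ℝ, 1 ≤ A ∧ 0 < r ∧ r < 1 ∧ ∀ k : ℕ, 1 ≤ k →
      ‖((Fintype.card (RelaxedWord UB UM k) : ℂ)⁻¹) • ∑ f : RelaxedWord UB UM k,
          op (momentMat t (wordMat fun j => (f.1 j : Matrix.unitaryGroup (Fin 4) ℂ)))
        - G4 t‖ ≤ A * r ^ k := by
  obtain ⟨A, r, hA, hr, hr1, hd⟩ := seed_decay (t := t) UB UM hMB hMne hMinv hdense
  have hm : 0 < UM.card := hMne.card_pos
  have hlt : UM.card < UB.card := Finset.card_lt_card (lt_of_le_of_ne hMB hproper)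
  have hB : (0 : ℝ) < UB.card := by exact_mod_cast hm.trans hlt
  have hmR : (0 : ℝ) < UM.card := by exact_mod_cast hm
  set a : ℝ := (UM.card : ℝ) / UB.card with ha
  have ha0 : 0 < a := by positivity
  have ha1 : a < 1 := by rw [ha, div_lt_one hB]; exact_mod_cast hlt
  refine ⟨(A + 2) / (1 - a), max r a, ?_, lt_max_of_lt_left hr, max_lt hr1 ha1, fun k hk => ?_⟩
  · rw [le_div_iff₀ (by linarith)]; linarith
  have hBc : (UB.card : ℂ) ≠ 0 := by exact_mod_cast hB.ne'
  have hMc : (UM.card : ℂ) ≠ 0 := by exact_mod_cast hmR.ne'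
  have hak : a ^ k ≤ a := pow_le_of_le_one ha0.le ha1.le (by omega)
  have hak1 : (1 - (a : ℂ) ^ k) ≠ 0 := by
    have : (1 - a ^ k : ℝ) ≠ 0 := by linarith
    exact_mod_cast this
  have hac : (a : ℂ) = (UM.card : ℂ) / UB.card := by rw [ha]; push_cast; rfl
  have hsum : ∑ f : RelaxedWord UB UM k,
      op (momentMat t (wordMat fun j => (f.1 j : Matrix.unitaryGroup (Fin 4) ℂ)))
      = ((UB.card : ℂ) ^ k) • (av t UB ^ k - ((a : ℂ) ^ k) • av t UM ^ k) := by
    have h1 := relaxed_sum UB UM hMB k (rho t)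
    have e : ∀ S : Finset (Matrix.unitaryGroup (Fin 4) ℂ), (S.card : ℂ) ≠ 0 →
        ∑ U ∈ S, rho t U = (S.card : ℂ) • av t S := by
      intro S hS
      rw [av, smul_smul, mul_inv_cancel₀ hS, one_smul]
    rw [e UB hBc, e UM hMc, smul_pow, smul_pow] at h1
    rw [smul_sub, smul_smul, ← mul_pow, hac, mul_div_cancel₀ _ hBc, ← h1]
    refine Finset.sum_congr rfl fun f _ => ?_
    rw [wordMat, op_moment_list, List.map_ofFn]
    rfl
  have hcard : (Fintype.card (RelaxedWord UB UM k) : ℂ) = (UB.card : ℂ) ^ k * (1 - (a : ℂ) ^ k) := by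
    rw [relaxed_card UB UM hMB, hac, div_pow, mul_sub, mul_one, mul_div_cancel₀ _ (pow_ne_zero _ hBc)]
  have hfin : ((Fintype.card (RelaxedWord UB UM k) : ℂ)⁻¹) • ∑ f : RelaxedWord UB UM k,
          op (momentMat t (wordMat fun j => (f.1 j : Matrix.unitaryGroup (Fin 4) ℂ)))
        - G4 t = ((1 - (a : ℂ) ^ k)⁻¹) •
          ((av t UB ^ k - G4 t) - ((a : ℂ) ^ k) • (av t UM ^ k - G4 t)) := by
    have h2 : G4 t = ((1 - (a : ℂ) ^ k)⁻¹) • ((1 - (a : ℂ) ^ k) • G4 t) := by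
      rw [smul_smul, inv_mul_cancel₀ hak1, one_smul]
    rw [hsum, hcard, smul_smul, mul_inv, mul_right_comm, inv_mul_cancel₀ (pow_ne_zero _ hBc), one_mul]
    nth_rewrite 1 [h2]
    refine (smul_sub _ _ _).symm.trans ?_
    refine congrArg (fun z => ((1 - (a : ℂ) ^ k)⁻¹) • z) ?_
    exact alg_id _ _ _ _
  rw [hfin, norm_smul]
  have hn1 : ‖(1 - (a : ℂ) ^ k)⁻¹‖ ≤ (1 - a)⁻¹ := by
    rw [norm_inv]
    refine inv_anti₀ (by linarith) ?_
    have : (1 - (a : ℂ) ^ k) = ((1 - a ^ k : ℝ) : ℂ) := by push_cast; rfl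
    rw [this, Complex.norm_real, Real.norm_of_nonneg (by linarith)]
    linarith
  have hG : ‖G4 t‖ ≤ 1 :=
    ContinuousLinearMap.opNorm_le_bound _ zero_le_one fun v => by
      rw [one_mul]; exact proj_norm_le _ _
  have hMk : ‖av t UM ^ k‖ ≤ 1 := by
    refine (norm_pow_le' _ (by omega)).trans ?_
    exact pow_le_one₀ (norm_nonneg _) (av_norm _)
  have hn2 : ‖(av t UB ^ k - G4 t) - ((a : ℂ) ^ k) • (av t UM ^ k - G4 t)‖
      ≤ (A + 2) * (max r a) ^ k := by
    refine (norm_sub_le _ _).trans ?_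
    rw [norm_smul, norm_pow, Complex.norm_real, Real.norm_of_nonneg ha0.le]
    have h3 : ‖av t UM ^ k - G4 t‖ ≤ 2 := (norm_sub_le _ _).trans (by linarith)
    have h4 : r ^ k ≤ (max r a) ^ k := by gcongr; exact le_max_left _ _
    have h5 : a ^ k ≤ (max r a) ^ k := by gcongr; exact le_max_right _ _
    calc _ ≤ A * r ^ k + a ^ k * 2 := by gcongr; exact hd k hk
      _ ≤ A * (max r a) ^ k + (max r a) ^ k * 2 := by gcongr
      _ = _ := by ring
  calc _ ≤ (1 - a)⁻¹ * ((A + 2) * (max r a) ^ k) := by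
        gcongr
    _ = _ := by rw [div_eq_mul_inv]; ring

end TPE

namespace TPE

section fiber
variable {ξ α R : Type*} [Fintype ξ] [DecidableEq ξ] [Fintype α] [DecidableEq α] [Fintype R] [DecidableEq R]
  {t : ℕ} (ε : ξ ≃ α × R)

/-- joining fibre coordinates -/
def jn (t : ℕ) : Idx t α × Idx t R ≃ Idx t ξ where
  toFun p := (fun s => ε.symm (p.1.1 s, p.2.1 s), fun s => ε.symm (p.1.2 s, p.2.2 s))
  invFun y := ((fun s => (ε (y.1 s)).1, fun s => (ε (y.2 s)).1),
    (fun s => (ε (y.1 s)).2, fun s => (ε (y.2 s)).2))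
  left_inv p := by simp
  right_inv y := by simp

/-- restriction to a fibre -/
def fib (r : Idx t R) : HS t ξ →L[ℂ] HS t α :=
  LinearMap.toContinuousLinearMap
    { toFun := fun v => WithLp.toLp 2 fun i => v (jn ε t (i, r))
      map_add' := fun v w => by ext i; rfl
      map_smul' := fun c v => by ext i; rfl }

lemma fib_apply (r : Idx t R) (v : HS t ξ) (i : Idx t α) : fib ε r v i = v (jn ε t (i, r)) := rfl

lemma fib_norm (v : HS t ξ) : ∑ r : Idx t R, ‖fib ε r v‖ ^ 2 = ‖v‖ ^ 2 := by
  have h1 : ‖v‖ ^ 2 = ∑ p : Idx t α × Idx t R, ‖v (jn ε t p)‖ ^ 2 := by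
    rw [EuclideanSpace.norm_sq_eq]
    exact (Equiv.sum_comp (jn ε t) (fun y => ‖v y‖ ^ 2)).symm
  rw [h1, Fintype.sum_prod_type_right (fun p : Idx t α × Idx t R => ‖v (jn ε t p)‖ ^ 2)]
  refine Finset.sum_congr rfl fun r _ => ?_
  rw [EuclideanSpace.norm_sq_eq]
  rfl

lemma fib_entry (U : Matrix α α ℂ) (U' : Matrix ξ ξ ℂ)
    (hU : ∀ x y, U' x y = if (ε x).2 = (ε y).2 then U (ε x).1 (ε y).1 else 0)
    (i j : Idx t α) (r r' : Idx t R) :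
    momentMat t U' (jn ε t (i, r)) (jn ε t (j, r')) = if r = r' then momentMat t U i j else 0 := by
  have h1 : ∀ s, U' ((jn ε t (i, r)).1 s) ((jn ε t (j, r')).1 s)
      = if r.1 s = r'.1 s then U (i.1 s) (j.1 s) else 0 := by
    intro s; rw [hU]; simp [jn]
  have h2 : ∀ s, U' ((jn ε t (i, r)).2 s) ((jn ε t (j, r')).2 s)
      = if r.2 s = r'.2 s then U (i.2 s) (j.2 s) else 0 := by
    intro s; rw [hU]; simp [jn]
  unfold momentMat
  simp only [h1, h2]
  by_cases h : r = r'
  · subst h; simp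
  · rw [if_neg h]
    by_cases h3 : r.1 = r'.1
    · have h4 : r.2 ≠ r'.2 := fun h4 => h (Prod.ext h3 h4)
      obtain ⟨s, hs⟩ := Function.ne_iff.1 h4
      rw [Finset.prod_eq_zero (i := s) (s := Finset.univ)
        (f := fun s => (starRingEnd ℂ) (if r.2 s = r'.2 s then U (i.2 s) (j.2 s) else 0))
        (Finset.mem_univ s) (by rw [if_neg hs, map_zero]), mul_zero]
    · obtain ⟨s, hs⟩ := Function.ne_iff.1 h3
      rw [Finset.prod_eq_zero (i := s) (s := Finset.univ)
        (f := fun s => (if r.1 s = r'.1 s then U (i.1 s) (j.1 s) else 0))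
        (Finset.mem_univ s) (by rw [if_neg hs]), zero_mul]

lemma fib_op (U : Matrix α α ℂ) (U' : Matrix ξ ξ ℂ)
    (hU : ∀ x y, U' x y = if (ε x).2 = (ε y).2 then U (ε x).1 (ε y).1 else 0)
    (r : Idx t R) (v : HS t ξ) :
    fib ε r (op (momentMat t U') v) = op (momentMat t U) (fib ε r v) := by
  ext i
  rw [fib_apply, op_apply, op_apply, ← (jn ε t).sum_comp, Fintype.sum_prod_type]
  refine Finset.sum_congr rfl fun j _ => ?_
  simp only [fib_entry ε U U' hU, fib_apply, ite_mul, zero_mul]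
  rw [Finset.sum_eq_single r]
  · rw [if_pos rfl]
  · intro r' _ h; rw [if_neg (Ne.symm h)]
  · intro h; exact absurd (Finset.mem_univ _) h

lemma fib_bound (T : HS t ξ →L[ℂ] HS t ξ) (T4 : HS t α →L[ℂ] HS t α)
    (h : ∀ r v, fib ε r (T v) = T4 (fib ε r v)) : ‖T‖ ≤ ‖T4‖ := by
  refine ContinuousLinearMap.opNorm_le_bound _ (norm_nonneg _) fun v => ?_
  refine le_of_sq_le_sq ?_ (by positivity)
  rw [mul_pow, ← fib_norm ε (T v), ← fib_norm ε v, Finset.mul_sum]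
  refine Finset.sum_le_sum fun r _ => ?_
  rw [h, ← mul_pow]
  gcongr
  exact T4.le_opNorm _

end fiber

section edge
variable {n t e : ℕ}

/-- splitting off the two qubits of an edge -/
def esplit (he : e + 1 < n) (x : Q n) : Fin 4 × ({r : Fin n // r ≠ ⟨e, by omega⟩ ∧ r ≠ ⟨e + 1, he⟩} → Fin 2) :=
  (pairIdx (x ⟨e, by omega⟩) (x ⟨e + 1, he⟩), fun r => x r.1)

lemma esplit_bij (he : e + 1 < n) : Function.Bijective (esplit he) := by
  constructor
  · intro x y h
    have h1 := congrArg Prod.fst h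
    have h2 := congrArg Prod.snd h
    obtain ⟨h3, h4⟩ := pairIdx_inj h1
    funext r
    by_cases hq : r = ⟨e, by omega⟩
    · rw [hq]; exact h3
    by_cases hq' : r = ⟨e + 1, he⟩
    · rw [hq']; exact h4
    exact congrFun h2 ⟨r, hq, hq'⟩
  · rintro ⟨a, f⟩
    refine ⟨fun r => if h : r = ⟨e, by omega⟩ then ⟨a.val / 2, by omega⟩
      else if h' : r = ⟨e + 1, he⟩ then ⟨a.val % 2, by omega⟩ else f ⟨r, h, h'⟩, ?_⟩
    refine Prod.ext ?_ ?_
    · ext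
      simp [esplit, pairIdx]
      omega
    · funext r
      simp [esplit, r.2.1, r.2.2]

lemma eG_entry (he : e + 1 < n) (U : Matrix (Fin 4) (Fin 4) ℂ) (x y : Q n) :
    eG he U x y = if (esplit he x).2 = (esplit he y).2 then U (esplit he x).1 (esplit he y).1 else 0 := by
  have h1 : eG he U x y = applyGate n ⟨e, by omega⟩ ⟨e + 1, he⟩ U x y := rfl
  rw [h1]
  unfold applyGate
  refine if_congr ?_ rfl rfl
  constructor
  · intro h
    funext r
    exact h r.1 r.2.1 r.2.2
  · intro h r h1 h2
    exact congrFun h ⟨r, h1, h2⟩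

lemma edge_transfer (he : e + 1 < n) {ι : Type*} [Fintype ι] (c : ℂ)
    (U : ι → Matrix (Fin 4) (Fin 4) ℂ) :
    ‖c • ∑ i, op (momentMat t (eG he (U i))) - (WE t n e).starProjection‖
      ≤ ‖c • ∑ i, op (momentMat t (U i)) - G4 t‖ := by
  set ε := Equiv.ofBijective _ (esplit_bij he) with hε
  have hent : ∀ (U : Matrix (Fin 4) (Fin 4) ℂ) x y, eG he U x y
      = if (ε x).2 = (ε y).2 then U (ε x).1 (ε y).1 else 0 := fun U x y => eG_entry he U x y
  refine fib_bound ε _ _ fun r v => ?_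
  have hG : fib ε r ((WE t n e).starProjection v) = G4 t (fib ε r v) := by
    have h1 : G4 t (fib ε r v) = ∫ U : Matrix.unitaryGroup (Fin 4) ℂ, rho t U (fib ε r v) ∂(nu (Fin 4)) := by
      have h2 := op_integral (nu (Fin 4)) (fun U : Matrix.unitaryGroup (Fin 4) ℂ =>
        momentMat t (U : Matrix (Fin 4) (Fin 4) ℂ))
        (momentMat_continuous.comp continuous_subtype_val) (fib ε r v)
      have h3 := congrArg (fun T : HS t (Fin 4) →L[ℂ] HS t (Fin 4) => T (fib ε r v))
        (haar_eq_proj (t := t) (nu (Fin 4)))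
      exact h3.symm.trans h2
    rw [h1, ← WE_avg he v, ← ContinuousLinearMap.integral_comp_comm]
    · refine integral_congr_ae (Filter.Eventually.of_forall fun U => ?_)
      exact fib_op ε _ _ (hent _) r v
    · exact integrable_cont _ _ ((op_continuous v).comp (eG_moment_continuous he))
  rw [_root_.sub_apply, _root_.sub_apply, map_sub, hG, _root_.smul_apply, _root_.smul_apply, map_smul,
    _root_.sum_apply, _root_.sum_apply, map_sum]
  congr 2
  exact Finset.sum_congr rfl fun i _ => fib_op ε _ _ (hent _) r v

end edge

end TPE

namespace TPE

lemma layer_smul {A : Type*} [Ring A] [Algebra ℂ A] (c : ℂ) (g : ℕ → A) (N : ℕ) :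
    layer (fun i => c • g i) N = c ^ N • layer g N := by
  induction N with
  | zero => simp [layer_zero]
  | succ N ih => rw [layer_succ, layer_succ, ih, smul_mul_smul_comm, pow_succ]

section tele
variable {E : Type*} [NormedAddCommGroup E] [InnerProductSpace ℂ E]

lemma layer_norm (f : ℕ → E →L[ℂ] E) (N : ℕ) (hf : ∀ i < N, ‖f i‖ ≤ 1) : ‖layer f N‖ ≤ 1 := by
  induction N with
  | zero => rw [layer_zero]; exact ContinuousLinearMap.norm_id_le
  | succ N ih =>
    rw [layer_succ]
    refine (norm_mul_le _ _).trans ?_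
    exact mul_le_one₀ (ih fun i hi => hf i (by omega)) (norm_nonneg _) (hf N (by omega))

lemma mul_tele (a b a' b' : E →L[ℂ] E) (ha : ‖a‖ ≤ 1) (hb' : ‖b'‖ ≤ 1) :
    ‖a * b - a' * b'‖ ≤ ‖a - a'‖ + ‖b - b'‖ := by
  have : a * b - a' * b' = a * (b - b') + (a - a') * b' := by noncomm_ring
  rw [this]
  refine (norm_add_le _ _).trans ?_
  have h1 := norm_mul_le a (b - b')
  have h2 := norm_mul_le (a - a') b'
  have h3 := norm_nonneg (b - b')
  have h4 := norm_nonneg (a - a')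
  nlinarith

lemma layer_diff (f g : ℕ → E →L[ℂ] E) (N : ℕ) (δ : ℝ) (hf : ∀ i < N, ‖f i‖ ≤ 1)
    (hg : ∀ i < N, ‖g i‖ ≤ 1) (h : ∀ i < N, ‖f i - g i‖ ≤ δ) :
    ‖layer f N - layer g N‖ ≤ N * δ := by
  induction N with
  | zero => simp [layer_zero]
  | succ N ih =>
    rw [layer_succ, layer_succ]
    refine (mul_tele _ _ _ _ (layer_norm f N fun i hi => hf i (by omega)) (hg N (by omega))).trans ?_
    have h1 := ih (fun i hi => hf i (by omega)) (fun i hi => hg i (by omega)) (fun i hi => h i (by omega))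
    have h2 := h N (by omega)
    push_cast
    linarith
end tele

lemma final_numerics (A r a : ℝ) (hA : 1 ≤ A) (hr : 0 < r) (hr1 : r < 1) (ha : 0 < a) (ha1 : a < 1)
    (t : ℕ) (ht : 1 ≤ t) :
    ∃ C : ℝ, 0 < C ∧ C < 1 ∧ ∀ (n k : ℕ) (ε' : ℝ), 0 < ε' → ε' < 1 →
      (10 * t + (n : ℝ) ^ 2 * t - n * t + n + Real.logb 2 (1 / ε')) /
            Real.logb 2 (1 / (1 + (C - 1) * a)) ≤ (k : ℝ) →
      1 ≤ k ∧ n * (A * r ^ k) ≤ ε' := by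
  set L := Real.logb 2 (1 / r) with hL
  set la := Real.logb 2 A with hla
  have hL0 : 0 < L := Real.logb_pos (by norm_num) (by rw [lt_div_iff₀ hr]; linarith)
  have hla0 : 0 ≤ la := Real.logb_nonneg (by norm_num) hA
  set K := (1 + la) / L with hK
  have hK0 : 0 < K := by positivity
  have hC0 : 0 < (2 : ℝ) ^ (-(1 / K)) := by positivity
  have hC1 : (2 : ℝ) ^ (-(1 / K)) < 1 :=
    Real.rpow_lt_one_of_one_lt_of_neg (by norm_num) (by have : 0 < 1 / K := by positivity
                                                        linarith)
  refine ⟨(2 : ℝ) ^ (-(1 / K)), hC0, hC1, ?_⟩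
  have hlC : Real.logb 2 ((2 : ℝ) ^ (-(1 / K))) = -(1 / K) := Real.logb_rpow (by norm_num) (by norm_num)
  set C := (2 : ℝ) ^ (-(1 / K)) with hC
  intro n k ε' hε hε1 hk
  set w := 1 + (C - 1) * a with hw
  have hwC : C ≤ w := by nlinarith
  have hw0 : 0 < w := by linarith
  have hw1 : w < 1 := by nlinarith
  set D := Real.logb 2 (1 / w) with hD
  have hD0 : 0 < D := Real.logb_pos (by norm_num) (by rw [lt_div_iff₀ hw0]; linarith)
  have hDK : D ≤ 1 / K := by
    rw [hD, one_div, Real.logb_inv]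
    have := Real.logb_le_logb_of_le (b := 2) (by norm_num) hC0 hwC
    rw [hlC] at this
    linarith
  set le := Real.logb 2 (1 / ε') with hle
  have hle0 : 0 < le := Real.logb_pos (by norm_num) (by rw [lt_div_iff₀ hε]; linarith)
  set X : ℝ := 10 + n + le with hX
  have hn0 : (0 : ℝ) ≤ n := by positivity
  have hX1 : 1 ≤ X := by linarith
  have ht' : (1 : ℝ) ≤ t := by exact_mod_cast ht
  have hnum : X ≤ 10 * t + (n : ℝ) ^ 2 * t - n * t + n + le := by
    have h1 : (n : ℝ) ≤ (n : ℝ) ^ 2 := by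
      exact_mod_cast Nat.le_self_pow (by norm_num) n
    nlinarith
  have hkX : X * K ≤ k := by
    refine le_trans ?_ hk
    rw [le_div_iff₀ hD0]
    have : X * K * D ≤ X := by
      have h2 : K * D ≤ 1 := by
        calc K * D ≤ K * (1 / K) := by gcongr
          _ = 1 := by field_simp
      nlinarith
    linarith
  have hk1 : 1 ≤ k := by
    have : (0 : ℝ) < k := lt_of_lt_of_le (by positivity) hkX
    have : 0 < k := by exact_mod_cast this
    omega
  refine ⟨hk1, ?_⟩
  have hkL : n + la + le ≤ k * L := by
    have h1 : X * (1 + la) ≤ k * L := by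
      have : X * K * L = X * (1 + la) := by rw [hK]; field_simp
      rw [← this]; gcongr
    nlinarith
  have hA0 : 0 < A := by linarith
  have hmain : (2 : ℝ) ^ n * (A * r ^ k) ≤ ε' := by
    rw [← Real.logb_le_logb (b := 2) (by norm_num) (by positivity) hε,
      Real.logb_mul (by positivity) (by positivity), Real.logb_mul (by positivity) (by positivity),
      Real.logb_pow, Real.logb_pow, Real.logb_self_eq_one (by norm_num)]
    have e1 : le = - Real.logb 2 ε' := by rw [hle, one_div, Real.logb_inv]
    have e2 : L = - Real.logb 2 r := by rw [hL, one_div, Real.logb_inv]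
    have e3 : (k : ℝ) * L = - (k * Real.logb 2 r) := by rw [e2]; ring
    linarith
  refine le_trans ?_ hmain
  have : (n : ℝ) ≤ 2 ^ n := by exact_mod_cast (Nat.lt_two_pow_self (n := n)).le
  gcongr

section block
variable {n t k : ℕ}

/-- edge moment operator -/
def eT (t n e : ℕ) (U : Matrix (Fin 4) (Fin 4) ℂ) : HS t (Q n) →L[ℂ] HS t (Q n) :=
  if he : e + 1 < n then op (momentMat t (eG he U)) else 1

lemma block_op (f : Fin (n / 2) → Matrix (Fin 4) (Fin 4) ℂ)
    (g : Fin ((n - 1) / 2) → Matrix (Fin 4) (Fin 4) ℂ) :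
    op (momentMat t (blockUnitary n f g))
      = (List.ofFn fun i : Fin ((n - 1) / 2) => eT t n (2 * i.val + 1) (g i)).prod
        * (List.ofFn fun i : Fin (n / 2) => eT t n (2 * i.val) (f i)).prod := by
  unfold blockUnitary
  rw [momentMat_mul, op_mul, op_moment_list, op_moment_list, List.map_ofFn, List.map_ofFn]
  congr 3
  · funext i
    unfold eT
    rw [dif_pos (by omega)]
    rfl
  · funext i
    unfold eT
    rw [dif_pos (by omega)]
    rfl

lemma eT_norm (e : ℕ) {U : Matrix (Fin 4) (Fin 4) ℂ} (hU : U ∈ Matrix.unitaryGroup (Fin 4) ℂ) :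
    ‖eT t n e U‖ ≤ 1 := by
  unfold eT
  split_ifs with he
  · exact ContinuousLinearMap.opNorm_le_bound _ zero_le_one fun v => by
      rw [momentMat_norm _ (eG_unitary he hU), one_mul]
  · exact ContinuousLinearMap.norm_id_le

variable {W : Type*} [Fintype W] (u : W → Matrix (Fin 4) (Fin 4) ℂ)

/-- averaged edge operator -/
def eA (t n : ℕ) (u : W → Matrix (Fin 4) (Fin 4) ℂ) (e : ℕ) : HS t (Q n) →L[ℂ] HS t (Q n) :=
  ((Fintype.card W : ℂ)⁻¹) • ∑ w, eT t n e (u w)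

lemma eA_norm (hu : ∀ w, u w ∈ Matrix.unitaryGroup (Fin 4) ℂ) (e : ℕ) : ‖eA t n u e‖ ≤ 1 := by
  unfold eA
  rw [norm_smul, norm_inv, Complex.norm_natCast]
  have : ‖∑ w, eT t n e (u w)‖ ≤ Fintype.card W := by
    refine (norm_sum_le _ _).trans ?_
    refine (Finset.sum_le_sum fun w _ => eT_norm e (hu w)).trans ?_
    simp
  calc (Fintype.card W : ℝ)⁻¹ * ‖∑ w, eT t n e (u w)‖ ≤ (Fintype.card W : ℝ)⁻¹ * Fintype.card W := by
        gcongr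
    _ ≤ 1 := inv_mul_le_one

lemma eA_diff (e : ℕ) (he : e + 1 < n) : ‖eA t n u e - (WE t n e).starProjection‖
    ≤ ‖((Fintype.card W : ℂ)⁻¹) • ∑ w, op (momentMat t (u w)) - G4 t‖ := by
  have h1 : eA t n u e = ((Fintype.card W : ℂ)⁻¹) • ∑ w, op (momentMat t (eG he (u w))) := by
    unfold eA
    refine congrArg (fun z => ((Fintype.card W : ℂ)⁻¹) • z) ?_
    refine Finset.sum_congr rfl fun w _ => ?_
    unfold eT
    rw [dif_pos he]
  rw [h1]
  exact edge_transfer he _ u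

lemma block_avg :
    op (∑ w : (Fin (n / 2) → W) × (Fin ((n - 1) / 2) → W),
      (((Fintype.card ((Fin (n / 2) → W) × (Fin ((n - 1) / 2) → W)) : ℝ)⁻¹ : ℝ) : ℂ) •
        momentMat t (blockUnitary n (fun i => u (w.1 i)) (fun i => u (w.2 i))))
      = layer (fun i => eA t n u (2 * i + 1)) ((n - 1) / 2)
        * layer (fun i => eA t n u (2 * i)) (n / 2) := by
  have h1 := sum_prod (fun i w => eT t n (2 * i + 1) (u w)) ((n - 1) / 2)
  have h0 := sum_prod (fun i w => eT t n (2 * i) (u w)) (n / 2)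
  have s1 : layer (fun i => eA t n u (2 * i + 1)) ((n - 1) / 2)
      = ((Fintype.card W : ℂ)⁻¹) ^ ((n - 1) / 2) •
        layer (fun i => ∑ w, eT t n (2 * i + 1) (u w)) ((n - 1) / 2) := layer_smul _ _ _
  have s0 : layer (fun i => eA t n u (2 * i)) (n / 2)
      = ((Fintype.card W : ℂ)⁻¹) ^ (n / 2) •
        layer (fun i => ∑ w, eT t n (2 * i) (u w)) (n / 2) := layer_smul _ _ _
  rw [s1, s0, smul_mul_smul_comm, ← h1, ← h0, Finset.sum_mul_sum, Finset.sum_comm,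
    ← Finset.smul_sum, op_smul, op_sum, Fintype.sum_prod_type]
  have hc : (((Fintype.card ((Fin (n / 2) → W) × (Fin ((n - 1) / 2) → W)) : ℝ)⁻¹ : ℝ) : ℂ)
      = ((Fintype.card W : ℂ)⁻¹) ^ ((n - 1) / 2) * ((Fintype.card W : ℂ)⁻¹) ^ (n / 2) := by
    rw [Fintype.card_prod, Fintype.card_fun, Fintype.card_fun, Fintype.card_fin, Fintype.card_fin]
    push_cast
    rw [mul_inv, mul_comm, inv_pow, inv_pow]
  rw [hc]
  refine congrArg (fun z => (((Fintype.card W : ℂ)⁻¹) ^ ((n - 1) / 2)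
    * ((Fintype.card W : ℂ)⁻¹) ^ (n / 2)) • z) ?_
  refine Finset.sum_congr rfl fun w1 _ => Finset.sum_congr rfl fun w2 _ => ?_
  exact block_op _ _

lemma opNorm_eq {ι : Type*} [Fintype ι] [DecidableEq ι] (A : Matrix ι ι ℂ) :
    opNorm A = ‖op A‖ := rfl

theorem block_main (ht : 1 ≤ t) (h : ⌊(2.5 : ℝ) * Real.logb 2 (4 * t)⌋ ≤ (n : ℤ))
    (hu : ∀ w, u w ∈ Matrix.unitaryGroup (Fin 4) ℂ) (δ : ℝ) (hδ0 : 0 ≤ δ)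
    (hδ : ‖((Fintype.card W : ℂ)⁻¹) • ∑ w, op (momentMat t (u w)) - G4 t‖ ≤ δ)
    (μH : Measure (Matrix.unitaryGroup (Fin n → Fin 2) ℂ)) [μH.IsHaarMeasure]
    [IsProbabilityMeasure μH] :
    opNorm (∑ w : (Fin (n / 2) → W) × (Fin ((n - 1) / 2) → W),
      (((Fintype.card ((Fin (n / 2) → W) × (Fin ((n - 1) / 2) → W)) : ℝ)⁻¹ : ℝ) : ℂ) •
        momentMat t (blockUnitary n (fun i => u (w.1 i)) (fun i => u (w.2 i)))
        - haarMomentMat t μH) ≤ Pgap t + n * δ := by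
  rw [opNorm_eq, op_sub, block_avg u, haar_eq_proj μH]
  have hP : ∀ e, ‖(WE t n e).starProjection‖ ≤ 1 := fun e =>
    ContinuousLinearMap.opNorm_le_bound _ zero_le_one fun v => by
      rw [one_mul]; exact proj_norm_le _ _
  have h1 := layer_diff (fun i => eA t n u (2 * i + 1))
    (fun i => (WE t n (2 * i + 1)).starProjection) ((n - 1) / 2) δ
    (fun i _ => eA_norm u hu _) (fun i _ => hP _)
    (fun i hi => (eA_diff u (2 * i + 1) (by omega)).trans hδ)
  have h0 := layer_diff (fun i => eA t n u (2 * i))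
    (fun i => (WE t n (2 * i)).starProjection) (n / 2) δ
    (fun i _ => eA_norm u hu _) (fun i _ => hP _)
    (fun i hi => (eA_diff u (2 * i) (by omega)).trans hδ)
  have hb := block_proj ht h
  have hm := mul_tele _ (layer (fun i => eA t n u (2 * i)) (n / 2))
    (layer (fun i => (WE t n (2 * i + 1)).starProjection) ((n - 1) / 2)) _
    (layer_norm (fun i => eA t n u (2 * i + 1)) ((n - 1) / 2) fun i _ => eA_norm u hu _)
    (layer_norm (fun i => (WE t n (2 * i)).starProjection) (n / 2) fun i _ => hP _)
  have hcount : (((n - 1) / 2 : ℕ) : ℝ) * δ + ((n / 2 : ℕ) : ℝ) * δ ≤ n * δ := by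
    rw [← add_mul]
    gcongr
    have : (n - 1) / 2 + n / 2 ≤ n := by omega
    exact_mod_cast this
  refine (norm_sub_le_norm_sub_add_norm_sub _
    (layer (fun i => (WE t n (2 * i + 1)).starProjection) ((n - 1) / 2)
        * layer (fun i => (WE t n (2 * i)).starProjection) (n / 2)) _).trans ?_
  linarith

end block

end TPE

/-- Theorem 3 of the paper: let `U_B ⊂ U(4)` be a partially invertible
universal set with invertible algebraic subset `U_M ⊊ U_B` and `a = |U_M|/|U_B|`, let
`t ≥ 1`, `n ≥ ⌊2.5·log₂(4t)⌋`, `0 < ε' < 1 − P(t)`, and (for some constant `0 < C < 1`)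
`k ≥ (10t + n²t − nt + n + log₂(1/ε')) / log₂(1/(1+(C−1)a))`. Then the `n`-qubit ensemble
`block(B₁)`, where `B₁` is the uniform ensemble on the relaxed seed `𝒰^k`, is an
`(η, t)`-tensor product expander with
`η = (P(t) + ε')/(1 − a^k)^{n−1} + (1 − (1 − a^k)^{n−1})/(1 − a^k)^{n−1}`. -/
theorem block_B1_is_TPE
    (UB UM : Finset (Matrix.unitaryGroup (Fin 4) ℂ))
    (hMB : UM ⊆ UB) (hMne : UM.Nonempty) (hproper : UM ≠ UB)
    (hMinv : ∀ U ∈ UM, U⁻¹ ∈ UM)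
    (hMalg : ∀ U ∈ UM, ∀ i j, IsAlgebraic ℚ ((U : Matrix (Fin 4) (Fin 4) ℂ) i j))
    (hdense : Dense ((Subgroup.closure (↑UB : Set (Matrix.unitaryGroup (Fin 4) ℂ)) :
        Subgroup (Matrix.unitaryGroup (Fin 4) ℂ)) : Set (Matrix.unitaryGroup (Fin 4) ℂ)))
    (t : ℕ) (ht : 1 ≤ t) :
    ∃ C : ℝ, 0 < C ∧ C < 1 ∧
      ∀ (n k : ℕ) (ε' : ℝ), 0 < ε' → ε' < 1 - Pgap t →
        ⌊(2.5 : ℝ) * Real.logb 2 (4 * t)⌋ ≤ (n : ℤ) →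
        (10 * t + (n : ℝ) ^ 2 * t - n * t + n + Real.logb 2 (1 / ε')) /
            Real.logb 2 (1 / (1 + (C - 1) * ((UM.card : ℝ) / (UB.card : ℝ)))) ≤ (k : ℝ) →
        ∀ μH : Measure (Matrix.unitaryGroup (Fin n → Fin 2) ℂ),
          μH.IsHaarMeasure → IsProbabilityMeasure μH →
          IsTPE t
            ((Pgap t + ε') / (1 - ((UM.card : ℝ) / (UB.card : ℝ)) ^ k) ^ (n - 1)
              + (1 - (1 - ((UM.card : ℝ) / (UB.card : ℝ)) ^ k) ^ (n - 1))
                / (1 - ((UM.card : ℝ) / (UB.card : ℝ)) ^ k) ^ (n - 1))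
            μH
            (fun _ : (Fin (n / 2) → RelaxedWord UB UM k) ×
                (Fin ((n - 1) / 2) → RelaxedWord UB UM k) =>
              (Fintype.card ((Fin (n / 2) → RelaxedWord UB UM k) ×
                (Fin ((n - 1) / 2) → RelaxedWord UB UM k)) : ℝ)⁻¹)
            (fun w =>
              blockUnitary n
                (fun i => wordMat fun j => ((w.1 i).1 j : Matrix.unitaryGroup (Fin 4) ℂ))
                (fun i => wordMat fun j => ((w.2 i).1 j : Matrix.unitaryGroup (Fin 4) ℂ))) := by
  obtain ⟨A, r, hA, hr, hr1, hdec⟩ :=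
    TPE.relaxed_decay (t := t) UB UM hMB hMne hproper hMinv hdense
  have hM : (0 : ℝ) < UM.card := by exact_mod_cast hMne.card_pos
  have hlt : (UM.card : ℝ) < UB.card := by
    exact_mod_cast Finset.card_lt_card (lt_of_le_of_ne hMB hproper)
  have hB : (0 : ℝ) < UB.card := hM.trans hlt
  have ha : 0 < (UM.card : ℝ) / UB.card := div_pos hM hB
  have ha1 : (UM.card : ℝ) / UB.card < 1 := (div_lt_one hB).2 hlt
  obtain ⟨C, hC, hC1, hnum⟩ := TPE.final_numerics A r _ hA hr hr1 ha ha1 t ht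
  refine ⟨C, hC, hC1, ?_⟩
  intro n k ε' hε hε1 hn hk μH hH hP
  have hPg := TPE.Pgap_pos ht
  obtain ⟨hk1, hnδ⟩ := hnum n k ε' hε (by linarith) hk
  have hmain := TPE.block_main
    (u := fun f : RelaxedWord UB UM k =>
      wordMat fun j => (f.1 j : Matrix.unitaryGroup (Fin 4) ℂ)) ht hn
    (fun f => TPE.word_unitary _) (A * r ^ k) (by positivity) (hdec k hk1) μH
  unfold IsTPE
  refine (hmain.trans (by linarith : _ ≤ Pgap t + ε')).trans ?_
  generalize (UM.card : ℝ) / UB.card = a at *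
  have hak : a ^ k < 1 := pow_lt_one₀ ha.le ha1 (by omega)
  have hak0 : 0 < a ^ k := pow_pos ha k
  have hq : 0 < (1 - a ^ k) ^ (n - 1) := pow_pos (by linarith) _
  have hq1 : (1 - a ^ k) ^ (n - 1) ≤ 1 := pow_le_one₀ (by linarith) (by linarith)
  rw [← add_div, le_div_iff₀ hq]
  have : (Pgap t + ε') * (1 - a ^ k) ^ (n - 1) ≤ (Pgap t + ε') * 1 :=
    mul_le_mul_of_nonneg_left hq1 (by linarith)
  linarith

end
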